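/- Let K be a number field of degree n_K over ℚ and fix α > 1. Then for x ≥ 2, Σ_{0 ≠ m ideal of O_K, N(m) ≥ x} N(m)^{−α} = κ/((α−1) x^{α−1}) + O(x^{−(α−1+2/(n_K+1))}), where the implied constant depends only on α and K. -/

import Mathlib

open Filter Topology
open scoped BigOperators

noncomputable section

variable (K : Type) [Field K] [NumberField K]

/-- The residue `κ` of the Dedekind zeta function of `K` at `s = 1`. -/
def kappa : ℝ :=
  (2 ^ NumberField.InfinitePlace.nrRealPlaces K *
      (2 * Real.pi) ^ NumberField.InfinitePlace.nrComplexPlaces K *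
      (NumberField.classNumber K) * NumberField.Units.regulator K) /
    ((NumberField.Units.torsionOrder K) * Real.sqrt |(NumberField.discr K : ℝ)|)

namespace LandauTail
set_option linter.unusedSectionVars false
open MeasureTheory
open scoped ContDiff

section NS
variable {P E : Type} [NormedAddCommGroup P] [NormedSpace ℝ P]
  [NormedAddCommGroup E] [NormedSpace ℝ E] [FiniteDimensional ℝ E] [MeasurableSpace E] [BorelSpace E]

/-- Uniform bound on the slice integrals of a compactly supported continuous function. -/
lemma slice_bound (μ : Measure E) [IsFiniteMeasureOnCompacts μ] (g : P × E → ℂ) (hg : Continuous g)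
    (hs : HasCompactSupport g) : ∃ C : ℝ, 0 ≤ C ∧ ∀ p, ∫ k, ‖g (p, k)‖ ∂μ ≤ C := by
  obtain ⟨M, hM⟩ := hg.bounded_above_of_compact_support hs
  have hM0 : 0 ≤ M := (norm_nonneg _).trans (hM 0)
  set S : Set E := Prod.snd '' tsupport g with hS
  have hSc : IsCompact S := hs.isCompact.image continuous_snd
  refine ⟨M * μ.real S, by positivity, fun p => ?_⟩
  have h1 : ∀ k, ‖g (p, k)‖ ≤ S.indicator (fun _ => M) k := by
    intro k
    by_cases hk : k ∈ S
    · simp [hk, hM]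
    · have : g (p, k) = 0 := by
        by_contra h
        exact hk ⟨(p, k), subset_tsupport _ h, rfl⟩
      simp [hk, this]
  calc ∫ k, ‖g (p, k)‖ ∂μ ≤ ∫ k, S.indicator (fun _ => M) k ∂μ := by
        apply integral_mono_of_nonneg
        · exact Eventually.of_forall fun k => norm_nonneg _
        · rw [integrable_indicator_iff hSc.measurableSet]
          exact integrableOn_const hSc.measure_lt_top.ne
        · exact Eventually.of_forall h1
    _ = M * μ.real S := by
        rw [integral_indicator hSc.measurableSet, setIntegral_const, smul_eq_mul, mul_comm]

lemma slice_compact (g : P × E → ℂ) (hs : HasCompactSupport g) (p : P) :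
    HasCompactSupport (fun k => g (p, k)) := by
  apply HasCompactSupport.of_support_subset_isCompact (hs.isCompact.image continuous_snd)
  intro k hk
  exact ⟨(p, k), subset_tsupport _ hk, rfl⟩

lemma integral_fderiv_zero (μ : Measure E) [μ.IsAddHaarMeasure] (g : E → ℂ) (hg : ContDiff ℝ 1 g)
    (hs : HasCompactSupport g) (l : E) : ∫ k, fderiv ℝ g k l ∂μ = 0 := by
  have hc : Continuous fun k => fderiv ℝ g k l :=
    (hg.continuous_fderiv (by simp)).clm_apply continuous_const
  have hsc : HasCompactSupport fun k => fderiv ℝ g k l := hs.fderiv_apply (𝕜 := ℝ) l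
  have := integral_mul_fderiv_eq_neg_fderiv_mul_of_integrable (μ := μ) (𝕜 := ℂ)
    (f := fun _ : E => (1 : ℂ)) (g := g) (v := l) (by simp)
    (by simpa using hc.integrable_of_hasCompactSupport hsc)
    (by simpa using hg.continuous.integrable_of_hasCompactSupport hs)
    (fun x _ => by fun_prop) (fun x _ => (hg.differentiable (by simp)) x)
  simpa using this

/-- directional derivative in the second variable -/
def DD (l : P → E) {G : Type} [NormedAddCommGroup G] [NormedSpace ℝ G] (g : P × E → G) :
    P × E → G := fun x => fderiv ℝ g x (0, l x.1)

lemma DD_contDiff {l : P → E} (hl : ContDiff ℝ ∞ l) {G : Type} [NormedAddCommGroup G]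
    [NormedSpace ℝ G] {g : P × E → G} (hg : ContDiff ℝ ∞ g) : ContDiff ℝ ∞ (DD l g) := by
  unfold DD
  have h1 : ContDiff ℝ ∞ (fderiv ℝ g) := hg.fderiv_right (by simp)
  exact h1.clm_apply (contDiff_const.prodMk (hl.comp contDiff_fst))

lemma DD_tsupport {l : P → E} {g : P × E → ℂ} : tsupport (DD l g) ⊆ tsupport g := by
  apply closure_minimal _ (isClosed_tsupport g)
  intro x hx
  by_contra h
  apply hx
  have := (notMem_tsupport_iff_eventuallyEq.mp h).fderiv_eq (𝕜 := ℝ)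
  simp [DD, this]

lemma hasFDerivAt_slice {G : Type} [NormedAddCommGroup G] [NormedSpace ℝ G] {g : P × E → G}
    (hg : ContDiff ℝ ∞ g) (p : P) (k : E) :
    HasFDerivAt (fun k => g (p, k)) ((fderiv ℝ g (p, k)).comp (ContinuousLinearMap.inr ℝ P E)) k := by
  have h1 : HasFDerivAt g (fderiv ℝ g (p, k)) (p, k) :=
    ((hg.differentiable (by simp)) _).hasFDerivAt
  exact h1.comp k (hasFDerivAt_prodMk_right p k)

lemma div_contDiff {b : P × E → ℂ} {d : P × E → ℝ} (hb : ContDiff ℝ ∞ b) (hd : ContDiff ℝ ∞ d)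
    (h : ∀ x ∈ tsupport b, d x ≠ 0) : ContDiff ℝ ∞ (fun x => b x / (d x : ℂ)) := by
  rw [contDiff_iff_contDiffAt]
  intro x
  by_cases hx : x ∈ tsupport b
  · have hd' : ContDiffAt ℝ ∞ (fun x => (d x : ℂ)) x :=
      (Complex.ofRealCLM.contDiff.comp hd).contDiffAt
    simp_rw [div_eq_mul_inv]
    exact hb.contDiffAt.mul (hd'.inv (by exact_mod_cast h x hx))
  · have : (fun x => b x / (d x : ℂ)) =ᶠ[𝓝 x] fun _ => 0 := by
      filter_upwards [notMem_tsupport_iff_eventuallyEq.mp hx] with y hy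
      simp [hy]
    exact contDiffAt_const.congr_of_eventuallyEq this

lemma div_tsupport {b : P × E → ℂ} {d : P × E → ℝ} :
    tsupport (fun x => b x / (d x : ℂ)) ⊆ tsupport b := by
  apply closure_mono
  intro x hx h
  apply hx
  simp [h]

/-- One integration by parts. -/
lemma ibp_step (μ : Measure E) [μ.IsAddHaarMeasure] {F : P × E → ℝ} (hF : ContDiff ℝ ∞ F)
    {l : P → E} (hl : ContDiff ℝ ∞ l) {b : P × E → ℂ} (hb : ContDiff ℝ ∞ b)
    (hs : HasCompactSupport b) (hne : ∀ x ∈ tsupport b, DD l F x ≠ 0)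
    {ψ : E → ℂ} (hψ : ContDiff ℝ ∞ ψ) (p : P) (t : ℝ) :
    (t * Complex.I) * ∫ k, ψ k * b (p, k) * Complex.exp (t * F (p, k) * Complex.I) ∂μ =
      - ∫ k, fderiv ℝ ψ k (l p) * (b (p, k) / ((DD l F (p, k) : ℝ) : ℂ)) *
          Complex.exp (t * F (p, k) * Complex.I) ∂μ
      - ∫ k, ψ k * DD l (fun x => b x / ((DD l F x : ℝ) : ℂ)) (p, k) *
          Complex.exp (t * F (p, k) * Complex.I) ∂μ := by
  set b1 : P × E → ℂ := fun x => b x / ((DD l F x : ℝ) : ℂ) with hb1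
  have hDF := DD_contDiff hl hF
  have hb1c : ContDiff ℝ ∞ b1 := div_contDiff hb hDF hne
  have hb1s : HasCompactSupport b1 := hs.mono' (fun x hx => div_tsupport (subset_tsupport _ hx))
  have hDb1 := DD_contDiff hl hb1c
  have hDb1s : HasCompactSupport (DD l b1) := hb1s.mono' (fun x hx => DD_tsupport (subset_tsupport _ hx))
  have hEc : ContDiff ℝ ∞ (fun k => Complex.exp (t * F (p, k) * Complex.I)) := by
    have : ContDiff ℝ ∞ (fun k => (F (p, k) : ℂ)) :=
      Complex.ofRealCLM.contDiff.comp (hF.comp (contDiff_prodMk_right p))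
    exact ((contDiff_const.mul this).mul contDiff_const).cexp
  have hsl : ContDiff ℝ ∞ fun k => b1 (p, k) := hb1c.comp (contDiff_prodMk_right p)
  set G : E → ℂ := fun k => ψ k * b1 (p, k) * Complex.exp (t * F (p, k) * Complex.I) with hG
  have hGc : ContDiff ℝ ∞ G := (hψ.mul hsl).mul hEc
  have hGs : HasCompactSupport G := ((slice_compact b1 hb1s p).mul_left).mul_right
  have h0 := integral_fderiv_zero μ G (hGc.of_le (by simp)) hGs (l p)
  have hD : ∀ k, fderiv ℝ G k (l p) =
      fderiv ℝ ψ k (l p) * b1 (p, k) * Complex.exp (t * F (p, k) * Complex.I) +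
      ψ k * DD l b1 (p, k) * Complex.exp (t * F (p, k) * Complex.I) +
      (t * Complex.I) * (ψ k * b (p, k) * Complex.exp (t * F (p, k) * Complex.I)) := by
    intro k
    have e1 := ((hψ.differentiable (by simp)) k).hasFDerivAt
    have e2 := hasFDerivAt_slice hb1c p k
    have e3 : HasFDerivAt (fun k => (F (p, k) : ℂ)) _ k :=
      Complex.ofRealCLM.hasFDerivAt.comp k (hasFDerivAt_slice hF p k)
    have e4 := ((e3.const_mul (t : ℂ)).mul_const Complex.I).cexp
    have e5 := ((e1.mul e2).mul e4).fderiv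
    rw [hG]
    erw [e5]
    have hb' : b (p, k) = b1 (p, k) * ((DD l F (p, k) : ℝ) : ℂ) := by
      by_cases hx : (p, k) ∈ tsupport b
      · simp only [hb1]
        rw [div_mul_cancel₀]
        exact_mod_cast hne _ hx
      · have : b (p, k) = 0 := image_eq_zero_of_notMem_tsupport hx
        simp [hb1, this]
    rw [hb']
    simp [DD]
    ring
  simp_rw [hD] at h0
  have c1 : Integrable (fun k => fderiv ℝ ψ k (l p) * b1 (p, k) * Complex.exp (t * F (p, k) * Complex.I)) μ := by
    apply Continuous.integrable_of_hasCompactSupport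
    · exact (((hψ.continuous_fderiv (by simp)).clm_apply continuous_const).mul hsl.continuous).mul hEc.continuous
    · exact ((slice_compact b1 hb1s p).mul_left).mul_right
  have c2 : Integrable (fun k => ψ k * DD l b1 (p, k) * Complex.exp (t * F (p, k) * Complex.I)) μ := by
    apply Continuous.integrable_of_hasCompactSupport
    · exact (hψ.continuous.mul (hDb1.continuous.comp (by fun_prop))).mul hEc.continuous
    · exact ((slice_compact _ hDb1s p).mul_left).mul_right
  have c3 : Integrable (fun k => (t * Complex.I) * (ψ k * b (p, k) * Complex.exp (t * F (p, k) * Complex.I))) μ := by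
    apply Integrable.const_mul
    apply Continuous.integrable_of_hasCompactSupport
    · exact (hψ.continuous.mul (hb.continuous.comp (by fun_prop))).mul hEc.continuous
    · exact ((slice_compact _ hs p).mul_left).mul_right
  rw [integral_add (show Integrable (fun k => _ + _) μ from c1.add c2) c3, integral_add c1 c2, integral_const_mul] at h0
  linear_combination h0

/-- Non-stationary phase, uniform in parameters. -/
lemma nonstationary (μ : Measure E) [μ.IsAddHaarMeasure] {F : P × E → ℝ} (hF : ContDiff ℝ ∞ F)
    {l : P → E} (hl : ContDiff ℝ ∞ l) (N : ℕ) : ∀ b : P × E → ℂ, ContDiff ℝ ∞ b →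
    HasCompactSupport b → (∀ x ∈ tsupport b, DD l F x ≠ 0) →
    ∃ C : ℝ, 0 ≤ C ∧ ∀ (p : P) (t : ℝ), 0 < t →
      ‖∫ k, b (p, k) * Complex.exp (t * F (p, k) * Complex.I) ∂μ‖ ≤ C / t ^ N := by
  induction N with
  | zero =>
    intro b hb hs _
    obtain ⟨C, hC, h⟩ := slice_bound μ b hb.continuous hs
    refine ⟨C, hC, fun p t _ => ?_⟩
    refine (norm_integral_le_integral_norm _).trans ?_
    simp only [pow_zero, div_one]
    refine le_trans (le_of_eq ?_) (h p)
    congr 1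
    ext k
    rw [norm_mul, ← Complex.ofReal_mul, Complex.norm_exp_ofReal_mul_I, mul_one]
  | succ N ih =>
    intro b hb hs hne
    have hDF := DD_contDiff hl hF
    set b1 : P × E → ℂ := fun x => b x / ((DD l F x : ℝ) : ℂ) with hb1
    have hb1c : ContDiff ℝ ∞ b1 := div_contDiff hb hDF hne
    have hb1s : HasCompactSupport b1 := hs.mono' (fun x hx => div_tsupport (subset_tsupport _ hx))
    have hDb1 := DD_contDiff hl hb1c
    have hDb1s : HasCompactSupport (DD l b1) := hb1s.mono' (fun x hx => DD_tsupport (subset_tsupport _ hx))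
    obtain ⟨C, hC, h⟩ := ih (DD l b1) hDb1 hDb1s
      (fun x hx => hne x (div_tsupport (DD_tsupport hx)))
    refine ⟨C, hC, fun p t ht => ?_⟩
    have := ibp_step μ hF hl hb hs hne (ψ := fun _ => 1) contDiff_const p t
    simp only [fderiv_fun_const, Pi.zero_apply, zero_apply, zero_mul,
      integral_zero, neg_zero, one_mul, zero_sub] at this
    have h2 := congrArg norm this
    rw [norm_mul, norm_mul, norm_neg, Complex.norm_I, mul_one, Complex.norm_real, Real.norm_eq_abs,
      abs_of_pos ht] at h2
    have h3 := h p t ht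
    rw [pow_succ, ← div_div, le_div_iff₀ ht, mul_comm, h2]
    exact h3

end NS
end LandauTail

namespace LandauTail
set_option linter.unusedSectionVars false
open MeasureTheory
open scoped ContDiff

section TT
variable {E : Type} 
  [NormedAddCommGroup E] [NormedSpace ℝ E] [FiniteDimensional ℝ E] [MeasurableSpace E] [BorelSpace E]

/-- The `TT*` inequality. -/
lemma tt_star (μ : Measure E) [μ.IsAddHaarMeasure] : ∃ C₀ : ℝ, 0 ≤ C₀ ∧ ∀ (u : E → ℂ),
    Continuous u → HasCompactSupport u → ∀ (C t : ℝ), 0 < t →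
    (∀ m : E, ‖∫ h, u (h + m) * (starRingEnd ℂ) (u h) ∂μ‖ ≤
        C * (1 + t * ‖m‖) ^ (-((Module.finrank ℝ E : ℝ) + 1))) →
    ‖∫ h, u h ∂μ‖ ^ 2 ≤ C * C₀ / t ^ (Module.finrank ℝ E) := by
  set d := Module.finrank ℝ E with hd
  have hintg : Integrable (fun x : E => (1 + ‖x‖) ^ (-((d : ℝ) + 1))) μ :=
    integrable_one_add_norm (by linarith)
  refine ⟨∫ x, (1 + ‖x‖) ^ (-((d : ℝ) + 1)) ∂μ, integral_nonneg fun x => by positivity, ?_⟩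
  intro u hu hs C t ht hW
  have hui : Integrable u μ := hu.integrable_of_hasCompactSupport hs
  -- the double integral
  have hcont : Continuous (fun x : E × E => (starRingEnd ℂ) (u x.1) * u (x.1 + x.2)) := by
    have : Continuous fun z : ℂ => (starRingEnd ℂ) z := Complex.continuous_conj
    exact (this.comp (hu.comp continuous_fst)).mul (hu.comp (by fun_prop))
  have hcs : HasCompactSupport (fun x : E × E => (starRingEnd ℂ) (u x.1) * u (x.1 + x.2)) := by
    apply HasCompactSupport.of_support_subset_isCompact
      ((hs.isCompact.prod hs.isCompact).image (f := fun x : E × E => (x.1, x.2 - x.1)) (by fun_prop))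
    rintro ⟨a, b⟩ hx
    refine ⟨(a, a + b), ⟨subset_tsupport _ ?_, subset_tsupport _ ?_⟩, by simp⟩
    · intro h; apply hx; simp [h]
    · intro h; apply hx; simp [h]
  have hI : Integrable (fun x : E × E => (starRingEnd ℂ) (u x.1) * u (x.1 + x.2)) (μ.prod μ) :=
    hcont.integrable_of_hasCompactSupport hcs
  have h1 : (starRingEnd ℂ) (∫ h, u h ∂μ) * ∫ h, u h ∂μ =
      ∫ m, ∫ h, u (h + m) * (starRingEnd ℂ) (u h) ∂μ ∂μ := by
    calc (starRingEnd ℂ) (∫ h, u h ∂μ) * ∫ h, u h ∂μ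
        = ∫ h, (starRingEnd ℂ) (u h) * ∫ m, u m ∂μ ∂μ := by
          rw [← integral_conj, integral_mul_const]
      _ = ∫ h, ∫ m, (starRingEnd ℂ) (u h) * u (h + m) ∂μ ∂μ := by
          congr 1; ext h
          rw [integral_const_mul, integral_add_left_eq_self u h]
      _ = ∫ m, ∫ h, (starRingEnd ℂ) (u h) * u (h + m) ∂μ ∂μ := integral_integral_swap hI
      _ = _ := by simp_rw [mul_comm]
  have h2 : ‖∫ h, u h ∂μ‖ ^ 2 = ‖∫ m, ∫ h, u (h + m) * (starRingEnd ℂ) (u h) ∂μ ∂μ‖ := by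
    rw [← h1, norm_mul, RCLike.norm_conj, sq]
  rw [h2]
  have hint2 : Integrable (fun x : E => (1 + t * ‖x‖) ^ (-((d : ℝ) + 1))) μ := by
    have := hintg.comp_smul (R := t) ht.ne'
    simpa [norm_smul, abs_of_pos ht] using this
  calc _ ≤ ∫ m, C * (1 + t * ‖m‖) ^ (-((d : ℝ) + 1)) ∂μ := by
        apply norm_integral_le_of_norm_le (hint2.const_mul C)
        exact Eventually.of_forall hW
    _ = C * ∫ m, (1 + ‖t • m‖) ^ (-((d : ℝ) + 1)) ∂μ := by
        rw [integral_const_mul]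
        simp [norm_smul, abs_of_pos ht]
    _ = _ := by
        rw [Measure.integral_comp_smul μ (fun m => (1 + ‖m‖) ^ (-((d : ℝ) + 1))) t]
        rw [abs_of_pos (by positivity), smul_eq_mul]
        field_simp
        rw [← hd]; ring
end TT
end LandauTail

namespace LandauTail
set_option linter.unusedSectionVars false
open MeasureTheory
open scoped ContDiff

/-- The multiplicative structure on `ℝ^{r₁} × ℂ^{r₂}` used in the oscillatory integral estimates. -/
structure Datum (A : Type) [NormedCommRing A] [NormedAlgebra ℝ A] [MeasurableSpace A]
    (μ : Measure A) where
  τ : A →L[ℝ] ℝ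
  σ : A →L[ℝ] A
  τσ : ∀ a, τ (σ a) = τ a
  pos : ∀ a, a ≠ 0 → 0 < τ (a * σ a)
  τ_one : τ 1 = Module.finrank ℝ A
  one_pos : 0 < Module.finrank ℝ A
  Ω : Set A
  Ω_open : IsOpen Ω
  Ω_unit : ∀ v ∈ Ω, IsUnit v
  Ω_exp : ∀ v ∈ Ω, ∀ k, v * NormedSpace.exp k ∈ Ω
  L : A → ℝ
  L_smooth : ∀ v ∈ Ω, ContDiffAt ℝ ∞ L v
  L_exp : ∀ v ∈ Ω, ∀ k, L (v * NormedSpace.exp k) = L v + τ k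
  L_meas : Measurable L
  mul_exp : ∀ (k : A), τ k = 0 → ∀ g : A → ℂ, ∫ v, g (v * NormedSpace.exp k) ∂μ = ∫ v, g v ∂μ

section AA
variable {A : Type} [NormedCommRing A] [NormedAlgebra ℝ A] [FiniteDimensional ℝ A]
  [MeasurableSpace A] [BorelSpace A]

lemma complete_A : CompleteSpace A := FiniteDimensional.complete ℝ A

lemma exp_contDiff : ContDiff ℝ ∞ (NormedSpace.exp : A → A) := by
  haveI : CompleteSpace A := complete_A
  rw [contDiff_iff_contDiffAt]
  intro x
  exact (NormedSpace.exp_analytic (𝕂 := ℝ) x).contDiffAt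

lemma exp_cont : Continuous (NormedSpace.exp : A → A) := exp_contDiff.continuous

lemma exp_add_A (x y : A) : NormedSpace.exp (x + y) = NormedSpace.exp x * NormedSpace.exp y := by
  haveI : CompleteSpace A := complete_A
  letI : NormedAlgebra ℚ A := NormedAlgebra.restrictScalars ℚ ℝ A
  exact NormedSpace.exp_add

lemma exp_mul_neg (x : A) : NormedSpace.exp x * NormedSpace.exp (-x) = 1 := by
  rw [← exp_add_A, add_neg_cancel, NormedSpace.exp_zero]

lemma exp_deriv (x : A) : HasFDerivAt (NormedSpace.exp : A → A) (NormedSpace.exp x • (1 : A →L[ℝ] A)) x := by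
  haveI : CompleteSpace A := complete_A
  exact hasFDerivAt_exp

variable {μ : Measure A} (D : Datum A μ)

/-- The hyperplane of trace zero elements. -/
abbrev Datum.H : Submodule ℝ A := LinearMap.ker D.τ.toLinearMap

lemma Datum.H_mem {a : A} : a ∈ D.H ↔ D.τ a = 0 := by simp [Datum.H]

/-- conjugation on the trace zero elements. -/
def Datum.σH (m : D.H) : D.H := ⟨D.σ m, by rw [D.H_mem, D.τσ]; exact D.H_mem.mp m.2⟩

lemma near_one (δ : ℝ) (hδ : 0 < δ) : ∃ r > 0, ∀ m : A, ‖m‖ ≤ r →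
    ‖NormedSpace.exp m - 1 - m‖ ≤ δ * ‖m‖ ∧ ‖NormedSpace.exp m - 1‖ ≤ δ := by
  have h := (exp_deriv (0 : A)).isLittleO
  have h1 := h.def hδ
  have h2 : ∀ᶠ m in 𝓝 (0 : A), ‖NormedSpace.exp m - 1‖ < δ := by
    have : Tendsto (fun m : A => ‖NormedSpace.exp m - 1‖) (𝓝 0) (𝓝 0) := by
      have hc : Continuous fun m : A => ‖NormedSpace.exp m - 1‖ := (exp_cont.sub continuous_const).norm
      have := hc.tendsto 0
      simpa using this
    exact this.eventually (gt_mem_nhds hδ)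
  obtain ⟨r, hr, hr'⟩ := Metric.eventually_nhds_iff.mp (h1.and h2)
  refine ⟨r / 2, by positivity, fun m hm => ?_⟩
  have := hr' (y := m) (by rw [dist_zero_right]; linarith)
  refine ⟨?_, this.2.le⟩
  simpa using this.1

/-- The cutoff in the `TT*` argument. -/
lemma geom (c1 c2 : ℝ) (hc1 : 0 < c1) : ∃ (r ε : ℝ) (χ : A × D.H → ℝ), 0 < r ∧ 0 < ε ∧
    ContDiff ℝ ∞ χ ∧ HasCompactSupport χ ∧
    (∀ x ∈ tsupport χ, ∀ h : A, ‖h‖ ≤ r → D.τ (x.1 * NormedSpace.exp h * x.2) ≠ 0) ∧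
    (∀ (η : A) (m : D.H), m ≠ 0 → ‖m‖ ≤ r → (∃ s : ℝ, c1 ≤ |s| ∧ |s| ≤ c2 ∧ ‖η - s • (1 : A)‖ ≤ ε) →
      χ (‖m‖⁻¹ • (η * (NormedSpace.exp (m : A) - 1)), ‖m‖⁻¹ • D.σH m) = 1) := by
  haveI : CompleteSpace A := complete_A
  -- the compact set
  set Sc : Set ℝ := {s | c1 ≤ |s| ∧ |s| ≤ c2} with hSc
  have hScc : IsCompact Sc := by
    apply Metric.isCompact_of_isClosed_isBounded
    · exact (isClosed_le continuous_const continuous_abs).inter (isClosed_le continuous_abs continuous_const)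
    · rw [isBounded_iff_forall_norm_le]
      exact ⟨c2, fun x hx => hx.2⟩
  have hσc : Continuous D.σH := by
    unfold Datum.σH
    exact (D.σ.continuous.comp continuous_subtype_val).subtype_mk _
  set T : Set (A × D.H) := (fun x : ℝ × D.H => (x.1 • (x.2 : A), D.σH x.2)) ''
    (Sc ×ˢ Metric.sphere 0 1) with hT
  have hTc : IsCompact T := by
    apply (hScc.prod (isCompact_sphere _ _)).image
    exact (continuous_fst.smul (continuous_subtype_val.comp continuous_snd)).prodMk (hσc.comp continuous_snd)
  set U : Set ((A × D.H) × A) := {x | D.τ (x.1.1 * NormedSpace.exp x.2 * x.1.2) ≠ 0} with hU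
  have hUo : IsOpen U := by
    have hc : Continuous fun x : (A × D.H) × A => D.τ (x.1.1 * NormedSpace.exp x.2 * x.1.2) := by
      apply D.τ.continuous.comp
      exact ((continuous_fst.comp continuous_fst).mul (exp_cont.comp continuous_snd)).mul
        (continuous_subtype_val.comp (continuous_snd.comp continuous_fst))
    exact isOpen_ne.preimage hc
  have hTU : T ×ˢ {(0 : A)} ⊆ U := by
    rintro ⟨x, y⟩ ⟨⟨⟨s, m⟩, ⟨hs, hm⟩, rfl⟩, hy⟩
    have hy0 : y = 0 := hy
    subst hy0
    simp only [hU, Set.mem_setOf_eq, NormedSpace.exp_zero, mul_one, Datum.σH]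
    rw [smul_mul_assoc, map_smul, smul_eq_mul]
    have hs0 : s ≠ 0 := by
      intro h
      have := hs.1
      simp [h] at this
      linarith
    have hm0 : (m : A) ≠ 0 := by
      intro h
      have : ‖m‖ = 1 := by simpa using hm
      rw [Submodule.coe_norm, h, norm_zero] at this
      exact zero_ne_one this
    exact mul_ne_zero hs0 (D.pos _ hm0).ne'
  obtain ⟨V, W, hVo, hWo, hTV, h0W, hVW⟩ := generalized_tube_lemma hTc isCompact_singleton hUo hTU
  obtain ⟨r1, hr1, hr1W⟩ := Metric.isOpen_iff.mp hWo 0 (h0W rfl)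
  obtain ⟨δ, hδ, hδV⟩ := hTc.exists_cthickening_subset_open hVo hTV
  -- smooth cutoff
  have hδc : IsCompact (Metric.cthickening δ T) := hTc.cthickening
  obtain ⟨χ, hχs, hχ1, hχ⟩ : ∃ χ : A × D.H → ℝ, ContDiff ℝ ∞ χ ∧ (∀ x ∈ Metric.cthickening (δ/2) T, χ x = 1) ∧
      (tsupport χ ⊆ Metric.cthickening δ T) := by
    have hcl : IsClosed (Metric.thickening (2 * δ / 3) T)ᶜ := Metric.isOpen_thickening.isClosed_compl
    have hdis : Disjoint (Metric.thickening (2 * δ / 3) T)ᶜ (Metric.cthickening (δ / 2) T) := by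
      rw [Set.disjoint_left]
      intro x hx hx2
      exact hx (Metric.cthickening_subset_thickening' (by positivity) (by linarith) _ hx2)
    obtain ⟨f, hf0, hf1, _⟩ := exists_contMDiffMap_zero_one_of_isClosed (n := ⊤) (modelWithCornersSelf ℝ (A × D.H)) hcl
      Metric.isClosed_cthickening hdis
    refine ⟨f, f.contMDiff.contDiff, fun x hx => by simpa using hf1 hx, ?_⟩
    refine closure_minimal ?_ Metric.isClosed_cthickening
    intro x hx
    by_contra hcon
    apply hx
    apply hf0
    intro h
    exact hcon ((Metric.thickening_subset_cthickening _ _).trans (Metric.cthickening_mono (by linarith) _) h)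
  -- choice of ε
  set c2' : ℝ := max c2 0 with hc2'
  obtain ⟨r2, hr2, hr2'⟩ := near_one (A := A) (δ / (4 * (c2' + 1)))  (by positivity)
  obtain ⟨r3, hr3, hr3'⟩ := near_one (A := A) 1 one_pos
  refine ⟨min (r1 / 2) (min r2 r3), δ / 8, χ, by positivity, by positivity, hχs,
    HasCompactSupport.of_support_subset_isCompact hδc ((subset_tsupport χ).trans hχ), ?_, ?_⟩
  · intro x hx h hh
    have h1 := hδV (hχ hx)
    have h2 : h ∈ W := hr1W (by
      rw [mem_ball_zero_iff]
      have := hh.trans (min_le_left _ _); linarith)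
    exact hVW (Set.mk_mem_prod h1 h2)
  · rintro η m hm hmr ⟨s, hs1, hs2, hs3⟩
    apply hχ1
    have hmn : 0 < ‖m‖ := norm_pos_iff.mpr hm
    have ht : (‖m‖⁻¹ • (s • (m : A)), ‖m‖⁻¹ • D.σH m) ∈ T := by
      refine ⟨(s, ‖m‖⁻¹ • m), ⟨⟨hs1, hs2⟩, ?_⟩, ?_⟩
      · rw [mem_sphere_zero_iff_norm, norm_smul, norm_inv, norm_norm, inv_mul_cancel₀ hmn.ne']
      · ext
        · simp [smul_comm s]
        · simp [Datum.σH]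
    apply Metric.mem_cthickening_of_dist_le _ _ _ _ ht
    rw [Prod.dist_eq, dist_self, max_eq_left dist_nonneg, dist_eq_norm]
    have e1 := (hr2' m (hmr.trans ((min_le_right _ _).trans (min_le_left _ _)))).1
    have e2 := (hr3' m (hmr.trans ((min_le_right _ _).trans (min_le_right _ _)))).1
    rw [← Submodule.coe_norm] at e1 e2
    have e3 : ‖NormedSpace.exp (m : A) - 1‖ ≤ 2 * ‖m‖ := by
      calc _ = ‖(NormedSpace.exp (m : A) - 1 - m) + m‖ := by abel_nf
        _ ≤ _ := (norm_add_le _ _).trans (by rw [← Submodule.coe_norm]; linarith)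
    have e4 : ‖m‖⁻¹ • (η * (NormedSpace.exp (m : A) - 1)) - ‖m‖⁻¹ • (s • (m : A)) =
        ‖m‖⁻¹ • ((η - s • (1 : A)) * (NormedSpace.exp (m : A) - 1) + s • (NormedSpace.exp (m : A) - 1 - m)) := by
      rw [← smul_sub]
      congr 1
      simp only [sub_mul, mul_sub, smul_mul_assoc, one_mul, smul_sub, mul_one]
      abel
    rw [e4, norm_smul, norm_inv, norm_norm, inv_mul_le_iff₀ hmn]
    have hpos : 0 < c2' + 1 := by positivity
    have hsc : |s| ≤ c2' + 1 := hs2.trans ((le_max_left _ _).trans (by linarith))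
    calc _ ≤ ‖η - s • (1 : A)‖ * ‖NormedSpace.exp (m : A) - 1‖ + |s| * ‖NormedSpace.exp (m : A) - 1 - m‖ := by
          refine (norm_add_le _ _).trans (add_le_add (norm_mul_le _ _) ?_)
          rw [norm_smul, Real.norm_eq_abs]
      _ ≤ δ / 8 * (2 * ‖m‖) + (c2' + 1) * (δ / (4 * (c2' + 1)) * ‖m‖) := by gcongr
      _ = ‖m‖ * (δ / 2) := by field_simp; norm_num
end AA
end LandauTail

namespace LandauTail
set_option linter.unusedSectionVars false
open MeasureTheory
open scoped ContDiff

section PUSH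
variable {A : Type} [NormedCommRing A] [NormedAlgebra ℝ A] [FiniteDimensional ℝ A]
  [MeasurableSpace A] [BorelSpace A] {μ : Measure A} [μ.IsAddHaarMeasure] (D : Datum A μ)

lemma smul_eq_exp (s : ℝ) (v : A) : Real.exp s • v = v * NormedSpace.exp (s • (1 : A)) := by
  rw [← Algebra.algebraMap_eq_smul_one s, ← NormedSpace.algebraMap_exp_comm, ← Real.exp_eq_exp_ℝ,
    Algebra.smul_def, mul_comm]

lemma L_smul {v : A} (hv : v ∈ D.Ω) (s : ℝ) :
    D.L (Real.exp s • v) = D.L v + Module.finrank ℝ A * s := by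
  rw [smul_eq_exp, D.L_exp v hv, map_smul, D.τ_one, smul_eq_mul, mul_comm]

lemma Ω_smul {v : A} (hv : v ∈ D.Ω) (s : ℝ) : Real.exp s • v ∈ D.Ω := by
  rw [smul_eq_exp]; exact D.Ω_exp v hv _

lemma push_shift {w : A → ENNReal} (hw : Measurable w) (hws : ∀ (s : ℝ) v, w (Real.exp s • v) = w v)
    (hwΩ : ∀ v, w v ≠ 0 → v ∈ D.Ω) {f : ℝ → ENNReal} (hf : Measurable f) (t : ℝ) :
    ∫⁻ v, f (D.L v - t) * w v ∂μ = ENNReal.ofReal (Real.exp t) * ∫⁻ v, f (D.L v) * w v ∂μ := by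
  have hn : (0 : ℝ) < Module.finrank ℝ A := by exact_mod_cast D.one_pos
  set s : ℝ := - t / Module.finrank ℝ A with hs
  have h1 : ∀ v, f (D.L v - t) * w v = (fun v => f (D.L v) * w v) (Real.exp s • v) := by
    intro v
    simp only [hws]
    by_cases hv : w v = 0
    · simp [hv]
    · rw [L_smul D (hwΩ v hv), hs]
      congr 2
      field_simp
      ring
  simp_rw [h1]
  have hm : Measurable (fun v => f (D.L v) * w v) := (hf.comp D.L_meas).mul hw
  rw [← lintegral_map (μ := μ) (f := fun v => f (D.L v) * w v) (g := fun v : A => Real.exp s • v) hm (by fun_prop),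
    Measure.map_addHaar_smul μ (Real.exp_pos s).ne', lintegral_smul_measure, smul_eq_mul]
  congr 2
  rw [← Real.exp_nat_mul, ← Real.exp_neg, abs_of_pos (Real.exp_pos _)]
  congr 1
  rw [hs]; field_simp

lemma push_identity {w : A → ENNReal} (hw : Measurable w) (hws : ∀ (s : ℝ) v, w (Real.exp s • v) = w v)
    (hwΩ : ∀ v, w v ≠ 0 → v ∈ D.Ω) {f f0 : ℝ → ENNReal} (hf : Measurable f) (hf0 : Measurable f0) :
    (∫⁻ t, f t * ENNReal.ofReal (Real.exp t)) * ∫⁻ v, f0 (D.L v) * w v ∂μ =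
    (∫⁻ t, f0 t * ENNReal.ofReal (Real.exp t)) * ∫⁻ v, f (D.L v) * w v ∂μ := by
  have hLm := D.L_meas
  have key : ∀ g g0 : ℝ → ENNReal, Measurable g → Measurable g0 →
      (∫⁻ t, g t * ENNReal.ofReal (Real.exp t)) * ∫⁻ v, g0 (D.L v) * w v ∂μ =
      ∫⁻ v, (∫⁻ t, g t * g0 (D.L v - t)) * w v ∂μ := by
    intro g g0 hg hg0
    rw [← lintegral_mul_const _ (by fun_prop)]
    simp_rw [mul_assoc]
    simp_rw [← push_shift D hw hws hwΩ hg0]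
    have : ∀ v, (∫⁻ t, g t * g0 (D.L v - t)) * w v = ∫⁻ t, g t * (g0 (D.L v - t) * w v) := by
      intro v
      rw [← lintegral_mul_const _ (by fun_prop)]
      simp_rw [mul_assoc]
    simp_rw [this]
    rw [lintegral_lintegral_swap]
    · congr 1; ext t
      rw [lintegral_const_mul]
      fun_prop
    · apply Measurable.aemeasurable
      unfold Function.uncurry
      fun_prop
  rw [key f f0 hf hf0, key f0 f hf0 hf]
  congr 1; ext v
  congr 1
  rw [← lintegral_sub_left_eq_self _ (D.L v)]
  congr 1; ext t
  rw [sub_sub_cancel, mul_comm]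

lemma push_bound {S : Set A} (hS : IsCompact S) (hSΩ : S ⊆ D.Ω) : ∃ C : ℝ, 0 ≤ C ∧
    ∀ φ : ℝ → ℂ, Continuous φ → HasCompactSupport φ →
      ∫ v in S, ‖φ (D.L v)‖ ∂μ ≤ C * ∫ u, ‖φ u‖ := by
  have : ProperSpace A := FiniteDimensional.proper ℝ A
  have hn : (0 : ℝ) < Module.finrank ℝ A := by exact_mod_cast D.one_pos
  obtain ⟨S2, hS2, hSS2, hS2Ω⟩ := exists_compact_between hS D.Ω_open hSΩ
  have hLc : ContinuousOn D.L D.Ω := fun v hv => (D.L_smooth v hv).continuousAt.continuousWithinAt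
  obtain ⟨R, hR⟩ := hS2.exists_bound_of_continuousOn (hLc.mono hS2Ω)
  set cone : Set A := ⋃ s : ℝ, (fun v => Real.exp s • v) ⁻¹' (interior S2) with hcone
  have hco : IsOpen cone := isOpen_iUnion fun s => isOpen_interior.preimage (by fun_prop)
  have hcΩ : cone ⊆ D.Ω := by
    intro v hv
    obtain ⟨s, hs⟩ := Set.mem_iUnion.mp hv
    have := Ω_smul D (hS2Ω (interior_subset hs)) (-s)
    simpa [smul_smul, ← Real.exp_add] using this
  set w : A → ENNReal := cone.indicator 1 with hw
  have hwm : Measurable w := measurable_one.indicator hco.measurableSet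
  have hws : ∀ (s : ℝ) v, w (Real.exp s • v) = w v := by
    intro s v
    have : Real.exp s • v ∈ cone ↔ v ∈ cone := by
      simp only [hcone, Set.mem_iUnion, Set.mem_preimage, smul_smul, ← Real.exp_add]
      constructor
      · rintro ⟨i, hi⟩; exact ⟨_, hi⟩
      · rintro ⟨i, hi⟩; exact ⟨i - s, by simpa using hi⟩
    by_cases hv : v ∈ cone
    · rw [hw, Set.indicator_of_mem hv, Set.indicator_of_mem (this.mpr hv)]; rfl
    · rw [hw, Set.indicator_of_notMem hv, Set.indicator_of_notMem (fun h => hv (this.mp h))]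
  have hwΩ : ∀ v, w v ≠ 0 → v ∈ D.Ω := fun v hv => hcΩ (Set.mem_of_indicator_ne_zero hv)
  set f0 : ℝ → ENNReal := (Set.Ico 0 1).indicator 1 with hf0
  have hf0m : Measurable f0 := measurable_one.indicator measurableSet_Ico
  -- finiteness
  have hfin : ∫⁻ v, f0 (D.L v) * w v ∂μ < ⊤ := by
    set Q : Set A := (fun x : ℝ × A => Real.exp x.1 • x.2) ''
      (Set.Icc (-(|R| + 1) / Module.finrank ℝ A) ((|R| + 1) / Module.finrank ℝ A) ×ˢ S2) with hQ
    have hQc : IsCompact Q := (isCompact_Icc.prod hS2).image (by fun_prop)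
    refine lt_of_le_of_lt (b := ∫⁻ v, Q.indicator 1 v ∂μ) (lintegral_mono fun v => ?_) ?_
    · by_cases hv : v ∈ cone
      · by_cases hv2 : D.L v ∈ Set.Ico (0 : ℝ) 1
        · have : v ∈ Q := by
            obtain ⟨s, hs⟩ := Set.mem_iUnion.mp hv
            refine ⟨(-s, Real.exp s • v), ⟨?_, interior_subset hs⟩, by simp [smul_smul, ← Real.exp_add]⟩
            have h1 := hR _ (interior_subset hs)
            rw [L_smul D (hcΩ hv), Real.norm_eq_abs, abs_le] at h1
            have h3 := le_abs_self R
            constructor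
            · simp only; rw [div_le_iff₀ hn]; linarith [hv2.1]
            · simp only; rw [le_div_iff₀ hn]; linarith [hv2.2]
          simp [hf0, hw, hv, hv2, this]
        · simp [hf0, hv2]
      · simp [hw, hv]
    · rw [lintegral_indicator_one hQc.measurableSet]
      exact hQc.measure_lt_top
  have hone : 1 ≤ ∫⁻ t, f0 t * ENNReal.ofReal (Real.exp t) := by
    calc (1 : ENNReal) = ∫⁻ t : ℝ, (Set.Ico (0 : ℝ) 1).indicator 1 t := by
          rw [lintegral_indicator_one measurableSet_Ico]; simp
      _ ≤ _ := by
          apply lintegral_mono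
          intro t
          by_cases ht : t ∈ Set.Ico (0 : ℝ) 1
          · simp [hf0, ht, ht.1]
          · simp [ht]
  set B := ∫⁻ v, f0 (D.L v) * w v ∂μ with hB
  refine ⟨Real.exp R * B.toReal, by positivity, fun φ hφ hφs => ?_⟩
  set f : ℝ → ENNReal := (Set.Iic R).indicator (fun u => ‖φ u‖ₑ) with hf
  have hfm : Measurable f := (by fun_prop : Measurable fun u => ‖φ u‖ₑ).indicator measurableSet_Iic
  have id := push_identity D hwm hws hwΩ hfm hf0m
  have h1 : ∫⁻ v in S, ‖φ (D.L v)‖ₑ ∂μ ≤ ∫⁻ v, f (D.L v) * w v ∂μ := by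
    rw [← lintegral_indicator hS.measurableSet]
    apply lintegral_mono
    intro v
    by_cases hv : v ∈ S
    · have hc : v ∈ cone := Set.mem_iUnion.mpr ⟨0, by simpa using hSS2 hv⟩
      have hl : D.L v ≤ R := (le_abs_self _).trans (hR v (interior_subset (hSS2 hv)))
      simp [hv, hw, hc, hf, hl]
    · simp [hv]
  have h2 : ∫⁻ t, f t * ENNReal.ofReal (Real.exp t) ≤ ENNReal.ofReal (Real.exp R) * ∫⁻ u, ‖φ u‖ₑ := by
    rw [← lintegral_const_mul _ (by fun_prop)]
    apply lintegral_mono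
    intro u
    by_cases hu : u ∈ Set.Iic R
    · simp only [hf, Set.indicator_of_mem hu]
      rw [mul_comm]
      gcongr
      exact hu
    · simp [hf, hu]
  have h3 : ∫⁻ v in S, ‖φ (D.L v)‖ₑ ∂μ ≤ ENNReal.ofReal (Real.exp R) * (∫⁻ u, ‖φ u‖ₑ) * B := by
    calc _ ≤ ∫⁻ v, f (D.L v) * w v ∂μ := h1
      _ ≤ (∫⁻ t, f0 t * ENNReal.ofReal (Real.exp t)) * ∫⁻ v, f (D.L v) * w v ∂μ := le_mul_of_one_le_left zero_le hone
      _ = _ := id.symm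
      _ ≤ _ := by gcongr
  have hφi : Integrable φ := hφ.integrable_of_hasCompactSupport hφs
  have hφf : ∫⁻ u, ‖φ u‖ₑ ≠ ⊤ := hφi.2.ne
  rw [integral_norm_eq_lintegral_enorm (f := fun v => φ (D.L v)) (hφ.measurable.comp D.L_meas).aestronglyMeasurable,
    integral_norm_eq_lintegral_enorm hφi.1]
  have h4 := ENNReal.toReal_mono (ENNReal.mul_ne_top (ENNReal.mul_ne_top ENNReal.ofReal_ne_top hφf) hfin.ne) h3
  rw [ENNReal.toReal_mul, ENNReal.toReal_mul, ENNReal.toReal_ofReal (Real.exp_pos R).le] at h4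
  linarith
end PUSH
end LandauTail

namespace LandauTail
set_option linter.unusedSectionVars false
open MeasureTheory
open scoped ContDiff

section OSC
variable {A : Type} [NormedCommRing A] [NormedAlgebra ℝ A] [FiniteDimensional ℝ A]
  [MeasurableSpace A] [BorelSpace A] {μ : Measure A} [μ.IsAddHaarMeasure] (D : Datum A μ)

/-- The oscillatory integral. -/
def JJ (φ : ℝ → ℂ) (a : A × A → ℂ) (y : A) (t : ℝ) : ℂ :=
  ∫ v, φ (D.L v) * a (y, v) * Complex.exp (t * D.τ (y * v) * Complex.I) ∂μ

/-- Admissible amplitudes. -/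
def Amp (a : A × A → ℂ) : Prop :=
  ContDiff ℝ ∞ a ∧ HasCompactSupport a ∧ ∀ x ∈ tsupport a, x.2 ∈ D.Ω

lemma exists_rho (r : ℝ) (hr : 0 < r) : ∃ ρ : D.H → ℝ, ContDiff ℝ ∞ ρ ∧ HasCompactSupport ρ ∧
    ∫ h, ρ h ∂(Measure.addHaar : Measure D.H) = 1 ∧ ∀ h ∈ tsupport ρ, ‖h‖ ≤ r := by
  let f : ContDiffBump (0 : D.H) := ⟨r / 2, r, by linarith, by linarith⟩
  refine ⟨f.normed Measure.addHaar, f.contDiff_normed, f.hasCompactSupport_normed, f.integral_normed, ?_⟩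
  intro h hh
  rw [f.tsupport_normed_eq] at hh
  simpa [f] using hh

/-- The fiber integral. -/
def GG (ρ : D.H → ℝ) (a : A × A → ℂ) (y : A) (t : ℝ) (v : A) : ℂ :=
  ∫ h : D.H, (ρ h : ℂ) * a (y, v * NormedSpace.exp (h : A)) *
    Complex.exp (t * D.τ (y * v * NormedSpace.exp (h : A)) * Complex.I) ∂Measure.addHaar

lemma expH_cont : Continuous fun h : D.H => NormedSpace.exp (h : A) :=
  exp_cont.comp continuous_subtype_val

lemma avg_cont {a : A × A → ℂ} (ha : Amp D a) {φ : ℝ → ℂ} (hφ : Continuous φ) (y : A) (t : ℝ) :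
    Continuous (fun v => φ (D.L v) * a (y, v) * Complex.exp (t * D.τ (y * v) * Complex.I)) ∧
    HasCompactSupport (fun v => φ (D.L v) * a (y, v) * Complex.exp (t * D.τ (y * v) * Complex.I)) := by
  constructor
  · rw [continuous_iff_continuousAt]
    intro v
    by_cases hv : (y, v) ∈ tsupport a
    · have h1 : ContinuousAt D.L v := (D.L_smooth v (ha.2.2 _ hv)).continuousAt
      have h2 : ContinuousAt (fun v => φ (D.L v)) v := hφ.continuousAt.comp h1
      have h3 : Continuous (fun v => a (y, v)) := ha.1.continuous.comp (by fun_prop)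
      exact (h2.mul h3.continuousAt).mul (by fun_prop)
    · have h1 : ∀ᶠ z in 𝓝 v, a (y, z) = 0 := by
        have := notMem_tsupport_iff_eventuallyEq.mp hv
        exact (Continuous.prodMk_right y).continuousAt.eventually this
      have : (fun v => φ (D.L v) * a (y, v) * Complex.exp (t * D.τ (y * v) * Complex.I)) =ᶠ[𝓝 v] fun _ => 0 := by
        filter_upwards [h1] with z hy
        simp [hy]
      exact continuousAt_const.congr this.symm
  · exact ((slice_compact a ha.2.1 y).mul_left).mul_right

lemma havg {a : A × A → ℂ} (ha : Amp D a) {φ : ℝ → ℂ} (hφ : Continuous φ) (y : A) (t : ℝ)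
    {ρ : D.H → ℝ} (hρ : Continuous ρ) (hρs : HasCompactSupport ρ)
    (hρ1 : ∫ h, ρ h ∂(Measure.addHaar : Measure D.H) = 1) :
    JJ D φ a y t = ∫ v, φ (D.L v) * GG D ρ a y t v ∂μ := by
  obtain ⟨hgc, hgs⟩ := avg_cont D ha hφ y t
  unfold JJ
  set g := fun v => φ (D.L v) * a (y, v) * Complex.exp (t * D.τ (y * v) * Complex.I) with hg
  have h1 : ∀ h : D.H, ∫ v, (ρ h : ℂ) * g (v * NormedSpace.exp (h : A)) ∂μ = ρ h * ∫ v, g v ∂μ := by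
    intro h
    rw [integral_const_mul, D.mul_exp _ (D.H_mem.mp h.2)]
  have h2 : ∫ v, g v ∂μ = ∫ h : D.H, ∫ v, (ρ h : ℂ) * g (v * NormedSpace.exp (h : A)) ∂μ ∂Measure.addHaar := by
    simp_rw [h1]
    rw [integral_mul_const, integral_complex_ofReal, hρ1]
    simp
  rw [h2, integral_integral_swap]
  · congr 1; ext v
    unfold GG
    rw [← integral_const_mul]
    congr 1; ext h
    simp only [hg]
    by_cases hz : a (y, v * NormedSpace.exp (h : A)) = 0
    · simp [hz]
    · have h3 := ha.2.2 _ (subset_tsupport a hz)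
      simp only at h3
      have h4 := D.L_exp _ h3 (-(h : A))
      rw [mul_assoc, exp_mul_neg, mul_one, map_neg, D.H_mem.mp h.2, neg_zero, add_zero] at h4
      rw [h4, ← mul_assoc y v]
      ring
  · apply Continuous.integrable_of_hasCompactSupport
    · unfold Function.uncurry
      have := expH_cont D
      exact ((Complex.continuous_ofReal.comp (hρ.comp continuous_fst))).mul
        (hgc.comp (continuous_snd.mul (this.comp continuous_fst)))
    · apply HasCompactSupport.of_support_subset_isCompact
        ((hρs.isCompact.prod hgs.isCompact).image (f := fun x : D.H × A =>
          (x.1, x.2 * NormedSpace.exp (-(x.1 : A)))) ?_)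
      · rintro ⟨h, v⟩ hx
        refine ⟨(h, v * NormedSpace.exp (h : A)), ⟨subset_tsupport _ ?_, subset_tsupport _ ?_⟩, ?_⟩
        · intro h0; apply hx; simp [Function.uncurry, h0]
        · intro h0; apply hx; simp only [Function.uncurry]; simp only at h0; rw [h0]; simp
        · simp [mul_assoc, exp_mul_neg]
      · exact continuous_fst.prodMk (continuous_snd.mul (exp_cont.comp (continuous_subtype_val.comp continuous_fst).neg))

lemma avg_bound {a : A × A → ℂ} (ha : Amp D a) 
    {ρ : D.H → ℝ} (hρ : Continuous ρ) (hρs : HasCompactSupport ρ)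
    (hρ1 : ∫ h, ρ h ∂(Measure.addHaar : Measure D.H) = 1) : ∃ C : ℝ, 0 ≤ C ∧
    ∀ φ : ℝ → ℂ, Continuous φ → HasCompactSupport φ → ∀ (y : A) (t B : ℝ),
      (∀ v, ‖GG D ρ a y t v‖ ≤ B) → ‖JJ D φ a y t‖ ≤ C * B * ∫ u, ‖φ u‖ := by
  set S : Set A := (fun x : (A × A) × D.H => x.1.2 * NormedSpace.exp (-(x.2 : A))) ''
    (tsupport a ×ˢ tsupport ρ) with hS
  have hSc : IsCompact S := by
    apply (ha.2.1.isCompact.prod hρs.isCompact).image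
    exact (continuous_snd.comp continuous_fst).mul (exp_cont.comp (continuous_subtype_val.comp continuous_snd).neg)
  have hSΩ : S ⊆ D.Ω := by
    rintro _ ⟨⟨⟨y, v⟩, h⟩, ⟨hx1, hx2⟩, rfl⟩
    exact D.Ω_exp _ (ha.2.2 _ hx1) _
  obtain ⟨C, hC, hpush⟩ := push_bound D hSc hSΩ
  refine ⟨C, hC, fun φ hφ hφs y t B hB => ?_⟩
  have hB0 : 0 ≤ B := (norm_nonneg _).trans (hB 0)
  rw [havg D ha hφ y t hρ hρs hρ1]
  have hz : ∀ v, v ∉ S → GG D ρ a y t v = 0 := by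
    intro v hv
    unfold GG
    apply integral_eq_zero_of_ae
    refine Eventually.of_forall fun h => ?_
    simp only [Pi.zero_apply]
    by_contra hne
    apply hv
    refine ⟨((y, v * NormedSpace.exp (h : A)), h), ⟨subset_tsupport _ ?_, subset_tsupport _ ?_⟩, ?_⟩
    · intro h0; apply hne; rw [h0]; simp
    · intro h0; apply hne; rw [h0]; simp
    · simp [mul_assoc, exp_mul_neg]
  rw [← setIntegral_eq_integral_of_forall_compl_eq_zero (s := S) (fun v hv => by rw [hz v hv, mul_zero])]
  have hLc : ContinuousOn D.L S := fun v hv => (D.L_smooth v (hSΩ hv)).continuousAt.continuousWithinAt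
  have hintg : IntegrableOn (fun v => ‖φ (D.L v)‖) S μ :=
    ((hφ.norm.comp_continuousOn hLc)).integrableOn_compact hSc
  calc _ ≤ ∫ v in S, B * ‖φ (D.L v)‖ ∂μ := by
        apply norm_integral_le_of_norm_le (hintg.const_mul B)
        refine Eventually.of_forall fun v => ?_
        rw [norm_mul, mul_comm]
        gcongr
        exact hB v
    _ = B * ∫ v in S, ‖φ (D.L v)‖ ∂μ := integral_const_mul _ _
    _ ≤ B * (C * ∫ u, ‖φ u‖) := by gcongr; exact hpush φ hφ hφs
    _ = _ := by ring

/-- derivative of the phase. -/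
lemma DD_phase {P : Type} [NormedAddCommGroup P] [NormedSpace ℝ P] {ζ : P → A} (hζ : ContDiff ℝ ∞ ζ)
    (l : P → D.H) : ContDiff ℝ ∞ (fun x : P × D.H => D.τ (ζ x.1 * NormedSpace.exp (x.2 : A))) ∧
    ∀ p h, DD l (fun x : P × D.H => D.τ (ζ x.1 * NormedSpace.exp (x.2 : A))) (p, h) =
      D.τ (ζ p * NormedSpace.exp (h : A) * l p) := by
  have hs : ContDiff ℝ ∞ (fun x : P × D.H => D.τ (ζ x.1 * NormedSpace.exp (x.2 : A))) := by
    apply D.τ.contDiff.comp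
    exact (hζ.comp contDiff_fst).mul (exp_contDiff.comp (D.H.subtypeL.contDiff.comp contDiff_snd))
  refine ⟨hs, fun p h => ?_⟩
  have h1 := hasFDerivAt_slice hs p h
  have h2 : HasFDerivAt (fun k : D.H => NormedSpace.exp (k : A)) _ h :=
    (exp_deriv (h : A)).comp h D.H.subtypeL.hasFDerivAt
  have h3 : HasFDerivAt (fun k : D.H => D.τ (ζ p * NormedSpace.exp (k : A))) _ h :=
    D.τ.hasFDerivAt.comp h (h2.const_mul (ζ p))
  have h4 := h1.unique h3
  have h5 := congrArg (fun T : D.H →L[ℝ] ℝ => T (l p)) h4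
  simp only [DD]
  simp at h5
  rw [h5, mul_assoc]

/-- projection to trace zero. -/
def Datum.π (x : A) : D.H := ⟨x - (D.τ x / Module.finrank ℝ A) • (1 : A), by
  have hn : (0 : ℝ) < Module.finrank ℝ A := by exact_mod_cast D.one_pos
  rw [D.H_mem, map_sub, map_smul, D.τ_one, smul_eq_mul, div_mul_cancel₀ _ hn.ne', sub_self]⟩

lemma π_contDiff : ContDiff ℝ ∞ D.π := by
  have : D.π = fun x => (LinearMap.toContinuousLinearMap
      (({ toFun := D.π
          map_add' := fun x z => by
            ext; simp [Datum.π, add_div, add_smul]; abel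
          map_smul' := fun c x => by
            ext; simp [Datum.π, smul_sub, smul_smul, mul_div_assoc] } : A →ₗ[ℝ] D.H))) x := by
    ext x; simp
  rw [this]
  exact ContinuousLinearMap.contDiff _

lemma σH_contDiff : ContDiff ℝ ∞ D.σH := by
  have : D.σH = fun x => (LinearMap.toContinuousLinearMap
      (({ toFun := D.σH
          map_add' := fun x z => by ext; simp [Datum.σH]
          map_smul' := fun c x => by ext; simp [Datum.σH] } : D.H →ₗ[ℝ] D.H))) x := by
    ext x; simp
  rw [this]
  exact ContinuousLinearMap.contDiff _

lemma π_pos {x : A} (hx : D.π x ≠ 0) : 0 < D.τ (x * D.σH (D.π x)) := by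
  have h0 : (D.π x : A) ≠ 0 := by simpa using hx
  have h1 : x = (D.π x : A) + (D.τ x / Module.finrank ℝ A) • (1 : A) := by simp [Datum.π]
  conv_rhs => rw [h1]
  have h2 : D.τ (D.σH (D.π x) : A) = 0 := D.H_mem.mp (D.σH (D.π x)).2
  rw [add_mul, map_add, smul_mul_assoc, map_smul, one_mul]
  rw [← h1, h2, smul_zero, add_zero]
  exact D.pos _ h0

/-- Away from the stationary direction. -/
lemma case_b {a : A × A → ℂ} (ha : Amp D a) (hne : ∀ x ∈ tsupport a, D.π (x.1 * x.2) ≠ 0) (N : ℕ) :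
    ∃ C : ℝ, 0 ≤ C ∧ ∀ φ : ℝ → ℂ, Continuous φ → HasCompactSupport φ → ∀ (y : A) (t : ℝ), 0 < t →
      ‖JJ D φ a y t‖ ≤ C / t ^ N * ∫ u, ‖φ u‖ := by
  have hπ := (π_contDiff D)
  have hσ := (σH_contDiff D)
  -- choose the radius
  set U : Set ((A × A) × D.H) := {x | D.τ (x.1.1 * (x.1.2 * NormedSpace.exp (-(x.2 : A))) * NormedSpace.exp (x.2 : A) *
    D.σH (D.π (x.1.1 * (x.1.2 * NormedSpace.exp (-(x.2 : A)))))) ≠ 0} with hU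
  have hUo : IsOpen U := by
    have e1 : Continuous fun x : (A × A) × D.H => NormedSpace.exp (x.2 : A) := (expH_cont D).comp continuous_snd
    have e2 : Continuous fun x : (A × A) × D.H => NormedSpace.exp (-(x.2 : A)) :=
      exp_cont.comp (continuous_subtype_val.comp continuous_snd).neg
    have e3 : Continuous fun x : (A × A) × D.H => x.1.1 * (x.1.2 * NormedSpace.exp (-(x.2 : A))) :=
      (continuous_fst.comp continuous_fst).mul ((continuous_snd.comp continuous_fst).mul e2)
    have hc : Continuous fun x : (A × A) × D.H => D.τ (x.1.1 * (x.1.2 * NormedSpace.exp (-(x.2 : A))) * NormedSpace.exp (x.2 : A) *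
        D.σH (D.π (x.1.1 * (x.1.2 * NormedSpace.exp (-(x.2 : A)))))) :=
      D.τ.continuous.comp ((e3.mul e1).mul (continuous_subtype_val.comp (hσ.continuous.comp (hπ.continuous.comp e3))))
    exact isOpen_ne.preimage hc
  have hTU : tsupport a ×ˢ {(0 : D.H)} ⊆ U := by
    rintro ⟨x, y'⟩ ⟨hx, hy⟩
    have hy0 : y' = 0 := hy
    subst hy0
    have := (π_pos D (hne x hx)).ne'
    simpa [hU] using this
  obtain ⟨V, W, hVo, hWo, hTV, h0W, hVW⟩ := generalized_tube_lemma ha.2.1.isCompact isCompact_singleton hUo hTU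
  obtain ⟨r, hr, hrW⟩ := Metric.isOpen_iff.mp hWo 0 (h0W rfl)
  obtain ⟨ρ, hρ, hρs, hρ1, hρr⟩ := exists_rho D (r / 2) (by positivity)
  obtain ⟨C1, hC1, h1⟩ := avg_bound D ha hρ.continuous hρs hρ1
  -- nonstationary phase
  set ζ : A × A → A := fun p => p.1 * p.2 with hζ
  have hζc : ContDiff ℝ ∞ ζ := contDiff_fst.mul contDiff_snd
  set l : A × A → D.H := fun p => D.σH (D.π (p.1 * p.2)) with hl
  have hlc : ContDiff ℝ ∞ l := hσ.comp (hπ.comp hζc)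
  obtain ⟨hF, hDD⟩ := DD_phase D hζc l
  set b : (A × A) × D.H → ℂ := fun x => (ρ x.2 : ℂ) * a (x.1.1, x.1.2 * NormedSpace.exp (x.2 : A)) with hb
  have hec : ContDiff ℝ ∞ (fun x : (A × A) × D.H => NormedSpace.exp (x.2 : A)) :=
    exp_contDiff.comp (D.H.subtypeL.contDiff.comp contDiff_snd)
  have hbc : ContDiff ℝ ∞ b := by
    refine (Complex.ofRealCLM.contDiff.comp (hρ.comp contDiff_snd)).mul (ha.1.comp ?_)
    exact (contDiff_fst.comp contDiff_fst).prodMk ((contDiff_snd.comp contDiff_fst).mul hec)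
  set Q : Set ((A × A) × D.H) := (fun x : (A × A) × D.H => ((x.1.1, x.1.2 * NormedSpace.exp (-(x.2 : A))), x.2)) ''
    (tsupport a ×ˢ tsupport ρ) with hQ
  have hQc : IsCompact Q := by
    apply (ha.2.1.isCompact.prod hρs.isCompact).image
    refine ((continuous_fst.comp continuous_fst).prodMk ((continuous_snd.comp continuous_fst).mul ?_)).prodMk continuous_snd
    exact exp_cont.comp (continuous_subtype_val.comp continuous_snd).neg
  have hbQ : Function.support b ⊆ Q := by
    rintro ⟨⟨y, v⟩, h⟩ hx
    refine ⟨((y, v * NormedSpace.exp (h : A)), h), ⟨subset_tsupport _ ?_, subset_tsupport _ ?_⟩, ?_⟩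
    · intro h0; apply hx; simp only [hb]; rw [h0]; simp
    · intro h0; apply hx; simp only [hb]; rw [h0]; simp
    · simp [mul_assoc, exp_mul_neg]
  have hbs : HasCompactSupport b := HasCompactSupport.of_support_subset_isCompact hQc hbQ
  have hbt : tsupport b ⊆ Q := closure_minimal hbQ hQc.isClosed
  obtain ⟨C2, hC2, h2⟩ := nonstationary (Measure.addHaar : Measure D.H) hF hlc N b hbc hbs (by
    intro x hx
    obtain ⟨⟨⟨y, v⟩, h⟩, ⟨hx1, hx2⟩, rfl⟩ := hbt hx
    simp only
    rw [hDD]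
    have hW : h ∈ W := hrW (by
      rw [mem_ball_zero_iff]
      have := hρr h hx2
      linarith)
    exact hVW (Set.mk_mem_prod (hTV hx1) hW))
  refine ⟨C1 * C2, by positivity, fun φ hφ hφs y t ht => ?_⟩
  have := h1 φ hφ hφs y t (C2 / t ^ N) (fun v => h2 (y, v) t ht)
  rwa [← mul_div_assoc] at this
end OSC
end LandauTail

namespace LandauTail
set_option linter.unusedSectionVars false
open MeasureTheory
open scoped ContDiff

section CASEA
variable {A : Type} [NormedCommRing A] [NormedAlgebra ℝ A] [FiniteDimensional ℝ A]
  [MeasurableSpace A] [BorelSpace A] {μ : Measure A} [μ.IsAddHaarMeasure] (D : Datum A μ)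

/-- combining the trivial bound and the decay bound. -/
lemma combine_bound {x C0 C1 w : ℝ} (d : ℕ) (hx : 0 ≤ x) (h0 : 0 ≤ C0) (h1 : 0 ≤ C1) (hw0 : w ≤ C0)
    (hw1 : 0 < x → w ≤ C1 / x ^ (d + 1)) :
    w ≤ (2 ^ (d + 1) * (C0 + C1)) * (1 + x) ^ (-((d : ℝ) + 1)) := by
  have hr : (1 + x) ^ (-((d : ℝ) + 1)) = ((1 + x) ^ (d + 1))⁻¹ := by
    rw [Real.rpow_neg (by linarith), ← Nat.cast_succ, Real.rpow_natCast]
  rw [hr, ← div_eq_mul_inv, le_div_iff₀ (by positivity)]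
  rcases le_or_gt x 1 with h | h
  · calc w * (1 + x) ^ (d + 1) ≤ (C0 + C1) * 2 ^ (d + 1) := by
          gcongr
          · linarith
          · linarith
      _ = _ := by ring
  · have hx0 : 0 < x := by linarith
    calc w * (1 + x) ^ (d + 1) ≤ (C1 / x ^ (d + 1)) * (2 * x) ^ (d + 1) := by
          gcongr
          · exact hw1 hx0
          · linarith
      _ = C1 * 2 ^ (d + 1) := by rw [mul_pow]; field_simp
      _ ≤ _ := by nlinarith [show (0:ℝ) < 2 ^ (d + 1) by positivity]

set_option maxHeartbeats 2000000 in
lemma case_a0 {T0 : Set (A × A)} (hT0 : IsCompact T0) (hT : ∀ x ∈ T0, x.1 ≠ 0 ∧ x.2 ∈ D.Ω) :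
    ∃ ε > 0, ∀ a : A × A → ℂ, Amp D a → tsupport a ⊆ T0 →
      (∀ x ∈ tsupport a, ‖D.π (x.1 * x.2)‖ ≤ ε ) →
      (∀ x ∈ tsupport a, D.τ (x.1 * x.2) ≠ 0) ∧
    ∃ C : ℝ, 0 ≤ C ∧ ∀ φ : ℝ → ℂ, Continuous φ → HasCompactSupport φ → ∀ (y : A) (t : ℝ), 0 < t →
      ‖JJ D φ a y t‖ ≤ C * t ^ (-(Module.finrank ℝ D.H : ℝ) / 2) * ∫ u, ‖φ u‖ := by
  have hn : (0 : ℝ) < Module.finrank ℝ A := by exact_mod_cast D.one_pos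
  have hone : 0 < ‖(1 : A)‖ := by
    rw [norm_pos_iff]
    intro h
    have := D.τ_one
    rw [h, map_zero] at this
    linarith
  set d := Module.finrank ℝ D.H with hd
  -- bounds on T0
  obtain ⟨c, hc, hcT⟩ : ∃ c > 0, ∀ x ∈ T0, c ≤ ‖x.1 * x.2‖ := by
    rcases T0.eq_empty_or_nonempty with h | h
    · exact ⟨1, one_pos, by simp [h]⟩
    · obtain ⟨x0, hx0, hmin⟩ := hT0.exists_isMinOn h (f := fun x : A × A => ‖x.1 * x.2‖)
        (by fun_prop)
      refine ⟨‖x0.1 * x0.2‖, ?_, fun x hx => hmin hx⟩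
      refine norm_pos_iff.mpr ?_
      intro h0
      have := (D.Ω_unit _ (hT x0 hx0).2)
      rw [this.mul_left_eq_zero] at h0
      exact (hT x0 hx0).1 h0
  obtain ⟨c2, hc2⟩ := hT0.exists_bound_of_continuousOn
    (f := fun x : A × A => D.τ (x.1 * x.2) / Module.finrank ℝ A) (by fun_prop)
  obtain ⟨r, ε', χ, hr, hε', hχ, hχs, hχ0, hχ1⟩ := geom D (c / (2 * ‖(1 : A)‖)) c2 (by positivity)
  set c2' : ℝ := max c2 0 with hc2'
  have hc2pos : 0 < c2' + 1 := by positivity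
  obtain ⟨r2, hr2, hr2'⟩ := near_one (A := A) (min 1 (ε' / (2 * (c2' + 1)))) (by positivity)
  obtain ⟨ρ, hρ, hρs, hρ1, hρr⟩ := exists_rho D (min (r / 2) r2) (by positivity)
  refine ⟨min (c / 2) (ε' / (2 * (‖(1 : A)‖ + 1))), by positivity, fun a ha haT hπ => ?_⟩
  have hsplit : ∀ x : A, x = (D.π x : A) + (D.τ x / Module.finrank ℝ A) • (1 : A) := by
    intro x; simp [Datum.π]
  have hlow : ∀ x ∈ tsupport a, c / (2 * ‖(1 : A)‖) ≤ |D.τ (x.1 * x.2) / Module.finrank ℝ A| := by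
    intro x hx
    have h1 := hcT x (haT hx)
    have h2 := (hπ x hx).trans (min_le_left _ _)
    have h3 := norm_add_le (D.π (x.1 * x.2) : A) ((D.τ (x.1 * x.2) / Module.finrank ℝ A) • (1 : A))
    rw [← hsplit, norm_smul, ← Submodule.coe_norm, Real.norm_eq_abs] at h3
    rw [div_le_iff₀ (by positivity)]
    nlinarith
  refine ⟨fun x hx h0 => ?_, ?_⟩
  · have h1 := hlow x hx
    rw [h0, zero_div, abs_zero] at h1
    have : 0 < c / (2 * ‖(1 : A)‖) := by positivity
    linarith
  obtain ⟨C1, hC1, h1⟩ := avg_bound D ha hρ.continuous hρs hρ1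
  obtain ⟨C₀, hC₀, htt⟩ := tt_star (Measure.addHaar : Measure D.H)
  -- amplitude
  set X : (A × A) × D.H → D.H → ℂ := fun p h =>
    ((ρ (h + p.2) : ℂ) * a (p.1.1, p.1.2 * NormedSpace.exp ((h + p.2 : D.H) : A))) *
      (starRingEnd ℂ) ((ρ h : ℂ) * a (p.1.1, p.1.2 * NormedSpace.exp (h : A))) with hX
  set b : ((A × D.H) × ((A × A) × D.H)) × D.H → ℂ := fun x => (χ x.1.1 : ℂ) * X x.1.2 x.2 with hb
  have hXc : ContDiff ℝ ∞ (fun x : ((A × A) × D.H) × D.H => X x.1 x.2) := by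
    have k1 : ContDiff ℝ ∞ (fun x : ((A × A) × D.H) × D.H => x.2 + x.1.2) := by fun_prop
    have k2 : ContDiff ℝ ∞ (fun x : ((A × A) × D.H) × D.H => NormedSpace.exp ((x.2 + x.1.2 : D.H) : A)) :=
      exp_contDiff.comp (D.H.subtypeL.contDiff.comp k1)
    have k3 : ContDiff ℝ ∞ (fun x : ((A × A) × D.H) × D.H => NormedSpace.exp ((x.2 : D.H) : A)) :=
      exp_contDiff.comp (D.H.subtypeL.contDiff.comp contDiff_snd)
    have k4 : ContDiff ℝ ∞ (fun x : ((A × A) × D.H) × D.H => x.1.1.1) := by fun_prop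
    have k5 : ContDiff ℝ ∞ (fun x : ((A × A) × D.H) × D.H => x.1.1.2) := by fun_prop
    refine ContDiff.mul ?_ (Complex.conjCLE.contDiff.comp ?_)
    · exact (Complex.ofRealCLM.contDiff.comp (hρ.comp k1)).mul (ha.1.comp (k4.prodMk (k5.mul k2)))
    · exact (Complex.ofRealCLM.contDiff.comp (hρ.comp contDiff_snd)).mul (ha.1.comp (k4.prodMk (k5.mul k3)))
  have hbc : ContDiff ℝ ∞ b := by
    refine (Complex.ofRealCLM.contDiff.comp (hχ.comp (contDiff_fst.comp contDiff_fst))).mul ?_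
    exact hXc.comp ((contDiff_snd.comp contDiff_fst).prodMk contDiff_snd)
  have hXne : ∀ y v m h, X ((y, v), m) h ≠ 0 → h + m ∈ tsupport ρ ∧ h ∈ tsupport ρ ∧
      (y, v * NormedSpace.exp (h : A)) ∈ tsupport a := by
    intro y v m h hne
    refine ⟨subset_tsupport _ ?_, subset_tsupport _ ?_, subset_tsupport _ ?_⟩
    · intro h0; apply hne; simp only [hX]; rw [h0]; simp
    · intro h0; apply hne; simp only [hX]; rw [h0]; simp
    · intro h0; apply hne; simp only [hX]; rw [h0]; simp
  have hecc : Continuous fun x : (A × A) × (D.H × D.H) => NormedSpace.exp (-(x.2.1 : A)) :=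
    exp_cont.comp (continuous_subtype_val.comp (continuous_fst.comp continuous_snd)).neg
  set Q : Set (((A × A) × D.H) × D.H) :=
    (fun x : (A × A) × (D.H × D.H) => (((x.1.1, x.1.2 * NormedSpace.exp (-(x.2.1 : A))), x.2.2 - x.2.1), x.2.1)) ''
    (tsupport a ×ˢ (tsupport ρ ×ˢ tsupport ρ)) with hQ
  have hQc : IsCompact Q := by
    apply (ha.2.1.isCompact.prod (hρs.isCompact.prod hρs.isCompact)).image
    fun_prop
  have hXQ : ∀ p h, X p h ≠ 0 → (p, h) ∈ Q := by
    rintro ⟨⟨y, v⟩, m⟩ h hx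
    obtain ⟨e1, e2, e3⟩ := hXne y v m h hx
    exact ⟨((y, v * NormedSpace.exp (h : A)), (h, h + m)), ⟨e3, e2, e1⟩, by simp [mul_assoc, exp_mul_neg]⟩
  have hXs : HasCompactSupport (fun x : ((A × A) × D.H) × D.H => X x.1 x.2) :=
    HasCompactSupport.of_support_subset_isCompact hQc (fun x hx => hXQ _ _ hx)
  set Q2 : Set (((A × D.H) × ((A × A) × D.H)) × D.H) :=
    (fun x : (A × D.H) × (((A × A) × D.H) × D.H) => ((x.1, x.2.1), x.2.2)) '' (tsupport χ ×ˢ Q) with hQ2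
  have hQ2c : IsCompact Q2 := (hχs.isCompact.prod hQc).image (by fun_prop)
  have hbQ : Function.support b ⊆ Q2 := by
    rintro ⟨⟨z, p⟩, h⟩ hx
    refine ⟨(z, (p, h)), ⟨subset_tsupport _ ?_, hXQ _ _ ?_⟩, rfl⟩
    · intro h0; apply hx; simp only [hb]; rw [h0]; simp
    · intro h0; apply hx; simp only [hb]; rw [h0]; simp
  have hbs : HasCompactSupport b := HasCompactSupport.of_support_subset_isCompact hQ2c hbQ
  have hbt : tsupport b ⊆ Q2 := closure_minimal hbQ hQ2c.isClosed
  obtain ⟨B0, hB0, hb0⟩ := slice_bound (Measure.addHaar : Measure D.H) _ hXc.continuous hXs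
  have hζc : ContDiff ℝ ∞ (fun p : (A × D.H) × ((A × A) × D.H) => p.1.1) := by fun_prop
  have hlc : ContDiff ℝ ∞ (fun p : (A × D.H) × ((A × A) × D.H) => p.1.2) := by fun_prop
  obtain ⟨hF, hDD⟩ := DD_phase D hζc (fun p : (A × D.H) × ((A × A) × D.H) => p.1.2)
  obtain ⟨B1, hB1, hb1⟩ := nonstationary (Measure.addHaar : Measure D.H) hF hlc (d + 1) b hbc hbs (by
    intro x hx
    obtain ⟨⟨z, ⟨⟨y, m⟩, h⟩⟩, ⟨hx1, hx2⟩, rfl⟩ := hbt hx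
    simp only
    rw [hDD]
    apply hχ0 z hx1
    obtain ⟨w, hw, hw2⟩ := hx2
    have : h = w.2.1 := by rw [Prod.ext_iff] at hw2; exact hw2.2.symm
    rw [this]
    have h3 := (hρr _ hw.2.1).trans (min_le_left _ _)
    rw [Submodule.coe_norm] at h3
    linarith)
  -- the key bound on fibers
  have key : ∀ (y : A) (t : ℝ) (v : A), 0 < t →
      ‖GG D ρ a y t v‖ ^ 2 ≤ (2 ^ (d + 1) * (B0 + B1)) * C₀ / t ^ d := by
    intro y t v ht
    unfold GG
    apply htt
    · have e1 : Continuous fun h : D.H => a (y, v * NormedSpace.exp (h : A)) :=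
        ha.1.continuous.comp (continuous_const.prodMk (continuous_const.mul (expH_cont D)))
      have e2 : Continuous fun h : D.H => D.τ (y * v * NormedSpace.exp (h : A)) :=
        D.τ.continuous.comp (continuous_const.mul (expH_cont D))
      have e3 := hρ.continuous
      exact ((Complex.continuous_ofReal.comp e3).mul e1).mul (Complex.continuous_exp.comp
        ((continuous_const.mul (Complex.continuous_ofReal.comp e2)).mul continuous_const))
    · apply HasCompactSupport.mul_right
      apply HasCompactSupport.mul_right
      exact hρs.comp_left (g := fun x : ℝ => (x : ℂ)) (by simp)
    · exact ht
    intro m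
    have hu : ∀ h : D.H, ((ρ (h + m) : ℂ) * a (y, v * NormedSpace.exp ((h + m : D.H) : A)) *
        Complex.exp (t * D.τ (y * v * NormedSpace.exp ((h + m : D.H) : A)) * Complex.I)) *
        (starRingEnd ℂ) ((ρ h : ℂ) * a (y, v * NormedSpace.exp (h : A)) *
        Complex.exp (t * D.τ (y * v * NormedSpace.exp (h : A)) * Complex.I)) =
        X ((y, v), m) h * Complex.exp (t * D.τ (y * v * (NormedSpace.exp (m : A) - 1) * NormedSpace.exp (h : A)) * Complex.I) := by
      intro h
      have e0 : D.τ (y * v * (NormedSpace.exp (m : A) - 1) * NormedSpace.exp (h : A)) =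
          D.τ (y * v * NormedSpace.exp ((h + m : D.H) : A)) - D.τ (y * v * NormedSpace.exp (h : A)) := by
        rw [← map_sub, Submodule.coe_add, exp_add_A]
        congr 1; ring
      rw [e0]
      have e1 : (starRingEnd ℂ) (Complex.exp (t * D.τ (y * v * NormedSpace.exp (h : A)) * Complex.I)) =
          Complex.exp (-(t * D.τ (y * v * NormedSpace.exp (h : A)) * Complex.I)) := by
        rw [← Complex.exp_conj]; simp
      rw [map_mul (starRingEnd ℂ) (_ * _), e1, Complex.ofReal_sub, mul_sub, sub_mul, sub_eq_add_neg, Complex.exp_add]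
      simp only [hX]
      ring
    simp_rw [hu]
    apply combine_bound d (by positivity) hB0 hB1
    · refine (norm_integral_le_integral_norm _).trans ?_
      refine le_trans (le_of_eq ?_) (hb0 ((y, v), m))
      congr 1; ext h
      rw [norm_mul, ← Complex.ofReal_mul, Complex.norm_exp_ofReal_mul_I, mul_one]
    · intro htm
      have hm0 : m ≠ 0 := by rintro rfl; simp at htm
      have hmn : 0 < ‖m‖ := norm_pos_iff.mpr hm0
      have := hb1 ((‖m‖⁻¹ • (y * v * (NormedSpace.exp (m : A) - 1)), ‖m‖⁻¹ • D.σH m), ((y, v), m)) (t * ‖m‖) htm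
      refine le_trans (le_of_eq ?_) this
      congr 2; ext h
      simp only [hb]
      by_cases hz : X ((y, v), m) h = 0
      · simp [hz]
      · obtain ⟨e1, e2, e3⟩ := hXne y v m h hz
        have f1 := (hρr _ e1).trans (min_le_left _ _)
        have f2 := (hρr _ e2).trans (min_le_left _ _)
        have f3 := (hρr _ e2).trans (min_le_right _ _)
        have hmr : ‖m‖ ≤ r := by
          calc ‖m‖ = ‖(h + m) - h‖ := by rw [add_sub_cancel_left]
            _ ≤ ‖h + m‖ + ‖h‖ := norm_sub_le _ _
            _ ≤ r := by linarith
        have hone' : χ (‖m‖⁻¹ • (y * v * (NormedSpace.exp (m : A) - 1)), ‖m‖⁻¹ • D.σH m) = 1 := by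
          apply hχ1 (y * v) m hm0 hmr
          set z : A := y * (v * NormedSpace.exp (h : A)) with hz'
          have g1 : c / (2 * ‖(1 : A)‖) ≤ |D.τ z / Module.finrank ℝ A| := hlow _ e3
          have g2 : ‖D.τ z / Module.finrank ℝ A‖ ≤ c2 := hc2 _ (haT e3)
          have g3 : ‖D.π z‖ ≤ _ := (hπ _ e3).trans (min_le_right _ _)
          refine ⟨D.τ z / Module.finrank ℝ A, g1, g2, ?_⟩
          set s := D.τ z / Module.finrank ℝ A with hs
          have g4 : y * v - s • (1 : A) = (D.π z : A) * NormedSpace.exp (-(h : A)) + s • (NormedSpace.exp (-(h : A)) - 1) := by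
            have q1 : y * v = z * NormedSpace.exp (-(h : A)) := by
              rw [hz', mul_assoc, mul_assoc, exp_mul_neg, mul_one]
            have q2 : (D.π z : A) = z - s • (1 : A) := rfl
            rw [q1, q2, sub_mul, smul_sub, smul_mul_assoc, one_mul]
            abel
          have g5 := (hr2' (-(h : A)) (by rw [norm_neg]; exact f3)).2
          have g6 := g5.trans (min_le_left _ _)
          have g7 := g5.trans (min_le_right _ _)
          have g8 : ‖NormedSpace.exp (-(h : A))‖ ≤ ‖(1 : A)‖ + 1 := by
            calc _ = ‖(NormedSpace.exp (-(h : A)) - 1) + 1‖ := by rw [sub_add_cancel]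
              _ ≤ _ := by refine (norm_add_le _ _).trans ?_; linarith
          have g9 : |s| ≤ c2' + 1 := by
            have := le_max_left c2 0
            rw [Real.norm_eq_abs] at g2
            linarith
          rw [g4]
          calc _ ≤ ‖D.π z‖ * ‖NormedSpace.exp (-(h : A))‖ + |s| * ‖NormedSpace.exp (-(h : A)) - 1‖ := by
                refine (norm_add_le _ _).trans (add_le_add (norm_mul_le _ _) ?_)
                rw [norm_smul, Real.norm_eq_abs]
            _ ≤ (ε' / (2 * (‖(1 : A)‖ + 1))) * (‖(1 : A)‖ + 1) + (c2' + 1) * (ε' / (2 * (c2' + 1))) := by gcongr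
            _ = ε' := by field_simp; ring
        rw [hone', Complex.ofReal_one, one_mul, smul_mul_assoc, map_smul, smul_eq_mul]
        congr 2
        push_cast
        have : (‖m‖ : ℂ) ≠ 0 := by exact_mod_cast hmn.ne'
        field_simp
  set B := (2 ^ (d + 1) * (B0 + B1)) * C₀ with hB
  have hBpos : 0 ≤ B := by positivity
  refine ⟨C1 * Real.sqrt B, by positivity, fun φ hφ hφs y t ht => ?_⟩
  rw [mul_assoc C1]
  apply h1 φ hφ hφs y t
  intro v
  have h5 := key y t v ht
  have h6 : (Real.sqrt B * t ^ (-(d : ℝ) / 2)) ^ 2 = B / t ^ d := by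
    rw [mul_pow, Real.sq_sqrt hBpos, ← Real.rpow_natCast (t ^ _), ← Real.rpow_mul ht.le]
    rw [show -(d : ℝ) / 2 * ((2 : ℕ) : ℝ) = -(d : ℝ) by push_cast; ring, Real.rpow_neg ht.le, Real.rpow_natCast]
    rfl
  rw [← h6] at h5
  exact (sq_le_sq₀ (norm_nonneg _) (by positivity)).mp h5
end CASEA
end LandauTail

namespace LandauTail
set_option linter.unusedSectionVars false
open MeasureTheory
open scoped ContDiff

section RADIAL
variable {A : Type} [NormedCommRing A] [NormedAlgebra ℝ A] [FiniteDimensional ℝ A]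
  [MeasurableSpace A] [BorelSpace A] {μ : Measure A} [μ.IsAddHaarMeasure] (D : Datum A μ)

lemma euler_ibp (g : A → ℂ) (hg : ContDiff ℝ 1 g) (hs : HasCompactSupport g) :
    ∫ v, fderiv ℝ g v v ∂μ = - (Module.finrank ℝ A : ℂ) * ∫ v, g v ∂μ := by
  let B := Module.finBasis ℝ A
  have h0 : ∀ i, ∫ v, fderiv ℝ (fun v => ((B.coord i).toContinuousLinearMap v : ℂ) * g v) v (B i) ∂μ = 0 := by
    intro i
    apply integral_fderiv_zero
    · exact (Complex.ofRealCLM.contDiff.comp (ContinuousLinearMap.contDiff _)).mul hg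
    · exact hs.mul_left
  have h1 : ∀ i v, fderiv ℝ (fun v => ((B.coord i).toContinuousLinearMap v : ℂ) * g v) v (B i) =
      ((B.coord i v : ℝ) : ℂ) * fderiv ℝ g v (B i) + g v := by
    intro i v
    have e1 : HasFDerivAt (fun v => ((B.coord i).toContinuousLinearMap v : ℂ)) _ v :=
      Complex.ofRealCLM.hasFDerivAt.comp v ((B.coord i).toContinuousLinearMap.hasFDerivAt)
    have e2 := ((hg.differentiable (by simp)) v).hasFDerivAt
    have e3 := (e1.mul e2).fderiv
    erw [e3]
    simp
  have hgi : Integrable g μ := hg.continuous.integrable_of_hasCompactSupport hs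
  have h2 : ∀ i, Integrable (fun v => ((B.coord i v : ℝ) : ℂ) * fderiv ℝ g v (B i)) μ := by
    intro i
    apply Continuous.integrable_of_hasCompactSupport
    · have e1 : Continuous fun v => ((B.coord i).toContinuousLinearMap v : ℂ) :=
        Complex.continuous_ofReal.comp (ContinuousLinearMap.continuous _)
      exact e1.mul ((hg.continuous_fderiv (by simp)).clm_apply continuous_const)
    · exact (hs.fderiv_apply (𝕜 := ℝ) (B i)).mul_left
  have h3 : ∀ v, fderiv ℝ g v v = ∑ i, ((B.coord i v : ℝ) : ℂ) * fderiv ℝ g v (B i) := by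
    intro v
    conv_lhs => rw [← B.sum_repr v]
    rw [map_sum]
    congr 1; ext i
    rw [map_smul]
    simp
  simp_rw [h3]
  rw [integral_finsetSum _ (fun i _ => h2 i)]
  have h4 : ∀ i, ∫ v, ((B.coord i v : ℝ) : ℂ) * fderiv ℝ g v (B i) ∂μ = - ∫ v, g v ∂μ := by
    intro i
    have := h0 i
    simp_rw [h1] at this
    rw [integral_add (h2 i) hgi] at this
    linear_combination this
  simp_rw [h4]
  simp

/-- The amplitude after division by the radial derivative of the phase. -/
def amp1 (a : A × A → ℂ) : A × A → ℂ := fun x => a x / ((D.τ (x.1 * x.2) : ℝ) : ℂ)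

/-- The second amplitude produced by a radial integration by parts. -/
def amp2 (a : A × A → ℂ) : A × A → ℂ := fun x =>
  fderiv ℝ (amp1 D a) x (0, x.2) + (Module.finrank ℝ A : ℂ) * amp1 D a x

lemma phase_contDiff : ContDiff ℝ ∞ (fun x : A × A => D.τ (x.1 * x.2)) :=
  D.τ.contDiff.comp (contDiff_fst.mul contDiff_snd)

lemma Amp_mono {a b : A × A → ℂ} (ha : Amp D a) (hb : ContDiff ℝ ∞ b) (h : tsupport b ⊆ tsupport a) : Amp D b :=
  ⟨hb, ha.2.1.mono' ((subset_tsupport _).trans h), fun x hx => ha.2.2 x (h hx)⟩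

lemma amp1_tsupport (a : A × A → ℂ) : tsupport (amp1 D a) ⊆ tsupport a := by
  apply closure_mono
  intro x hx h
  apply hx
  simp [amp1, h]

lemma amp1_Amp {a : A × A → ℂ} (ha : Amp D a) (hne : ∀ x ∈ tsupport a, D.τ (x.1 * x.2) ≠ 0) :
    Amp D (amp1 D a) :=
  Amp_mono D ha (div_contDiff ha.1 (phase_contDiff D) hne) (amp1_tsupport D a)

lemma amp2_tsupport (a : A × A → ℂ) : tsupport (amp2 D a) ⊆ tsupport a := by
  refine subset_trans ?_ (amp1_tsupport D a)
  apply closure_minimal _ (isClosed_tsupport _)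
  intro x hx
  by_contra h
  apply hx
  have h1 := notMem_tsupport_iff_eventuallyEq.mp h
  simp [amp2, h1.fderiv_eq (𝕜 := ℝ), h1.eq_of_nhds]

lemma amp2_Amp {a : A × A → ℂ} (ha : Amp D a) (hne : ∀ x ∈ tsupport a, D.τ (x.1 * x.2) ≠ 0) :
    Amp D (amp2 D a) := by
  have h1 := (amp1_Amp D ha hne).1
  refine Amp_mono D ha ?_ (amp2_tsupport D a)
  exact ((h1.fderiv_right (m := ∞) (by simp)).clm_apply (contDiff_const.prodMk contDiff_snd)).add
    (contDiff_const.mul h1)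

lemma L_deriv {v : A} (hv : v ∈ D.Ω) : fderiv ℝ D.L v v = Module.finrank ℝ A := by
  have h1 : HasFDerivAt D.L (fderiv ℝ D.L v) v := ((D.L_smooth v hv).differentiableAt (by simp)).hasFDerivAt
  have h2 : HasDerivAt (fun s : ℝ => Real.exp s • v) v 0 := by
    have := (Real.hasDerivAt_exp 0).smul_const v
    simpa using this
  have h1' : HasFDerivAt D.L (fderiv ℝ D.L v) (Real.exp 0 • v) := by simpa using h1
  have h3 := h1'.comp_hasDerivAt (0 : ℝ) h2
  have h4 : HasDerivAt (fun s : ℝ => D.L (Real.exp s • v)) (Module.finrank ℝ A : ℝ) 0 := by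
    simp_rw [L_smul D hv]
    have := ((hasDerivAt_id (0 : ℝ)).const_mul (Module.finrank ℝ A : ℝ)).const_add (D.L v)
    simpa using this
  exact h3.unique h4

lemma radial_step {a : A × A → ℂ} (ha : Amp D a) (hne : ∀ x ∈ tsupport a, D.τ (x.1 * x.2) ≠ 0)
    {φ : ℝ → ℂ} (hφ : ContDiff ℝ ∞ φ) (y : A) (t : ℝ) :
    (t * Complex.I) * JJ D φ a y t = - ((Module.finrank ℝ A : ℂ) * JJ D (deriv φ) (amp1 D a) y t +
      JJ D φ (amp2 D a) y t) := by
  have ha1 := amp1_Amp D ha hne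
  have ha2 := amp2_Amp D ha hne
  set a1 := amp1 D a with ha1d
  have hE : ContDiff ℝ ∞ (fun v : A => Complex.exp (t * D.τ (y * v) * Complex.I)) := by
    have e1 : ContDiff ℝ ∞ (fun v : A => (D.τ (y * v) : ℂ)) :=
      Complex.ofRealCLM.contDiff.comp (D.τ.contDiff.comp (contDiff_const.mul contDiff_id))
    exact ((contDiff_const.mul e1).mul contDiff_const).cexp
  have hsl : ContDiff ℝ ∞ fun v => a1 (y, v) := ha1.1.comp (contDiff_prodMk_right y)
  set G : A → ℂ := fun v => φ (D.L v) * a1 (y, v) * Complex.exp (t * D.τ (y * v) * Complex.I) with hG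
  have hzero : ∀ v, (y, v) ∉ tsupport a1 → G =ᶠ[𝓝 v] fun _ => 0 := by
    intro v hv
    have h1 : ∀ᶠ z in 𝓝 v, a1 (y, z) = 0 :=
      (Continuous.prodMk_right y).continuousAt.eventually (notMem_tsupport_iff_eventuallyEq.mp hv)
    filter_upwards [h1] with z hz
    simp [hG, hz]
  have hGc : ContDiff ℝ ∞ G := by
    rw [contDiff_iff_contDiffAt]
    intro v
    by_cases hv : (y, v) ∈ tsupport a1
    · have h1 := D.L_smooth v (ha1.2.2 _ hv)
      exact ((hφ.contDiffAt.comp v h1).mul hsl.contDiffAt).mul hE.contDiffAt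
    · exact contDiffAt_const.congr_of_eventuallyEq (hzero v hv)
  have hGs : HasCompactSupport G := ((slice_compact a1 ha1.2.1 y).mul_left).mul_right
  have h0 := euler_ibp (μ := μ) G (hGc.of_le (by simp)) hGs
  have hD : ∀ v, fderiv ℝ G v v =
      (Module.finrank ℝ A : ℂ) * (deriv φ (D.L v) * a1 (y, v) * Complex.exp (t * D.τ (y * v) * Complex.I)) +
      φ (D.L v) * amp2 D a (y, v) * Complex.exp (t * D.τ (y * v) * Complex.I) -
      (Module.finrank ℝ A : ℂ) * G v +
      (t * Complex.I) * (φ (D.L v) * a (y, v) * Complex.exp (t * D.τ (y * v) * Complex.I)) := by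
    intro v
    by_cases hv : (y, v) ∈ tsupport a1
    · have hvΩ := ha1.2.2 _ hv
      have hva := amp1_tsupport D a hv
      have l1 : HasFDerivAt D.L (fderiv ℝ D.L v) v := ((D.L_smooth v hvΩ).differentiableAt (by simp)).hasFDerivAt
      have l2 := ((hφ.differentiable (by simp)) (D.L v)).hasDerivAt
      have e1 : HasFDerivAt (fun v => φ (D.L v)) _ v := l2.hasFDerivAt.comp v l1
      have e2 := hasFDerivAt_slice ha1.1 y v
      have e3 : HasFDerivAt (fun v => (D.τ (y * v) : ℂ)) _ v :=
        Complex.ofRealCLM.hasFDerivAt.comp v (D.τ.hasFDerivAt.comp v ((hasFDerivAt_id (𝕜 := ℝ) v).const_mul y))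
      have e4 := ((e3.const_mul (t : ℂ)).mul_const Complex.I).cexp
      have e5 := ((e1.mul e2).mul e4).fderiv
      rw [hG]
      erw [e5]
      have hb' : a (y, v) = a1 (y, v) * ((D.τ (y * v) : ℝ) : ℂ) := by
        simp only [ha1d, amp1]
        rw [div_mul_cancel₀]
        exact_mod_cast hne _ hva
      rw [hb']
      have hL := L_deriv D hvΩ
      simp [amp2, hL]
      ring
    · have h1 := hzero v hv
      have h2 : a1 (y, v) = 0 := image_eq_zero_of_notMem_tsupport hv
      have h3 : amp2 D a (y, v) = 0 := by
        have h1 := notMem_tsupport_iff_eventuallyEq.mp hv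
        simp only [amp2]
        rw [← ha1d, h1.fderiv_eq (𝕜 := ℝ), h2]
        simp
      have h4 : a (y, v) = 0 := by
        by_contra h5
        have : a1 (y, v) ≠ 0 := by
          simp only [ha1d, amp1]
          apply div_ne_zero h5
          exact_mod_cast hne _ (subset_tsupport _ h5)
        exact this h2
      rw [h1.fderiv_eq (𝕜 := ℝ), h2, h3, h4, h1.eq_of_nhds]
      simp
  simp_rw [hD] at h0
  have hφ' : Continuous (deriv φ) := hφ.continuous_deriv (by simp)
  have c1 : Integrable (fun v => deriv φ (D.L v) * a1 (y, v) * Complex.exp (t * D.τ (y * v) * Complex.I)) μ :=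
    (avg_cont D ha1 hφ' y t).1.integrable_of_hasCompactSupport (avg_cont D ha1 hφ' y t).2
  have c2 : Integrable (fun v => φ (D.L v) * amp2 D a (y, v) * Complex.exp (t * D.τ (y * v) * Complex.I)) μ :=
    (avg_cont D ha2 hφ.continuous y t).1.integrable_of_hasCompactSupport (avg_cont D ha2 hφ.continuous y t).2
  have c3 : Integrable (fun v => φ (D.L v) * a (y, v) * Complex.exp (t * D.τ (y * v) * Complex.I)) μ :=
    (avg_cont D ha hφ.continuous y t).1.integrable_of_hasCompactSupport (avg_cont D ha hφ.continuous y t).2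
  have c4 : Integrable G μ := hGc.continuous.integrable_of_hasCompactSupport hGs
  have i1 : ∀ n : ℂ, Integrable (fun v => n * (deriv φ (D.L v) * a1 (y, v) *
      Complex.exp (t * D.τ (y * v) * Complex.I)) + φ (D.L v) * amp2 D a (y, v) *
      Complex.exp (t * D.τ (y * v) * Complex.I)) μ := fun n => (c1.const_mul n).add c2
  have i2 : ∀ n m : ℂ, Integrable (fun v => n * (deriv φ (D.L v) * a1 (y, v) *
      Complex.exp (t * D.τ (y * v) * Complex.I)) + φ (D.L v) * amp2 D a (y, v) *
      Complex.exp (t * D.τ (y * v) * Complex.I) - m * G v) μ :=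
    fun n m => (i1 n).sub (c4.const_mul m)
  rw [integral_add (i2 _ _) (c3.const_mul _),
    integral_sub (i1 _) (c4.const_mul _), integral_add (c1.const_mul _) c2,
    integral_const_mul, integral_const_mul, integral_const_mul] at h0
  unfold JJ
  linear_combination h0

/-- Sum of the `L¹` norms of the first derivatives. -/
def NM (M : ℕ) (φ : ℝ → ℂ) : ℝ := ∑ j ∈ Finset.range (M + 1), ∫ u, ‖iteratedDeriv j φ u‖

lemma NM_nonneg (M : ℕ) (φ : ℝ → ℂ) : 0 ≤ NM M φ :=
  Finset.sum_nonneg fun _ _ => integral_nonneg fun _ => norm_nonneg _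

lemma NM_le_succ (M : ℕ) (φ : ℝ → ℂ) : NM M φ ≤ NM (M + 1) φ := by
  unfold NM
  rw [Finset.sum_range_succ _ (M + 1)]
  have : 0 ≤ ∫ u, ‖iteratedDeriv (M + 1) φ u‖ := integral_nonneg fun _ => norm_nonneg _
  linarith

lemma NM_deriv_le (M : ℕ) (φ : ℝ → ℂ) : NM M (deriv φ) ≤ NM (M + 1) φ := by
  unfold NM
  rw [Finset.sum_range_succ' _ (M + 1)]
  have : 0 ≤ ∫ u, ‖iteratedDeriv 0 φ u‖ := integral_nonneg fun _ => norm_nonneg _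
  simp_rw [← iteratedDeriv_succ']
  linarith

lemma le_NM (M : ℕ) (φ : ℝ → ℂ) : ∫ u, ‖φ u‖ ≤ NM M φ := by
  unfold NM
  have := Finset.single_le_sum (f := fun j => ∫ u, ‖iteratedDeriv j φ u‖) (s := Finset.range (M + 1))
    (fun _ _ => integral_nonneg fun _ => norm_nonneg _) (Finset.mem_range.mpr (Nat.succ_pos M))
  simpa using this

lemma case_a {T0 : Set (A × A)} (hT0 : IsCompact T0) (hT : ∀ x ∈ T0, x.1 ≠ 0 ∧ x.2 ∈ D.Ω) :
    ∃ ε > 0, ∀ (M : ℕ) (a : A × A → ℂ), Amp D a → tsupport a ⊆ T0 →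
      (∀ x ∈ tsupport a, ‖D.π (x.1 * x.2)‖ ≤ ε) →
    ∃ C : ℝ, 0 ≤ C ∧ ∀ φ : ℝ → ℂ, ContDiff ℝ ∞ φ → HasCompactSupport φ → ∀ (y : A) (t : ℝ), 0 < t →
      ‖JJ D φ a y t‖ ≤ C * t ^ (-((Module.finrank ℝ D.H : ℝ) / 2 + M)) * NM M φ := by
  obtain ⟨ε, hε, h⟩ := case_a0 D hT0 hT
  refine ⟨ε, hε, fun M => ?_⟩
  induction M with
  | zero =>
    intro a ha haT hπ
    obtain ⟨_, C, hC, hb⟩ := h a ha haT hπ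
    refine ⟨C, hC, fun φ hφ hφs y t ht => ?_⟩
    have := hb φ hφ.continuous hφs y t ht
    simpa [NM, neg_div] using this
  | succ M ih =>
    intro a ha haT hπ
    obtain ⟨hne, -⟩ := h a ha haT hπ
    obtain ⟨C1, hC1, h1⟩ := ih (amp1 D a) (amp1_Amp D ha hne) ((amp1_tsupport D a).trans haT)
      (fun x hx => hπ x (amp1_tsupport D a hx))
    obtain ⟨C2, hC2, h2⟩ := ih (amp2 D a) (amp2_Amp D ha hne) ((amp2_tsupport D a).trans haT)
      (fun x hx => hπ x (amp2_tsupport D a hx))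
    refine ⟨Module.finrank ℝ A * C1 + C2, by positivity, fun φ hφ hφs y t ht => ?_⟩
    have e1 := congrArg norm (radial_step D ha hne hφ y t)
    rw [norm_mul, norm_mul, norm_neg, Complex.norm_I, mul_one, Complex.norm_real, Real.norm_eq_abs,
      abs_of_pos ht] at e1
    have hφ' : ContDiff ℝ ∞ (deriv φ) := by
      have := contDiff_infty_iff_deriv.mp hφ
      exact this.2
    have e2 := h1 (deriv φ) hφ' hφs.deriv y t ht
    have e3 := h2 φ hφ hφs y t ht
    set p := t ^ (-((Module.finrank ℝ D.H : ℝ) / 2 + M)) with hp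
    have hp0 : 0 < p := Real.rpow_pos_of_pos ht _
    have e4 : t ^ (-((Module.finrank ℝ D.H : ℝ) / 2 + ((M + 1 : ℕ) : ℝ))) = p / t := by
      rw [hp, ← Real.rpow_sub_one ht.ne']
      congr 1; push_cast; ring
    rw [e4]
    have e5 : ‖JJ D φ a y t‖ = ‖(Module.finrank ℝ A : ℂ) * JJ D (deriv φ) (amp1 D a) y t + JJ D φ (amp2 D a) y t‖ / t := by
      rw [eq_div_iff ht.ne', mul_comm, e1]
    rw [e5, div_le_iff₀ ht]
    calc _ ≤ Module.finrank ℝ A * ‖JJ D (deriv φ) (amp1 D a) y t‖ + ‖JJ D φ (amp2 D a) y t‖ := by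
          refine (norm_add_le _ _).trans ?_
          rw [norm_mul]; simp
      _ ≤ Module.finrank ℝ A * (C1 * p * NM (M + 1) φ) + C2 * p * NM (M + 1) φ := by
          gcongr
          · exact e2.trans (by gcongr; exact NM_deriv_le M φ)
          · exact e3.trans (by gcongr; exact NM_le_succ M φ)
      _ = _ := by field_simp

lemma osc_amp {a : A × A → ℂ} (ha : Amp D a) (hne : ∀ x ∈ tsupport a, x.1 ≠ 0) (M : ℕ) :
    ∃ C : ℝ, 0 ≤ C ∧ ∀ φ : ℝ → ℂ, ContDiff ℝ ∞ φ → HasCompactSupport φ → ∀ (y : A) (t : ℝ), 0 < t →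
      ‖JJ D φ a y t‖ ≤ C * t ^ (-((Module.finrank ℝ D.H : ℝ) / 2 + M)) * NM M φ := by
  obtain ⟨ε, hε, h⟩ := case_a D ha.2.1.isCompact (fun x hx => ⟨hne x hx, ha.2.2 x hx⟩)
  let f : ContDiffBump (0 : D.H) := ⟨ε / 2, ε, by linarith, by linarith⟩
  have hπm : ContDiff ℝ ∞ fun x : A × A => D.π (x.1 * x.2) := (π_contDiff D).comp (contDiff_fst.mul contDiff_snd)
  have hfc : ContDiff ℝ ∞ fun x : A × A => (f (D.π (x.1 * x.2)) : ℂ) :=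
    Complex.ofRealCLM.contDiff.comp (f.contDiff.comp hπm)
  set a1 : A × A → ℂ := fun x => a x * (f (D.π (x.1 * x.2)) : ℂ) with ha1
  set a2 : A × A → ℂ := fun x => a x * (1 - (f (D.π (x.1 * x.2)) : ℂ)) with ha2
  have ht1 : tsupport a1 ⊆ tsupport a := by
    apply closure_mono
    intro x hx h; apply hx; simp [ha1, h]
  have ht2 : tsupport a2 ⊆ tsupport a := by
    apply closure_mono
    intro x hx h; apply hx; simp [ha2, h]
  have hA1 : Amp D a1 := Amp_mono D ha (ha.1.mul hfc) ht1
  have hA2 : Amp D a2 := Amp_mono D ha (ha.1.mul (contDiff_const.sub hfc)) ht2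
  obtain ⟨C1, hC1, h1⟩ := h M a1 hA1 ht1 (by
    have hcl : IsClosed {x : A × A | ‖D.π (x.1 * x.2)‖ ≤ ε} := isClosed_le hπm.continuous.norm continuous_const
    have : tsupport a1 ⊆ {x : A × A | ‖D.π (x.1 * x.2)‖ ≤ ε} := by
      apply closure_minimal _ hcl
      intro x hx
      by_contra hcon
      apply hx
      have : f (D.π (x.1 * x.2)) = 0 := by
        apply f.zero_of_le_dist
        rw [dist_zero_right]
        exact (not_le.mp hcon).le
      simp [ha1, this]
    exact fun x hx => this hx)
  have hb2 : ∀ x ∈ tsupport a2, D.π (x.1 * x.2) ≠ 0 := by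
    intro x hx h0
    apply notMem_tsupport_iff_eventuallyEq.mpr _ hx
    have h3 : ∀ᶠ z in 𝓝 x, D.π (z.1 * z.2) ∈ Metric.ball (0 : D.H) (ε / 2) := by
      apply hπm.continuous.continuousAt.eventually
      simp only [h0]
      exact Metric.ball_mem_nhds _ (by positivity)
    filter_upwards [h3] with z hz
    have : f (D.π (z.1 * z.2)) = 1 := f.one_of_mem_closedBall (Metric.ball_subset_closedBall hz)
    simp [ha2, this]
  obtain ⟨C2, hC2, h2⟩ := case_b D hA2 hb2 0
  obtain ⟨C3, hC3, h3⟩ := case_b D hA2 hb2 (Module.finrank ℝ D.H + M)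
  refine ⟨C1 + (C2 + C3), by positivity, fun φ hφ hφs y t ht => ?_⟩
  have hsum : JJ D φ a y t = JJ D φ a1 y t + JJ D φ a2 y t := by
    unfold JJ
    have q1 := avg_cont D hA1 hφ.continuous y t
    have q2 := avg_cont D hA2 hφ.continuous y t
    rw [← integral_add (q1.1.integrable_of_hasCompactSupport q1.2) (q2.1.integrable_of_hasCompactSupport q2.2)]
    congr 1; ext v
    simp only [ha1, ha2]
    ring
  set p := t ^ (-((Module.finrank ℝ D.H : ℝ) / 2 + M)) with hp
  have hp0 : 0 < p := Real.rpow_pos_of_pos ht _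
  have hI : 0 ≤ ∫ u, ‖φ u‖ := integral_nonneg fun _ => norm_nonneg _
  have k2 : ‖JJ D φ a2 y t‖ ≤ (C2 + C3) * p * ∫ u, ‖φ u‖ := by
    rcases le_or_gt t 1 with h | h
    · refine (h2 φ hφ.continuous hφs y t ht).trans ?_
      have : 1 ≤ p := Real.one_le_rpow_of_pos_of_le_one_of_nonpos ht h (by
        have : (0:ℝ) ≤ (Module.finrank ℝ D.H : ℝ) / 2 + M := by positivity
        linarith)
      rw [pow_zero, div_one]
      gcongr
      nlinarith
    · refine (h3 φ hφ.continuous hφs y t ht).trans ?_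
      gcongr
      have : (t ^ (Module.finrank ℝ D.H + M))⁻¹ ≤ p := by
        rw [hp, ← Real.rpow_natCast, ← Real.rpow_neg ht.le]
        apply Real.rpow_le_rpow_of_exponent_le h.le
        push_cast
        have : (0:ℝ) ≤ (Module.finrank ℝ D.H : ℝ) := by positivity
        linarith
      rw [div_eq_mul_inv]
      nlinarith
  rw [hsum]
  calc _ ≤ C1 * p * NM M φ + (C2 + C3) * p * NM M φ := by
        refine (norm_add_le _ _).trans (add_le_add (h1 φ hφ hφs y t ht) (k2.trans ?_))
        gcongr
        exact le_NM M φ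
    _ = _ := by ring

/-- Decay of the Fourier transform of `φ(L v) a₀(v)`. -/
theorem osc_decay {a0 : A → ℂ} (ha : ContDiff ℝ ∞ a0) (has : HasCompactSupport a0)
    (haΩ : tsupport a0 ⊆ D.Ω) (M : ℕ) :
    ∃ C : ℝ, 0 ≤ C ∧ ∀ φ : ℝ → ℂ, ContDiff ℝ ∞ φ → HasCompactSupport φ → ∀ ξ : A, ξ ≠ 0 →
      ‖∫ v, φ (D.L v) * a0 v * Complex.exp (D.τ (ξ * v) * Complex.I) ∂μ‖ ≤
        C * ‖ξ‖ ^ (-((Module.finrank ℝ D.H : ℝ) / 2 + M)) * NM M φ := by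
  have : ProperSpace A := FiniteDimensional.proper ℝ A
  -- cutoff in y
  obtain ⟨χ, hχ, hχs, hχ0, hχ1⟩ : ∃ χ : A → ℝ, ContDiff ℝ ∞ χ ∧ HasCompactSupport χ ∧
      (∀ y ∈ tsupport χ, y ≠ 0) ∧ ∀ y, ‖y‖ = 1 → χ y = 1 := by
    let f : ContDiffBump (0 : A) := ⟨2, 3, by norm_num, by norm_num⟩
    let g : ContDiffBump (0 : A) := ⟨1/4, 1/2, by norm_num, by norm_num⟩
    refine ⟨fun y => f y * (1 - g y), f.contDiff.mul (contDiff_const.sub g.contDiff),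
      f.hasCompactSupport.mul_right, ?_, ?_⟩
    · rintro y hy rfl
      apply notMem_tsupport_iff_eventuallyEq.mpr _ hy
      filter_upwards [Metric.ball_mem_nhds (0 : A) (show (0:ℝ) < 1/4 by norm_num)] with z hz
      have : g z = 1 := g.one_of_mem_closedBall (Metric.ball_subset_closedBall hz)
      simp [this]
    · intro y hy
      have h1 : f y = 1 := f.one_of_mem_closedBall (by simp [f, hy])
      have h2 : g y = 0 := g.zero_of_le_dist (by rw [dist_zero_right, hy]; simp [g]; norm_num)
      simp [h1, h2]
  set a : A × A → ℂ := fun x => (χ x.1 : ℂ) * a0 x.2 with had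
  have hsub : Function.support a ⊆ tsupport χ ×ˢ tsupport a0 := by
    rintro ⟨y, v⟩ hx
    refine ⟨subset_tsupport _ ?_, subset_tsupport _ ?_⟩
    · intro h0; apply hx; simp only [had]; simp only at h0; rw [h0]; simp
    · intro h0; apply hx; simp only [had]; simp only at h0; rw [h0]; simp
  have hcl : IsCompact (tsupport χ ×ˢ tsupport a0) := hχs.isCompact.prod has.isCompact
  have hts : tsupport a ⊆ tsupport χ ×ˢ tsupport a0 := closure_minimal hsub hcl.isClosed
  have hA : Amp D a := by
    refine ⟨?_, HasCompactSupport.of_support_subset_isCompact hcl hsub, fun x hx => haΩ (hts hx).2⟩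
    exact (Complex.ofRealCLM.contDiff.comp (hχ.comp contDiff_fst)).mul (ha.comp contDiff_snd)
  obtain ⟨C, hC, h⟩ := osc_amp D hA (fun x hx => hχ0 _ (hts hx).1) M
  refine ⟨C, hC, fun φ hφ hφs ξ hξ => ?_⟩
  have hn : 0 < ‖ξ‖ := norm_pos_iff.mpr hξ
  have := h φ hφ hφs (‖ξ‖⁻¹ • ξ) ‖ξ‖ hn
  refine le_trans (le_of_eq ?_) this
  unfold JJ
  congr 2; ext v
  have h1 : χ (‖ξ‖⁻¹ • ξ) = 1 := hχ1 _ (by rw [norm_smul, norm_inv, norm_norm, inv_mul_cancel₀ hn.ne'])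
  simp only [had, h1, Complex.ofReal_one, one_mul, smul_mul_assoc, map_smul, smul_eq_mul]
  congr 2
  push_cast
  have : (‖ξ‖ : ℂ) ≠ 0 := by exact_mod_cast hn.ne'
  field_simp
end RADIAL
end LandauTail

namespace LandauTail
set_option linter.unusedSectionVars false
open MeasureTheory
open scoped ContDiff

section POISSON
variable {ι : Type} [Fintype ι]

/-- integer vector as a real vector -/
def zv (m : ι → ℤ) : ι → ℝ := fun i => (m i : ℝ)

/-- unit cube with corner `m` -/
def cube (m : ι → ℤ) : Set (ι → ℝ) := {x | ∀ i, x i ∈ Set.Ioc (m i : ℝ) (m i + 1)}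

lemma cube_meas (m : ι → ℤ) : MeasurableSet (cube m) := by
  have : cube m = Set.pi Set.univ fun i => Set.Ioc (m i : ℝ) (m i + 1) := by
    ext x; simp [cube]
  rw [this]
  exact MeasurableSet.univ_pi fun i => measurableSet_Ioc

lemma cube_disj : Pairwise (Function.onFun Disjoint (cube : (ι → ℤ) → Set (ι → ℝ))) := by
  intro m k hmk
  rw [Function.onFun, Set.disjoint_left]
  intro x h1 h2
  apply hmk
  ext i
  have a := h1 i
  have b := h2 i
  have c : (m i : ℝ) < k i + 1 := a.1.trans_le b.2
  have d : (k i : ℝ) < m i + 1 := b.1.trans_le a.2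
  have c' : m i < k i + 1 := by exact_mod_cast c
  have d' : k i < m i + 1 := by exact_mod_cast d
  omega

lemma cube_union : (⋃ m : ι → ℤ, cube m) = Set.univ := by
  rw [Set.eq_univ_iff_forall]
  intro x
  rw [Set.mem_iUnion]
  refine ⟨fun i => ⌈x i⌉ - 1, fun i => ?_⟩
  push_cast
  constructor
  · have := Int.ceil_lt_add_one (x i); linarith
  · have := Int.le_ceil (x i); linarith

lemma unfold_hasSum {g : (ι → ℝ) → ℂ} (hg : Integrable g) :
    HasSum (fun m : ι → ℤ => ∫ x in cube 0, g (x + zv m)) (∫ x, g x) := by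
  have h := hasSum_integral_iUnion (μ := volume) (f := g) cube_meas cube_disj (hg.integrableOn)
  rw [cube_union, Measure.restrict_univ] at h
  refine h.congr_fun ?_
  intro m
  have e : cube (0 : ι → ℤ) = (fun x => x + zv m) ⁻¹' cube m := by
    ext x
    simp only [cube, zv, Set.mem_preimage, Set.mem_setOf_eq, Pi.add_apply, Set.mem_Ioc, Pi.zero_apply, Int.cast_zero]
    refine forall_congr' fun i => ?_
    constructor <;> rintro ⟨h1, h2⟩ <;> constructor <;> linarith
  rw [e]
  exact (measurePreserving_add_right volume (zv m)).setIntegral_preimage_emb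
    (measurableEmbedding_addRight (zv m)) g (cube m)

lemma unfold_tsum {g : (ι → ℝ) → ℂ} (hg : Integrable g) :
    ∫ x in cube 0, ∑' m : ι → ℤ, g (x + zv m) = ∫ x, g x := by
  have h := unfold_hasSum hg
  have hn : Integrable (fun x => ((‖g x‖ : ℝ) : ℂ)) := hg.norm.ofReal
  have h2 := (unfold_hasSum hn).summable
  have h3 := hasSum_integral_of_summable_integral_norm (μ := volume.restrict (cube (0 : ι → ℤ)))
    (F := fun (m : ι → ℤ) x => g (x + zv m)) (fun m => (hg.comp_add_right (zv m)).integrableOn) ?_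
  · exact h3.unique h
  · have := h2.norm
    refine this.congr fun m => ?_
    have e := integral_ofReal (𝕜 := ℂ) (μ := volume.restrict (cube (0 : ι → ℤ))) (f := fun x => ‖g (x + zv m)‖)
    refine (congrArg norm e).trans ?_
    refine (Complex.norm_real _).trans ?_
    exact abs_of_nonneg (integral_nonneg fun x => norm_nonneg (g (x + zv m)))

lemma mk_eq (x y : ι → ℝ) (h : (fun i => (x i : UnitAddCircle)) = fun i => (y i : UnitAddCircle)) :
    ∃ m : ι → ℤ, y = x + zv m := by
  have h1 : ∀ i, ∃ m : ℤ, y i = x i + m := by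
    intro i
    have := congrFun h i
    erw [QuotientAddGroup.eq] at this
    rw [ AddSubgroup.mem_zmultiples_iff] at this
    obtain ⟨k, hk⟩ := this
    refine ⟨k, ?_⟩
    simp at hk
    linarith
  choose m hm using h1
  exact ⟨m, funext hm⟩

lemma per_cont {f : (ι → ℝ) → ℂ} (hf : Continuous f) (hs : HasCompactSupport f) :
    Continuous fun x => ∑' m : ι → ℤ, f (x + zv m) := by
  classical
  obtain ⟨R, hR⟩ := hs.isCompact.isBounded.subset_closedBall 0
  rw [continuous_iff_continuousAt]
  intro x0
  have : ∀ᶠ x in 𝓝 x0, ∑' m : ι → ℤ, f (x + zv m) =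
      ∑ m ∈ (Fintype.piFinset fun _ : ι => Finset.Icc (-⌈R + ‖x0‖ + 1⌉) ⌈R + ‖x0‖ + 1⌉), f (x + zv m) := by
    filter_upwards [Metric.ball_mem_nhds x0 one_pos] with x hx
    apply tsum_eq_sum
    intro m hm
    apply image_eq_zero_of_notMem_tsupport
    intro h
    apply hm
    have h1 := hR h
    rw [mem_closedBall_zero_iff] at h1
    have hx' : ‖x‖ ≤ ‖x0‖ + 1 := by
      have := norm_le_norm_add_norm_sub' x x0
      rw [Metric.mem_ball, dist_eq_norm] at hx
      linarith [norm_sub_rev x x0]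
    rw [Fintype.mem_piFinset]
    intro i
    have h2 : ‖x i + m i‖ ≤ R := (norm_le_pi_norm (x + zv m) i).trans h1
    have h3 : ‖x i‖ ≤ ‖x0‖ + 1 := (norm_le_pi_norm x i).trans hx'
    rw [Real.norm_eq_abs, abs_le] at h2 h3
    rw [Finset.mem_Icc]
    constructor
    · have : (-⌈R + ‖x0‖ + 1⌉ : ℝ) ≤ m i := by
        have := Int.le_ceil (R + ‖x0‖ + 1); linarith
      exact_mod_cast this
    · have : (m i : ℝ) ≤ ⌈R + ‖x0‖ + 1⌉ := by
        have := Int.le_ceil (R + ‖x0‖ + 1); linarith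
      exact_mod_cast this
  refine ContinuousAt.congr ?_ (this.mono fun _ h => h.symm)
  apply Continuous.continuousAt
  fun_prop

lemma per_per (f : (ι → ℝ) → ℂ) (x : ι → ℝ) (k : ι → ℤ) :
    ∑' m : ι → ℤ, f (x + zv k + zv m) = ∑' m : ι → ℤ, f (x + zv m) := by
  rw [← (Equiv.addLeft k).tsum_eq (fun m => f (x + zv m))]
  congr 1; ext m
  congr 1; ext i; simp [zv]; ring

lemma mk_quot : IsOpenQuotientMap fun (x : ι → ℝ) (i : ι) => (x i : UnitAddCircle) := by
  apply IsOpenQuotientMap.piMap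
  intro i
  exact QuotientAddGroup.isOpenQuotientMap_mk

theorem poisson {f : (ι → ℝ) → ℂ} (hf : Continuous f) (hs : HasCompactSupport f)
    (hsum : Summable fun k : ι → ℤ => ∫ x, Complex.exp (((-2 * Real.pi * ∑ i, (k i : ℝ) * x i : ℝ) : ℂ) * Complex.I) * f x) :
    ∑' m : ι → ℤ, f (zv m) =
      ∑' k : ι → ℤ, ∫ x, Complex.exp (((-2 * Real.pi * ∑ i, (k i : ℝ) * x i : ℝ) : ℂ) * Complex.I) * f x := by
  let P : (ι → ℝ) → UnitAddTorus ι := fun (x : ι → ℝ) (i : ι) => (x i : UnitAddCircle)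
  let F : (ι → ℝ) → ℂ := fun x => ∑' m : ι → ℤ, f (x + zv m)
  have hP : IsOpenQuotientMap P := mk_quot
  let G : UnitAddTorus ι → ℂ := fun q => F (Function.surjInv hP.surjective q)
  have hG : ∀ x, G (P x) = F x := by
    intro x
    obtain ⟨m, hm⟩ := mk_eq x (Function.surjInv hP.surjective (P x)) (Function.surjInv_eq hP.surjective (P x)).symm
    simp only [G, F]
    rw [hm, per_per]
  have hGc : Continuous G := by
    rw [hP.isQuotientMap.continuous_iff]
    have : G ∘ P = F := funext hG
    rw [this]
    exact per_cont hf hs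
  have hcoe : ∀ k : ι → ℤ, UnitAddTorus.mFourierCoeff G k =
      ∫ x, Complex.exp (((-2 * Real.pi * ∑ i, (k i : ℝ) * x i : ℝ) : ℂ) * Complex.I) * f x := by
    intro k
    have hchar : ∀ x : ι → ℝ, UnitAddTorus.mFourier (-k) (P x) =
        Complex.exp (((-2 * Real.pi * ∑ i, (k i : ℝ) * x i : ℝ) : ℂ) * Complex.I) := by
      intro x
      simp only [UnitAddTorus.mFourier, ContinuousMap.coe_mk, P, fourier_coe_apply]
      rw [← Complex.exp_sum]
      congr 1
      push_cast
      rw [Finset.mul_sum, Finset.sum_mul]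
      congr 1; ext i
      simp; ring
    have hper : ∀ (x : ι → ℝ) (m : ι → ℤ), P (x + zv m) = P x := by
      intro x m; ext i
      simp [P, zv]
    rw [UnitAddTorus.mFourierCoeff_eq_integral G k 0]
    have hcube : {x : ι → ℝ | ∀ i, x i ∈ Set.Ioc ((0 : ι → ℝ) i) ((0 : ι → ℝ) i + 1)} = cube 0 := by
      ext x; simp [cube]
    rw [hcube]
    have : Integrable fun x => UnitAddTorus.mFourier (-k) (P x) * f x := by
      apply Continuous.integrable_of_hasCompactSupport
      · exact ((UnitAddTorus.mFourier (-k)).continuous.comp hP.continuous).mul hf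
      · exact hs.mul_left
    have h4 := unfold_tsum this
    simp_rw [hper, tsum_mul_left] at h4
    simp_rw [← hchar]
    rw [← h4]
    congr 1; ext x
    rw [smul_eq_mul]
    congr 1
    exact hG x
  have hG' : Summable (UnitAddTorus.mFourierCoeff (⟨G, hGc⟩ : C(UnitAddTorus ι, ℂ))) := by
    refine hsum.congr fun k => (hcoe k).symm
  have h5 := UnitAddTorus.hasSum_mFourier_series_apply_of_summable hG' (P 0)
  have h6 := h5.tsum_eq
  have h7 : (⟨G, hGc⟩ : C(UnitAddTorus ι, ℂ)) (P 0) = ∑' m : ι → ℤ, f (zv m) := by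
    change G (P 0) = _
    rw [hG]
    simp [F]
  rw [h7] at h6
  rw [← h6]
  congr 1; ext k
  rw [← hcoe k]
  simp [UnitAddTorus.mFourier, P]
  
end POISSON
end LandauTail

namespace LandauTail
set_option linter.unusedSectionVars false
open MeasureTheory
open scoped ContDiff

section FREQ

/-- one dimensional weight -/
def Hs (s Q κ : ℝ) : ℝ := κ ^ (-s) * (min 1 (Q / κ)) ^ 2

lemma Hs_nonneg {s Q κ : ℝ} (hκ : 0 ≤ κ) : 0 ≤ Hs s Q κ := by
  unfold Hs; have := Real.rpow_nonneg hκ (-s); positivity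

lemma sum_rpow_le {s : ℝ} (h0 : 0 < s) (h1 : s < 1) (M : ℕ) :
    ∑ j ∈ Finset.range M, ((j + 1 : ℕ) : ℝ) ^ (-s) ≤ (M : ℝ) ^ (1 - s) / (1 - s) := by
  have hp : 0 < 1 - s := by linarith
  induction M with
  | zero => simp [Real.zero_rpow hp.ne']
  | succ M ih =>
    rw [Finset.sum_range_succ]
    have hj : (0 : ℝ) < ((M + 1 : ℕ) : ℝ) := by positivity
    have h2 := rpow_one_add_le_one_add_mul_self (s := -1 / ((M + 1 : ℕ) : ℝ)) (p := 1 - s) (by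
      rw [le_div_iff₀ hj]; push_cast; have : (0 : ℝ) ≤ M := by positivity
      linarith) hp.le (by linarith)
    have h3 : (M : ℝ) = ((M + 1 : ℕ) : ℝ) * (1 + -1 / ((M + 1 : ℕ) : ℝ)) := by
      field_simp; push_cast; ring
    have h4 : (M : ℝ) ^ (1 - s) ≤ ((M + 1 : ℕ) : ℝ) ^ (1 - s) * (1 + (1 - s) * (-1 / ((M + 1 : ℕ) : ℝ))) := by
      have h5 : 0 ≤ 1 + -1 / ((M + 1 : ℕ) : ℝ) := by
        have : (M : ℝ) / ((M + 1 : ℕ) : ℝ) = 1 + -1 / ((M + 1 : ℕ) : ℝ) := by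
          field_simp; push_cast; ring
        rw [← this]; positivity
      conv_lhs => rw [h3]
      rw [Real.mul_rpow hj.le h5]
      gcongr
    have h6 : ((M + 1 : ℕ) : ℝ) ^ (-s) = ((M + 1 : ℕ) : ℝ) ^ (1 - s) * (1 / ((M + 1 : ℕ) : ℝ)) := by
      rw [show -s = (1 - s) - 1 by ring, Real.rpow_sub_one hj.ne']; ring
    rw [le_div_iff₀ hp] at ih ⊢
    rw [add_mul]
    calc _ ≤ (M : ℝ) ^ (1 - s) + ((M + 1 : ℕ) : ℝ) ^ (-s) * (1 - s) := by gcongr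
      _ ≤ _ := by
        rw [h6]
        refine (add_le_add_left h4 _).trans (le_of_eq ?_)
        ring

lemma one_dim {s : ℝ} (h0 : 0 < s) (h1 : s ≤ 1) : ∃ C : ℝ, 0 ≤ C ∧ ∀ Q : ℝ, 1 ≤ Q → (s = 1 → Q = 1) →
    ∀ N : ℕ, ∑ j ∈ Finset.range N, Hs s Q ((j + 1 : ℕ) : ℝ) ≤ C * Q ^ (1 - s) := by
  have key : ∃ C : ℝ, 0 ≤ C ∧ ∀ Q : ℝ, 1 ≤ Q → (s = 1 → Q = 1) →
      ∑ j ∈ Finset.range ⌊Q⌋₊, ((j + 1 : ℕ) : ℝ) ^ (-s) ≤ C * Q ^ (1 - s) := by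
    rcases h1.lt_or_eq with h1 | h1
    · refine ⟨1 / (1 - s), by have : 0 < 1 - s := by linarith
                              positivity, fun Q hQ _ => (sum_rpow_le h0 h1 _).trans ?_⟩
      have : 0 < 1 - s := by linarith
      rw [div_mul_eq_mul_div, one_mul]
      gcongr
      exact Nat.floor_le (by linarith)
    · refine ⟨1, zero_le_one, fun Q hQ h => ?_⟩
      rw [h h1]
      simp
  obtain ⟨C, hC, hk⟩ := key
  refine ⟨C + 2, by linarith, fun Q hQ hQ1 N => ?_⟩
  have hQ0 : 0 < Q := by linarith
  set M := ⌊Q⌋₊ with hM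
  have hMQ : (M : ℝ) ≤ Q := Nat.floor_le hQ0.le
  have hMQ' : Q < M + 1 := Nat.lt_floor_add_one Q
  have hle : ∑ j ∈ Finset.range N, Hs s Q ((j + 1 : ℕ) : ℝ) ≤
      ∑ j ∈ Finset.range M, ((j + 1 : ℕ) : ℝ) ^ (-s) +
      ∑ i ∈ Finset.Ioo M (N + 1), Q ^ (2 - s) * ((i : ℝ) ^ 2)⁻¹ := by
    have hlow : ∀ j : ℕ, Hs s Q ((j + 1 : ℕ) : ℝ) ≤ ((j + 1 : ℕ) : ℝ) ^ (-s) := by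
      intro j
      unfold Hs
      have h2 : (min 1 (Q / ((j + 1 : ℕ) : ℝ))) ^ 2 ≤ 1 :=
        pow_le_one₀ (le_min zero_le_one (by positivity)) (min_le_left _ _)
      exact mul_le_of_le_one_right (by positivity) h2
    have hhigh : ∀ j : ℕ, M ≤ j → Hs s Q ((j + 1 : ℕ) : ℝ) ≤ Q ^ (2 - s) * ((((j + 1 : ℕ) : ℝ)) ^ 2)⁻¹ := by
      intro j hj
      have hj' : (M : ℝ) ≤ j := by exact_mod_cast hj
      have hqj : Q ≤ ((j + 1 : ℕ) : ℝ) := by push_cast; linarith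
      unfold Hs
      have h2 : ((j + 1 : ℕ) : ℝ) ^ (-s) ≤ Q ^ (-s) := Real.rpow_le_rpow_of_nonpos hQ0 hqj (by linarith)
      have h3 : (min 1 (Q / ((j + 1 : ℕ) : ℝ))) ^ 2 ≤ (Q / ((j + 1 : ℕ) : ℝ)) ^ 2 :=
        pow_le_pow_left₀ (le_min zero_le_one (by positivity)) (min_le_right _ _) 2
      calc _ ≤ Q ^ (-s) * (Q / ((j + 1 : ℕ) : ℝ)) ^ 2 := by gcongr
        _ = _ := by
          rw [show 2 - s = -s + (2 : ℕ) by push_cast; ring, Real.rpow_add_natCast hQ0.ne']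
          rw [div_pow]; ring
    rcases le_total N M with hNM | hNM
    · have : 0 ≤ ∑ i ∈ Finset.Ioo M (N + 1), Q ^ (2 - s) * ((i : ℝ) ^ 2)⁻¹ :=
        Finset.sum_nonneg fun i _ => by positivity
      have h5 : ∑ j ∈ Finset.range N, Hs s Q ((j + 1 : ℕ) : ℝ) ≤ ∑ j ∈ Finset.range M, ((j + 1 : ℕ) : ℝ) ^ (-s) :=
        (Finset.sum_le_sum fun j _ => hlow j).trans
          (Finset.sum_le_sum_of_subset_of_nonneg (Finset.range_mono hNM) fun i _ _ => by positivity)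
      linarith
    · induction N, hNM using Nat.le_induction with
      | base =>
        have : 0 ≤ ∑ i ∈ Finset.Ioo M (M + 1), Q ^ (2 - s) * ((i : ℝ) ^ 2)⁻¹ :=
          Finset.sum_nonneg fun i _ => by positivity
        have h5 : ∑ j ∈ Finset.range M, Hs s Q ((j + 1 : ℕ) : ℝ) ≤ ∑ j ∈ Finset.range M, ((j + 1 : ℕ) : ℝ) ^ (-s) :=
          Finset.sum_le_sum fun j _ => hlow j
        linarith
      | succ N hN ih =>
        rw [Finset.sum_range_succ]
        have e : Finset.Ioo M (N + 1 + 1) = insert (N + 1) (Finset.Ioo M (N + 1)) := by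
          ext i; simp only [Finset.mem_Ioo, Finset.mem_insert]; omega
        rw [e, Finset.sum_insert (by simp)]
        have := hhigh N hN
        linarith
  refine hle.trans ?_
  rw [← Finset.mul_sum]
  have h3 := sum_Ioo_inv_sq_le (α := ℝ) M (N + 1)
  have h4 : Q ^ (2 - s) * ∑ i ∈ Finset.Ioo M (N + 1), ((i : ℝ) ^ 2)⁻¹ ≤ 2 * Q ^ (1 - s) := by
    have e : Q ^ (2 - s) = Q ^ (1 - s) * Q := by
      rw [← Real.rpow_add_one hQ0.ne']; congr 1; ring
    have h5 : Q * (2 / ((M : ℝ) + 1)) ≤ 2 := by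
      rw [mul_div_assoc', div_le_iff₀ (by positivity)]; linarith
    calc _ ≤ Q ^ (2 - s) * (2 / ((M : ℝ) + 1)) := by gcongr
      _ = Q ^ (1 - s) * (Q * (2 / ((M : ℝ) + 1))) := by rw [e]; ring
      _ ≤ Q ^ (1 - s) * 2 := by gcongr
      _ = _ := by ring
  have := hk Q hQ hQ1
  linarith

/-- size of an integer -/
def kap (k : ℤ) : ℝ := max 1 |(k : ℝ)|

lemma one_le_kap (k : ℤ) : 1 ≤ kap k := le_max_left _ _

lemma one_dim_int {s : ℝ} (h0 : 0 < s) (h1 : s ≤ 1) : ∃ C : ℝ, 0 ≤ C ∧ ∀ Q : ℝ, 1 ≤ Q → (s = 1 → Q = 1) →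
    ∀ T : Finset ℤ, ∑ k ∈ T, Hs s Q (kap k) ≤ C * Q ^ (1 - s) := by
  obtain ⟨C, hC, h⟩ := one_dim h0 h1
  refine ⟨1 + 2 * C, by linarith, fun Q hQ hQ1 T => ?_⟩
  have hb := h Q hQ hQ1
  have hn : ∀ n : ℕ, 0 ≤ Hs s Q ((n + 1 : ℕ) : ℝ) := fun n => Hs_nonneg (by positivity)
  have hsum : Summable fun n : ℕ => Hs s Q ((n + 1 : ℕ) : ℝ) := summable_of_sum_range_le hn hb
  have hts : ∑' n : ℕ, Hs s Q ((n + 1 : ℕ) : ℝ) ≤ C * Q ^ (1 - s) := hsum.tsum_le_of_sum_range_le hb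
  have e1 : (fun n : ℕ => Hs s Q (kap (-((n : ℤ) + 1)))) = fun n : ℕ => Hs s Q ((n + 1 : ℕ) : ℝ) := by
    ext n; congr 1
    unfold kap
    push_cast
    rw [abs_neg, abs_of_nonneg (by positivity), max_eq_right]
    have : (0 : ℝ) ≤ n := by positivity
    linarith
  have e2 : HasSum (fun n : ℕ => Hs s Q (kap (n : ℤ))) (Hs s Q 1 + ∑' n : ℕ, Hs s Q ((n + 1 : ℕ) : ℝ)) := by
    have : (fun n : ℕ => Hs s Q (kap ((n + 1 : ℕ) : ℤ))) = fun n : ℕ => Hs s Q ((n + 1 : ℕ) : ℝ) := by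
      ext n; congr 1
      unfold kap
      push_cast
      rw [abs_of_nonneg (by positivity), max_eq_right]
      have : (0 : ℝ) ≤ n := by positivity
      linarith
    have h3 := hsum.hasSum
    have h4 := (hasSum_nat_add_iff (f := fun n : ℕ => Hs s Q (kap (n : ℤ)))
      (g := ∑' n : ℕ, Hs s Q ((n + 1 : ℕ) : ℝ)) 1).mp (by rw [this]; exact h3)
    rw [add_comm]
    simpa [kap] using h4
  have h5 := HasSum.of_nat_of_neg_add_one (f := fun k : ℤ => Hs s Q (kap k)) e2 (by rw [e1]; exact hsum.hasSum)
  have h6 : ∑ k ∈ T, Hs s Q (kap k) ≤ _ :=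
    sum_le_hasSum T (fun k _ => Hs_nonneg (zero_le_one.trans (one_le_kap k))) h5
  have h7 : Hs s Q 1 ≤ 1 * Q ^ (1 - s) := by
    unfold Hs
    rw [Real.one_rpow, one_mul, div_one, min_eq_left hQ, one_mul, one_pow]
    exact Real.one_le_rpow hQ (by linarith)
  linarith

lemma multi_dim {ι : Type} [Fintype ι] {s : ℝ} (h0 : 0 < s) (h1 : s ≤ 1) :
    ∃ C : ℝ, 0 ≤ C ∧ ∀ Q : ℝ, 1 ≤ Q → (s = 1 → Q = 1) →
    ∀ T : Finset (ι → ℤ), ∑ k ∈ T, ∏ i, Hs s Q (kap (k i)) ≤ C * Q ^ ((1 - s) * Fintype.card ι) := by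
  classical
  obtain ⟨C, hC, h⟩ := one_dim_int h0 h1
  refine ⟨C ^ Fintype.card ι, by positivity, fun Q hQ hQ1 T => ?_⟩
  have hn : ∀ k, 0 ≤ Hs s Q (kap k) := fun k => Hs_nonneg (zero_le_one.trans (one_le_kap k))
  calc _ ≤ ∑ k ∈ Fintype.piFinset (fun i => T.image fun k => k i), ∏ i, Hs s Q (kap (k i)) := by
        apply Finset.sum_le_sum_of_subset_of_nonneg
        · intro k hk
          rw [Fintype.mem_piFinset]
          intro i
          exact Finset.mem_image_of_mem (fun k : ι → ℤ => k i) hk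
        · intro k _ _
          exact Finset.prod_nonneg fun i _ => hn _
    _ = ∏ i, ∑ k ∈ T.image (fun k => k i), Hs s Q (kap k) := by
        rw [Finset.prod_univ_sum]
    _ ≤ ∏ i : ι, C * Q ^ (1 - s) := by
        apply Finset.prod_le_prod
        · exact fun i _ => Finset.sum_nonneg fun k _ => hn k
        · exact fun i _ => h Q hQ hQ1 _
    _ = _ := by
        rw [Finset.prod_const, Finset.card_univ, mul_pow, Real.rpow_mul (by linarith), Real.rpow_natCast]

end FREQ
end LandauTail

namespace LandauTail
set_option linter.unusedSectionVars false
open MeasureTheory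
open scoped ContDiff

section LATTICE
variable {A : Type} [NormedCommRing A] [NormedAlgebra ℝ A] [FiniteDimensional ℝ A]
  [MeasurableSpace A] [BorelSpace A] {μ : Measure A} [μ.IsAddHaarMeasure] (D : Datum A μ)
  {ι : Type} [Fintype ι]

lemma finrank_H : (Module.finrank ℝ D.H : ℝ) = (Module.finrank ℝ A : ℝ) - 1 := by
  have h1 := LinearMap.finrank_range_add_finrank_ker (D.τ : A →ₗ[ℝ] ℝ)
  have h2 : LinearMap.range (D.τ : A →ₗ[ℝ] ℝ) = ⊤ := by
    apply LinearMap.range_eq_top.mpr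
    intro r
    have hn : (Module.finrank ℝ A : ℝ) ≠ 0 := by exact_mod_cast D.one_pos.ne'
    refine ⟨(r / Module.finrank ℝ A) • 1, ?_⟩
    simp [D.τ_one, hn]
  rw [h2, finrank_top, Module.finrank_self] at h1
  have h3 : Module.finrank ℝ D.H = Module.finrank ℝ (LinearMap.ker (D.τ : A →ₗ[ℝ] ℝ)) := rfl
  rw [h3, ← h1]; push_cast; ring

lemma exists_c0 (b : Module.Basis ι ℝ A) (μ : Measure A) [μ.IsAddHaarMeasure] :
    ∃ c0 : ℝ, 0 < c0 ∧ ∀ F : A → ℂ, ∫ x : ι → ℝ, F (b.equivFun.symm x) = c0 * ∫ v, F v ∂μ := by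
  let e : (ι → ℝ) ≃L[ℝ] A := b.equivFun.symm.toContinuousLinearEquiv
  let ν : Measure A := Measure.map e volume
  haveI : ν.IsAddHaarMeasure := e.isAddHaarMeasure_map volume
  have h := Measure.isAddLeftInvariant_eq_smul ν μ
  refine ⟨(Measure.addHaarScalarFactor ν μ : ℝ), ?_, fun F => ?_⟩
  · have := Measure.addHaarScalarFactor_pos_of_isAddHaarMeasure ν μ
    exact_mod_cast this
  · have h1 : ∫ x : ι → ℝ, F (b.equivFun.symm x) = ∫ v, F v ∂ν :=
      (e.toHomeomorph.measurableEmbedding.integral_map F).symm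
    rw [h1]
    have h2 : ∫ v, F v ∂ν = ∫ v, F v ∂(ν.addHaarScalarFactor μ • μ) := congrArg (fun m => ∫ v, F v ∂m) h
    rw [h2, integral_smul_nnreal_measure]
    rfl

/-- The vectors representing the characters of the lattice. -/
lemma exists_xi (b : Module.Basis ι ℝ A) : ∃ ξ : (ι → ℝ) →ₗ[ℝ] A,
    (∀ k x, D.τ (ξ k * b.equivFun.symm x) = -2 * Real.pi * ∑ i, k i * x i) ∧
    ∃ c : ℝ, 0 < c ∧ c ≤ 1 ∧ ∀ k, c * ‖k‖ ≤ ‖ξ k‖ := by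
  let T : A →ₗ[ℝ] Module.Dual ℝ A := LinearMap.mk₂ ℝ (fun a v => D.τ (a * v))
    (by intros; simp [add_mul]) (by intros; simp) (by intros; simp [mul_add]) (by intros; simp)
  have hT : ∀ a v, T a v = D.τ (a * v) := fun a v => rfl
  have hTi : Function.Injective T := by
    rw [← LinearMap.ker_eq_bot, LinearMap.ker_eq_bot']
    intro a ha
    by_contra h
    have h1 := D.pos a h
    rw [← hT, ha] at h1
    simp at h1
  let e : A ≃ₗ[ℝ] Module.Dual ℝ A := LinearEquiv.ofInjectiveOfFinrankEq T hTi (by simp)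
  have he : ∀ a, e a = T a := fun a => rfl
  let Φ : (ι → ℝ) →ₗ[ℝ] Module.Dual ℝ A := LinearMap.mk₂ ℝ
    (fun k v => -2 * Real.pi * ∑ i, k i * b.equivFun v i)
    (by intros; simp [add_mul, Finset.sum_add_distrib, mul_add])
    (by intros; simp [mul_assoc, ← Finset.mul_sum]; ring)
    (by intros; simp [Finset.sum_add_distrib, mul_add])
    (by intros; simp [← Finset.mul_sum, mul_left_comm])
  have hΦ : ∀ k v, Φ k v = -2 * Real.pi * ∑ i, k i * b.equivFun v i := fun k v => rfl
  let ξ : (ι → ℝ) →ₗ[ℝ] A := e.symm.toLinearMap.comp Φ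
  have hξ : ∀ k x, D.τ (ξ k * b.equivFun.symm x) = -2 * Real.pi * ∑ i, k i * x i := by
    intro k x
    rw [← hT, ← he]
    have : e (ξ k) = Φ k := e.apply_symm_apply _
    rw [this, hΦ, LinearEquiv.apply_symm_apply]
  have hinj : LinearMap.ker ξ = ⊥ := by
    rw [LinearMap.ker_eq_bot']
    intro k hk
    have h1 := hξ k k
    rw [hk, zero_mul, map_zero] at h1
    have h2 : ∑ i, k i * k i = 0 := by
      have := Real.pi_pos
      rcases mul_eq_zero.mp h1.symm with h | h
      · linarith
      · exact h
    rw [Finset.sum_eq_zero_iff_of_nonneg (fun i _ => mul_self_nonneg _)] at h2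
    ext i
    exact mul_self_eq_zero.mp (h2 i (Finset.mem_univ i))
  refine ⟨ξ, hξ, ?_⟩
  obtain ⟨C, hC, hl⟩ := ξ.exists_antilipschitzWith hinj
  have hC' : (0 : ℝ) < C := by exact_mod_cast hC
  refine ⟨min 1 (C : ℝ)⁻¹, by positivity, min_le_left _ _, fun k => ?_⟩
  have h1 := hl.le_mul_dist k 0
  simp at h1
  calc _ ≤ (C : ℝ)⁻¹ * ‖k‖ := by gcongr; exact min_le_right _ _
    _ ≤ _ := by rw [inv_mul_le_iff₀ hC']; exact h1

lemma Hs_anti {s Q x y : ℝ} (hs : 0 < s) (hQ : 0 < Q) (hx : 0 < x) (hxy : x ≤ y) : Hs s Q y ≤ Hs s Q x := by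
  unfold Hs
  have h1 : y ^ (-s) ≤ x ^ (-s) := Real.rpow_le_rpow_of_nonpos hx hxy (by linarith)
  have hy : 0 < y := hx.trans_le hxy
  have h2 : min 1 (Q / y) ≤ min 1 (Q / x) := by gcongr
  have h3 : 0 ≤ min 1 (Q / y) := by positivity
  have h4 : 0 ≤ x ^ (-s) := by positivity
  gcongr

lemma kap_le_norm {k : ι → ℤ} (hk : k ≠ 0) (i : ι) : kap (k i) ≤ ‖zv k‖ := by
  unfold kap
  apply max_le
  · obtain ⟨j, hj⟩ := Function.ne_iff.mp hk
    refine le_trans ?_ (norm_le_pi_norm (zv k) j)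
    simp only [zv, Real.norm_eq_abs]
    have : (1 : ℤ) ≤ |k j| := Int.one_le_abs hj
    exact_mod_cast this
  · exact norm_le_pi_norm (zv k) i

lemma g_cont {a0 : A → ℂ} (ha : ContDiff ℝ ∞ a0) (has : HasCompactSupport a0) (haΩ : tsupport a0 ⊆ D.Ω)
    {φ : ℝ → ℂ} (hφ : Continuous φ) :
    Continuous (fun v => φ (D.L v) * a0 v) ∧ HasCompactSupport (fun v => φ (D.L v) * a0 v) := by
  refine ⟨?_, has.mul_left⟩
  rw [continuous_iff_continuousAt]
  intro v
  by_cases hv : v ∈ tsupport a0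
  · exact (hφ.continuousAt.comp (D.L_smooth v (haΩ hv)).continuousAt).mul ha.continuous.continuousAt
  · have h1 := notMem_tsupport_iff_eventuallyEq.mp hv
    have : (fun v => φ (D.L v) * a0 v) =ᶠ[𝓝 v] fun _ => 0 := by
      filter_upwards [h1] with x hx
      simp [hx]
    exact this.continuousAt

/-- bound of a single frequency -/
lemma coeff_bound {a0 : A → ℂ} (ha : ContDiff ℝ ∞ a0) (has : HasCompactSupport a0) (haΩ : tsupport a0 ⊆ D.Ω)
    {n : ℕ} (hn : Module.finrank ℝ A = n) {c : ℝ} (hc : 0 < c) (hc1 : c ≤ 1) :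
    ∃ C : ℝ, 0 ≤ C ∧ ∀ φ : ℝ → ℂ, ContDiff ℝ ∞ φ → HasCompactSupport φ → ∀ R q Q x : ℝ, 1 ≤ R → 0 ≤ q →
      1 ≤ Q → 1 ≤ x → NM 1 φ ≤ q → NM (1 + 2 * n) φ ≤ q * (Q * R) ^ (2 * n) →
      ∀ ξ : A, R * (c * x) ≤ ‖ξ‖ →
      ‖∫ v, φ (D.L v) * a0 v * Complex.exp (((D.τ (ξ * v) : ℝ) : ℂ) * Complex.I) ∂μ‖ ≤
        C * q * R ^ (-(((n : ℝ) + 1) / 2)) * (Hs (((n : ℝ) + 1) / (2 * n)) Q x) ^ n := by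
  have hn0 : 0 < n := hn ▸ D.one_pos
  have hnR : (0 : ℝ) < n := by exact_mod_cast hn0
  obtain ⟨C1, hC1, h1⟩ := osc_decay D ha has haΩ 1
  obtain ⟨C2, hC2, h2⟩ := osc_decay D ha has haΩ (1 + 2 * n)
  set p : ℝ := ((n : ℝ) + 1) / 2 with hp
  refine ⟨(C1 + C2) * c ^ (-(p + (2 * n : ℕ))), by positivity, ?_⟩
  intro φ hφ hφs R q Q x hR hq hQ hx hq1 hq2 ξ hξ
  have hR0 : 0 < R := by linarith
  have hx0 : 0 < x := by linarith
  have hQ0 : 0 < Q := by linarith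
  have hpos : 0 < R * (c * x) := by positivity
  have hξ0 : ξ ≠ 0 := norm_pos_iff.mp (hpos.trans_le hξ)
  have e1 := h1 φ hφ hφs ξ hξ0
  have e2 := h2 φ hφ hφs ξ hξ0
  rw [finrank_H, hn] at e1 e2
  rw [show -(((n : ℝ) - 1) / 2 + ((1 : ℕ) : ℝ)) = -p by rw [hp]; push_cast; ring] at e1
  rw [show -(((n : ℝ) - 1) / 2 + ((1 + 2 * n : ℕ) : ℝ)) = -(p + (2 * n : ℕ)) by rw [hp]; push_cast; ring] at e2
  have hp0 : 0 < p := by positivity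
  have hHs : (Hs (((n : ℝ) + 1) / (2 * n)) Q x) ^ n = x ^ (-p) * (min 1 (Q / x)) ^ (2 * n) := by
    unfold Hs
    rw [mul_pow, ← Real.rpow_natCast, ← Real.rpow_mul hx0.le, ← pow_mul]
    congr 2
    rw [hp]; field_simp
  rw [hHs]
  have hcp : 1 ≤ c ^ (-(p + (2 * n : ℕ))) := Real.one_le_rpow_of_pos_of_le_one_of_nonpos hc hc1 (by
    have : (0 : ℝ) ≤ (2 * n : ℕ) := by positivity
    linarith)
  have hcp2 : c ^ (-p) ≤ c ^ (-(p + (2 * n : ℕ))) := Real.rpow_le_rpow_of_exponent_ge hc hc1 (by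
    have : (0 : ℝ) ≤ (2 * n : ℕ) := by positivity
    linarith)
  have hcp0 : 0 < c ^ (-p) := by positivity
  rcases le_total Q x with hQx | hQx
  · have hm : min 1 (Q / x) = Q / x := min_eq_right (by rw [div_le_one hx0]; exact hQx)
    rw [hm]
    have e3 : ‖ξ‖ ^ (-(p + (2 * n : ℕ))) ≤ (R * (c * x)) ^ (-(p + (2 * n : ℕ))) :=
      Real.rpow_le_rpow_of_nonpos hpos hξ (by
        have : (0 : ℝ) ≤ (2 * n : ℕ) := by positivity
        linarith)
    calc _ ≤ _ := e2
      _ ≤ C2 * (R * (c * x)) ^ (-(p + (2 * n : ℕ))) * (q * (Q * R) ^ (2 * n)) := by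
          have := NM_nonneg (1 + 2 * n) φ
          gcongr
      _ = C2 * c ^ (-(p + (2 * n : ℕ))) * q * R ^ (-p) * (x ^ (-p) * (Q / x) ^ (2 * n)) := by
          rw [Real.mul_rpow hR0.le (by positivity), Real.mul_rpow hc.le hx0.le, neg_add, Real.rpow_add hR0,
            Real.rpow_add hx0, Real.rpow_neg hR0.le (((2 * n : ℕ)) : ℝ), Real.rpow_neg hx0.le (((2 * n : ℕ)) : ℝ),
            Real.rpow_natCast, Real.rpow_natCast, mul_pow, div_pow]
          field_simp
      _ ≤ _ := by gcongr; linarith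
  · have hm : min 1 (Q / x) = 1 := min_eq_left (by rw [one_le_div hx0]; exact hQx)
    rw [hm, one_pow, mul_one]
    have e3 : ‖ξ‖ ^ (-p) ≤ (R * (c * x)) ^ (-p) :=
      Real.rpow_le_rpow_of_nonpos hpos hξ (by linarith)
    calc _ ≤ _ := e1
      _ ≤ C1 * (R * (c * x)) ^ (-p) * q := by
          have := NM_nonneg 1 φ
          gcongr
      _ = C1 * c ^ (-p) * q * R ^ (-p) * x ^ (-p) := by
          rw [Real.mul_rpow hR0.le (by positivity), Real.mul_rpow hc.le hx0.le]; ring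
      _ ≤ _ := by gcongr; linarith

theorem lattice_count (b : Module.Basis ι ℝ A) {a0 : A → ℂ} (ha : ContDiff ℝ ∞ a0)
    (has : HasCompactSupport a0) (haΩ : tsupport a0 ⊆ D.Ω) {n : ℕ} (hn : Module.finrank ℝ A = n) :
    ∃ c0 : ℝ, 0 < c0 ∧ ∃ C : ℝ, 0 ≤ C ∧ ∀ φ : ℝ → ℂ, ContDiff ℝ ∞ φ → HasCompactSupport φ →
      ∀ R q : ℝ, 1 ≤ R → 0 ≤ q → NM 1 φ ≤ q →
      NM (1 + 2 * n) φ ≤ q * (R ^ (((n : ℝ) - 1) / (n + 1)) * R) ^ (2 * n) →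
      ‖∑' m : ι → ℤ, φ (D.L (R⁻¹ • b.equivFun.symm (zv m))) * a0 (R⁻¹ • b.equivFun.symm (zv m)) -
        c0 * R ^ n * ∫ v, φ (D.L v) * a0 v ∂μ‖ ≤ C * q * R ^ ((n : ℝ) * (n - 1) / (n + 1)) := by
  classical
  have hn0 : 0 < n := hn ▸ D.one_pos
  have hnR : (1 : ℝ) ≤ n := by exact_mod_cast hn0
  have hcard : Fintype.card ι = n := by rw [← hn, Module.finrank_eq_card_basis b]
  obtain ⟨c0, hc0, hintg⟩ := exists_c0 b μ
  obtain ⟨ξ, hξ, c, hc, hc1, hξn⟩ := exists_xi D b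
  obtain ⟨C1, hC1, hcoef⟩ := coeff_bound D ha has haΩ hn hc hc1
  set s : ℝ := ((n : ℝ) + 1) / (2 * n) with hs
  have hs0 : 0 < s := by positivity
  have hs1 : s ≤ 1 := by rw [hs, div_le_one (by positivity)]; linarith
  obtain ⟨C2, hC2, hsum⟩ := multi_dim (ι := ι) hs0 hs1
  refine ⟨c0, hc0, c0 * C1 * C2, by positivity, ?_⟩
  intro φ hφ hφs R q hR hq hq1 hq2
  have hR0 : 0 < R := by linarith
  set Q : ℝ := R ^ (((n : ℝ) - 1) / (n + 1)) with hQd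
  have hQ : 1 ≤ Q := Real.one_le_rpow hR (div_nonneg (by linarith) (by linarith))
  have hsQ : s = 1 → Q = 1 := by
    intro h
    rw [hs, div_eq_one_iff_eq (by positivity)] at h
    have : (n : ℝ) = 1 := by linarith
    rw [hQd, this]; simp
  obtain ⟨hgc, hgs⟩ := g_cont D ha has haΩ hφ.continuous
  set g : A → ℂ := fun v => φ (D.L v) * a0 v with hg
  let e : (ι → ℝ) ≃L[ℝ] A := b.equivFun.symm.toContinuousLinearEquiv
  have hRi : R⁻¹ ≠ 0 := inv_ne_zero hR0.ne'
  let f : (ι → ℝ) → ℂ := fun x => g (R⁻¹ • b.equivFun.symm x)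
  have hfc : Continuous f := hgc.comp (e.continuous.const_smul R⁻¹)
  have hfs : HasCompactSupport f :=
    hgs.comp_homeomorph (e.toHomeomorph.trans (Homeomorph.smulOfNeZero R⁻¹ hRi))
  let ck : (ι → ℤ) → ℂ := fun k =>
    ∫ x, Complex.exp (((-2 * Real.pi * ∑ i, (k i : ℝ) * x i : ℝ) : ℂ) * Complex.I) * f x
  have hck : ∀ k, ck k = c0 * R ^ n * ∫ v, g v * Complex.exp (((D.τ ((R • ξ (zv k)) * v) : ℝ) : ℂ) * Complex.I) ∂μ := by
    intro k
    let F : A → ℂ := fun v => g v * Complex.exp (((D.τ ((R • ξ (zv k)) * v) : ℝ) : ℂ) * Complex.I)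
    have h1 : ck k = ∫ x : ι → ℝ, F (R⁻¹ • b.equivFun.symm x) := by
      simp only [ck, F, f]
      congr 1; ext x
      rw [mul_comm]
      congr 4
      rw [smul_mul_smul_comm, mul_inv_cancel₀ hR0.ne', one_smul, hξ]
      rfl
    rw [h1, hintg (fun v => F (R⁻¹ • v)), Measure.integral_comp_smul, hn, inv_pow, inv_inv,
      abs_of_pos (by positivity), Complex.real_smul]
    push_cast
    ring
  have hbd : ∀ k, k ≠ 0 → ‖ck k‖ ≤ c0 * R ^ n * (C1 * q * R ^ (-(((n : ℝ) + 1) / 2))) * ∏ i, Hs s Q (kap (k i)) := by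
    intro k hk
    have hx : 1 ≤ ‖zv k‖ := by
      obtain ⟨j, hj⟩ := Function.ne_iff.mp hk
      exact (one_le_kap (k j)).trans (kap_le_norm hk j)
    have h1 := hcoef φ hφ hφs R q Q ‖zv k‖ hR hq hQ hx hq1 hq2 (R • ξ (zv k)) (by
      rw [norm_smul, Real.norm_eq_abs, abs_of_pos hR0]
      gcongr
      exact hξn _)
    have h2 : (Hs s Q ‖zv k‖) ^ n ≤ ∏ i, Hs s Q (kap (k i)) := by
      rw [← hcard, ← Finset.card_univ, ← Finset.prod_const]
      apply Finset.prod_le_prod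
      · exact fun i _ => Hs_nonneg (norm_nonneg _)
      · exact fun i _ => Hs_anti hs0 (by linarith) (by linarith [one_le_kap (k i)]) (kap_le_norm hk i)
    rw [hck, norm_mul, norm_mul, norm_pow, Complex.norm_real, Complex.norm_real, Real.norm_eq_abs, Real.norm_eq_abs,
      abs_of_pos hc0, abs_of_pos hR0, mul_assoc]
    refine (mul_le_mul_of_nonneg_left (mul_le_mul_of_nonneg_left h1 (by positivity)) hc0.le).trans ?_
    rw [← mul_assoc, ← mul_assoc]
    gcongr
  set W := c0 * R ^ n * (C1 * q * R ^ (-(((n : ℝ) + 1) / 2))) with hW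
  have hW0 : 0 ≤ W := by positivity
  have hfin := hsum Q hQ hsQ
  have hprodn : ∀ k : ι → ℤ, 0 ≤ ∏ i, Hs s Q (kap (k i)) := fun k =>
    Finset.prod_nonneg fun i _ => Hs_nonneg (zero_le_one.trans (one_le_kap _))
  have hsm : Summable fun k : ι → ℤ => ∏ i, Hs s Q (kap (k i)) := summable_of_sum_le hprodn hfin
  have hts : ∑' k : ι → ℤ, ∏ i, Hs s Q (kap (k i)) ≤ C2 * Q ^ ((1 - s) * Fintype.card ι) :=
    hsm.tsum_le_of_sum_le hfin
  let dk : (ι → ℤ) → ℂ := fun k => if k = 0 then 0 else ck k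
  have hdk : ∀ k, ‖dk k‖ ≤ W * ∏ i, Hs s Q (kap (k i)) := by
    intro k
    by_cases hk : k = 0
    · simp only [dk, hk, if_true, norm_zero]
      exact mul_nonneg hW0 (hprodn _)
    · simp only [dk, hk, if_false]
      exact hbd k hk
  have hdks : Summable dk := Summable.of_norm_bounded (hsm.mul_left W) hdk
  have hcks : Summable ck := by
    have : ck = fun k => dk k + if k = 0 then ck 0 else 0 := by
      ext k
      by_cases hk : k = 0
      · simp [dk, hk]
      · simp [dk, hk]
    rw [this]
    exact hdks.add (hasSum_ite_eq 0 (ck 0)).summable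
  have hpo := poisson hfc hfs hcks
  have hsplit : ∑' k, ck k = ck 0 + ∑' k, dk k := hcks.tsum_eq_add_tsum_ite 0
  have hc00 : ck 0 = c0 * R ^ n * ∫ v, g v ∂μ := by
    rw [hck 0]
    congr 2; ext v
    have : (zv (0 : ι → ℤ)) = 0 := by ext i; simp [zv]
    rw [this]; simp
  have hfinal : ∑' m : ι → ℤ, f (zv m) - c0 * R ^ n * ∫ v, g v ∂μ = ∑' k, dk k := by
    rw [hpo, ← hc00]
    exact sub_eq_of_eq_add' hsplit
  change ‖∑' m : ι → ℤ, f (zv m) - c0 * R ^ n * ∫ v, g v ∂μ‖ ≤ _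
  rw [hfinal]
  refine (tsum_of_norm_bounded (hsm.mul_left W).hasSum hdk).trans ?_
  rw [tsum_mul_left]
  refine (mul_le_mul_of_nonneg_left hts hW0).trans (le_of_eq ?_)
  rw [hW, hQd, hcard, ← Real.rpow_mul hR0.le, ← Real.rpow_natCast R n]
  have hexp : R ^ ((n : ℝ) * (n - 1) / (n + 1)) =
      R ^ (n : ℝ) * R ^ (-(((n : ℝ) + 1) / 2)) * R ^ (((n : ℝ) - 1) / (n + 1) * ((1 - s) * n)) := by
    rw [← Real.rpow_add hR0, ← Real.rpow_add hR0]
    congr 1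
    rw [hs]; field_simp; ring
  rw [hexp]; ring

end LATTICE
end LandauTail

namespace LandauTail
set_option linter.unusedSectionVars false
open MeasureTheory
open scoped ContDiff

section MIXED
variable {ι κ : Type} [Fintype ι] [Fintype κ]

lemma mx_exp_fst (k : (ι → ℝ) × (κ → ℂ)) (i : ι) : (NormedSpace.exp k).1 i = Real.exp (k.1 i) := by
  letI : NormedAlgebra ℚ (ι → ℝ) := NormedAlgebra.restrictScalars ℚ ℝ _
  letI : NormedAlgebra ℚ (κ → ℂ) := NormedAlgebra.restrictScalars ℚ ℝ _
  rw [Prod.fst_exp, Pi.coe_exp, Real.exp_eq_exp_ℝ]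

lemma mx_exp_snd (k : (ι → ℝ) × (κ → ℂ)) (i : κ) : (NormedSpace.exp k).2 i = Complex.exp (k.2 i) := by
  letI : NormedAlgebra ℚ (ι → ℝ) := NormedAlgebra.restrictScalars ℚ ℝ _
  letI : NormedAlgebra ℚ (κ → ℂ) := NormedAlgebra.restrictScalars ℚ ℝ _
  rw [Prod.snd_exp, Pi.coe_exp, Complex.exp_eq_exp_ℂ]

/-- trace form -/
def mxτ : ((ι → ℝ) × (κ → ℂ)) →L[ℝ] ℝ :=
  (∑ i, (ContinuousLinearMap.proj (R := ℝ) i).comp (ContinuousLinearMap.fst ℝ (ι → ℝ) (κ → ℂ))) +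
  (2 : ℝ) • (∑ i, Complex.reCLM.comp ((ContinuousLinearMap.proj (R := ℝ) (φ := fun _ : κ => ℂ) i).comp
    (ContinuousLinearMap.snd ℝ (ι → ℝ) (κ → ℂ))))

lemma mxτ_apply (k : (ι → ℝ) × (κ → ℂ)) : mxτ k = ∑ i, k.1 i + 2 * ∑ i, (k.2 i).re := by
  simp [mxτ]

/-- conjugation -/
def mxσ : ((ι → ℝ) × (κ → ℂ)) →L[ℝ] ((ι → ℝ) × (κ → ℂ)) :=
  (ContinuousLinearMap.fst ℝ (ι → ℝ) (κ → ℂ)).prod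
   (ContinuousLinearMap.pi fun i => (Complex.conjCLE : ℂ →L[ℝ] ℂ).comp
    ((ContinuousLinearMap.proj (R := ℝ) (φ := fun _ : κ => ℂ) i).comp
    (ContinuousLinearMap.snd ℝ (ι → ℝ) (κ → ℂ))))

lemma mxσ_apply (k : (ι → ℝ) × (κ → ℂ)) : mxσ k = (k.1, fun i => (starRingEnd ℂ) (k.2 i)) := by
  ext i <;> simp [mxσ]

lemma mxτσ (k : (ι → ℝ) × (κ → ℂ)) : mxτ (mxσ k) = mxτ k := by
  simp [mxτ_apply, mxσ_apply]

lemma mx_pos (a : (ι → ℝ) × (κ → ℂ)) (ha : a ≠ 0) : 0 < mxτ (a * mxσ a) := by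
  have h : mxτ (a * mxσ a) = ∑ i, (a.1 i)^2 + 2 * ∑ i, ‖a.2 i‖^2 := by
    rw [mxτ_apply, mxσ_apply]
    congr 1
    · exact Finset.sum_congr rfl fun i _ => by simp [sq]
    · congr 1
      refine Finset.sum_congr rfl fun i _ => ?_
      simp only [Prod.snd_mul, Pi.mul_apply, Complex.mul_conj]
      rw [Complex.ofReal_re, Complex.normSq_eq_norm_sq]
  rw [h]
  by_contra hc
  have h1 : 0 ≤ ∑ i, (a.1 i)^2 := Finset.sum_nonneg fun i _ => sq_nonneg _
  have h2 : 0 ≤ ∑ i, ‖a.2 i‖^2 := Finset.sum_nonneg fun i _ => sq_nonneg _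
  have e1 : ∑ i, (a.1 i)^2 = 0 := by linarith
  have e2 : ∑ i, ‖a.2 i‖^2 = 0 := by linarith
  rw [Finset.sum_eq_zero_iff_of_nonneg (fun i _ => sq_nonneg _)] at e1 e2
  apply ha
  ext i
  · simpa using e1 i (Finset.mem_univ _)
  · have := e2 i (Finset.mem_univ _)
    simpa using this

/-- multiplication as a linear map -/
def mxM (u : (ι → ℝ) × (κ → ℂ)) : ((ι → ℝ) × (κ → ℂ)) →ₗ[ℝ] ((ι → ℝ) × (κ → ℂ)) :=
  LinearMap.prodMap (LinearMap.pi fun i => (LinearMap.mulLeft ℝ (u.1 i)).comp (LinearMap.proj i))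
    (LinearMap.pi fun i => (LinearMap.mulLeft ℝ (u.2 i)).comp (LinearMap.proj i))

lemma mxM_apply (u v : (ι → ℝ) × (κ → ℂ)) : mxM u v = v * u := by
  ext i <;> simp [mxM, mul_comm]

lemma mxM_det (u : (ι → ℝ) × (κ → ℂ)) :
    LinearMap.det (mxM u) = (∏ i, u.1 i) * ∏ i, Complex.normSq (u.2 i) := by
  rw [mxM, LinearMap.det_prodMap, LinearMap.det_pi, LinearMap.det_pi]
  congr 1
  · refine Finset.prod_congr rfl fun i _ => ?_
    have := LinearMap.det_ring (LinearMap.mulLeft ℝ (u.1 i))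
    simpa using this
  · refine Finset.prod_congr rfl fun i _ => ?_
    rw [← Algebra.norm_complex_apply]
    rfl

lemma mxM_exp_det (k : (ι → ℝ) × (κ → ℂ)) :
    LinearMap.det (mxM (NormedSpace.exp k)) = Real.exp (mxτ k) := by
  rw [mxM_det, mxτ_apply, Real.exp_add, Finset.mul_sum, Real.exp_sum, Real.exp_sum]
  congr 1
  · exact Finset.prod_congr rfl fun i _ => mx_exp_fst k i
  · refine Finset.prod_congr rfl fun i _ => ?_
    rw [mx_exp_snd, Complex.normSq_eq_norm_sq, Complex.norm_exp, ← Real.exp_nat_mul]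
    norm_num

lemma mx_mul_exp (μ : Measure ((ι → ℝ) × (κ → ℂ))) [μ.IsAddHaarMeasure]
    (k : (ι → ℝ) × (κ → ℂ)) (hk : mxτ k = 0)
    (g : (ι → ℝ) × (κ → ℂ) → ℂ) : ∫ v, g (v * NormedSpace.exp k) ∂μ = ∫ v, g v ∂μ := by
  have hd : LinearMap.det (mxM (NormedSpace.exp k)) = 1 := by rw [mxM_exp_det, hk, Real.exp_zero]
  have hm := Measure.map_linearMap_addHaar_eq_smul_addHaar μ
    (f := mxM (NormedSpace.exp k)) (by rw [hd]; exact one_ne_zero)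
  rw [hd] at hm
  simp only [inv_one, abs_one, ENNReal.ofReal_one, one_smul] at hm
  let e : ((ι → ℝ) × (κ → ℂ)) ≃L[ℝ] ((ι → ℝ) × (κ → ℂ)) :=
    (LinearEquiv.ofIsUnitDet (f := mxM (NormedSpace.exp k)) (v := Module.finBasis ℝ _)
      (v' := Module.finBasis ℝ _) (by
      rw [LinearMap.det_toMatrix, hd]; exact isUnit_one)).toContinuousLinearEquiv
  have he : ∀ v, e v = v * NormedSpace.exp k := fun v => by
    rw [← mxM_apply]; rfl
  have h2 := MeasurableEmbedding.integral_map (μ := μ) e.toHomeomorph.measurableEmbedding g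
  have h3 : Measure.map (e.toHomeomorph) μ = μ := by
    conv_rhs => rw [← hm]
    congr 1
  rw [h3] at h2
  rw [h2]
  exact integral_congr_ae (Eventually.of_forall fun v => by simp [← he])
end MIXED

section NF
open NumberField NumberField.InfinitePlace NumberField.mixedEmbedding
open scoped Classical

lemma mixed_norm_split (x : mixedSpace K) : mixedEmbedding.norm x
    = (∏ w, ‖x.1 w‖) * ∏ w, ‖x.2 w‖^2 := by
  rw [mixedEmbedding.norm_apply, prod_eq_prod_mul_prod]
  congr 1
  · exact Finset.prod_congr rfl fun w _ => by rw [normAtPlace_apply_of_isReal w.2, mult_isReal, pow_one]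
  · exact Finset.prod_congr rfl fun w _ => by rw [normAtPlace_apply_of_isComplex w.2, mult_isComplex]

lemma normAtPlace_exp_real (k : mixedSpace K) (w : {w : InfinitePlace K // IsReal w}) :
    normAtPlace w.1 (NormedSpace.exp k) = Real.exp (k.1 w) := by
  rw [normAtPlace_apply_of_isReal w.2, mx_exp_fst, Real.norm_eq_abs, Real.abs_exp]

lemma normAtPlace_exp_complex (k : mixedSpace K) (w : {w : InfinitePlace K // IsComplex w}) :
    normAtPlace w.1 (NormedSpace.exp k) = Real.exp (k.2 w).re := by
  rw [normAtPlace_apply_of_isComplex w.2, mx_exp_snd, Complex.norm_exp]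

lemma mixed_norm_exp (k : mixedSpace K) : mixedEmbedding.norm (NormedSpace.exp k) = Real.exp (mxτ k) := by
  rw [mixed_norm_split, mxτ_apply, Real.exp_add, Finset.mul_sum, Real.exp_sum, Real.exp_sum]
  congr 1
  · exact Finset.prod_congr rfl fun i _ => by rw [mx_exp_fst, Real.norm_eq_abs, Real.abs_exp]
  · refine Finset.prod_congr rfl fun i _ => ?_
    rw [mx_exp_snd, Complex.norm_exp, ← Real.exp_nat_mul]
    norm_num

lemma log_normAtPlace_smooth (w : InfinitePlace K) (v : mixedSpace K) (hv : normAtPlace w v ≠ 0) :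
    ContDiffAt ℝ ∞ (fun x : mixedSpace K => Real.log (normAtPlace w x)) v := by
  rcases w.isReal_or_isComplex with hw | hw
  · have : (fun x : mixedSpace K => Real.log (normAtPlace w x)) = fun x => Real.log (x.1 ⟨w, hw⟩) := by
      funext x; rw [normAtPlace_apply_of_isReal hw, Real.norm_eq_abs, Real.log_abs]
    rw [this]
    rw [normAtPlace_apply_of_isReal hw, norm_ne_zero_iff] at hv
    refine ContDiffAt.log ?_ hv
    fun_prop
  · have : (fun x : mixedSpace K => Real.log (normAtPlace w x))
        = fun x => 2⁻¹ * Real.log (Complex.normSq (x.2 ⟨w, hw⟩)) := by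
      funext x; rw [normAtPlace_apply_of_isComplex hw, Complex.normSq_eq_norm_sq, Real.log_pow]
      push_cast; ring
    rw [this]
    rw [normAtPlace_apply_of_isComplex hw, norm_ne_zero_iff] at hv
    refine contDiffAt_const.mul (ContDiffAt.log ?_ (by simpa using hv))
    have h2 : (fun x : mixedSpace K => Complex.normSq (x.2 ⟨w, hw⟩))
      = fun x => ‖x.2 ⟨w, hw⟩‖^2 := by funext x; rw [Complex.normSq_eq_norm_sq]
    rw [h2]
    refine ContDiffAt.norm_sq ℝ ?_
    fun_prop

lemma mixed_log_norm (v : mixedSpace K) (hv : mixedEmbedding.norm v ≠ 0) :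
    Real.log (mixedEmbedding.norm v) = ∑ w, (mult w : ℝ) * Real.log (normAtPlace w v) := by
  rw [mixedEmbedding.norm_apply, Real.log_prod]
  · simp
  · intro w _
    exact pow_ne_zero _ (mixedEmbedding.norm_ne_zero_iff.mp hv w)

/-- the datum for a number field -/
def nfDatum : Datum (mixedSpace K) (volume : Measure (mixedSpace K)) where
  τ := mxτ
  σ := mxσ
  τσ := mxτσ
  pos := mx_pos
  τ_one := by
    rw [mixedEmbedding.finrank, mxτ_apply, ← card_add_two_mul_card_eq_rank]
    simp [nrRealPlaces, nrComplexPlaces]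
  one_pos := by rw [mixedEmbedding.finrank]; exact Module.finrank_pos
  Ω := {v | mixedEmbedding.norm v ≠ 0}
  Ω_open := isOpen_ne_fun (mixedEmbedding.continuous_norm K) continuous_const
  Ω_unit := by
    intro v hv
    have hv := mixedEmbedding.norm_ne_zero_iff.mp hv
    rw [Prod.isUnit_iff, Pi.isUnit_iff, Pi.isUnit_iff]
    refine ⟨fun w => ?_, fun w => ?_⟩
    · have := hv w.1
      rw [normAtPlace_apply_of_isReal w.2, norm_ne_zero_iff] at this
      exact isUnit_iff_ne_zero.mpr this
    · have := hv w.1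
      rw [normAtPlace_apply_of_isComplex w.2, norm_ne_zero_iff] at this
      exact isUnit_iff_ne_zero.mpr this
  Ω_exp := by
    intro v hv k
    show mixedEmbedding.norm _ ≠ 0
    rw [map_mul, mixed_norm_exp]
    exact mul_ne_zero hv (Real.exp_ne_zero _)
  L := fun v => Real.log (mixedEmbedding.norm v)
  L_smooth := by
    intro v hv
    have : (fun v : mixedSpace K => Real.log (mixedEmbedding.norm v)) =ᶠ[𝓝 v]
        fun v => ∑ w, (mult w : ℝ) * Real.log (normAtPlace w v) := by
      filter_upwards [(isOpen_ne_fun (mixedEmbedding.continuous_norm K) continuous_const).mem_nhds hv] with u hu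
      exact mixed_log_norm K u hu
    refine ContDiffAt.congr_of_eventuallyEq ?_ this
    refine ContDiffAt.sum fun w _ => contDiffAt_const.mul
      (log_normAtPlace_smooth K w v (mixedEmbedding.norm_ne_zero_iff.mp hv w))
  L_exp := by
    intro v hv k
    rw [map_mul, mixed_norm_exp, Real.log_mul hv (Real.exp_ne_zero _), Real.log_exp]
  L_meas := Real.measurable_log.comp (mixedEmbedding.continuous_norm K).measurable
  mul_exp := fun k hk g => mx_mul_exp volume k hk g

end NF
end LandauTail

namespace LandauTail
set_option linter.unusedSectionVars false
open MeasureTheory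
open scoped ContDiff

/-- bump with integer translates summing to one -/
def bb (t : ℝ) : ℝ := Real.smoothTransition t - Real.smoothTransition (t - 1)

lemma bb_nonneg (t : ℝ) : 0 ≤ bb t := sub_nonneg.mpr (Real.smoothTransition.monotone (by linarith))

lemma bb_smooth : ContDiff ℝ ∞ bb :=
  (Real.smoothTransition.contDiff (n := ⊤)).sub ((Real.smoothTransition.contDiff (n := ⊤)).comp (by fun_prop))

lemma bb_zero {t : ℝ} (h : t ≤ 0 ∨ 2 ≤ t) : bb t = 0 := by
  rcases h with h | h
  · rw [bb, Real.smoothTransition.zero_of_nonpos h, Real.smoothTransition.zero_of_nonpos (by linarith)]; simp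
  · rw [bb, Real.smoothTransition.one_of_one_le (by linarith), Real.smoothTransition.one_of_one_le (by linarith)]; simp

lemma bb_tsum (t : ℝ) : ∑' k : ℤ, ENNReal.ofReal (bb (t + k)) = 1 := by
  have hf0 := Int.fract_nonneg t
  have hf1 := Int.fract_lt_one t
  have hft : t = ⌊t⌋ + Int.fract t := (Int.floor_add_fract t).symm
  rw [tsum_eq_sum (s := {-⌊t⌋, 1 - ⌊t⌋})]
  · rw [Finset.sum_pair (by omega), ← ENNReal.ofReal_add (bb_nonneg _) (bb_nonneg _)]
    have e1 : t + ((-⌊t⌋ : ℤ) : ℝ) = Int.fract t := by push_cast; linarith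
    have e2 : t + ((1 - ⌊t⌋ : ℤ) : ℝ) = Int.fract t + 1 := by push_cast; linarith
    rw [e1, e2, bb, bb, Real.smoothTransition.zero_of_nonpos (x := Int.fract t - 1) (by linarith),
      Real.smoothTransition.one_of_one_le (x := Int.fract t + 1) (by linarith)]
    simp
  · intro k hk
    simp only [Finset.mem_insert, Finset.mem_singleton, not_or] at hk
    rw [bb_zero, ENNReal.ofReal_zero]
    rcases lt_trichotomy k (-⌊t⌋) with h | h | h
    · left
      have : (k : ℝ) ≤ -⌊t⌋ - 1 := by exact_mod_cast (by omega : k ≤ -⌊t⌋ - 1)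
      linarith
    · exact absurd h hk.1
    · right
      have : (k : ℝ) ≥ -⌊t⌋ + 2 := by exact_mod_cast (by omega : k ≥ -⌊t⌋ + 2)
      linarith

lemma tsum_pi_prod (r : ℕ) (f : Fin r → ℤ → ENNReal) :
    ∑' e : Fin r → ℤ, ∏ i, f i (e i) = ∏ i, ∑' k, f i k := by
  induction r with
  | zero => simp
  | succ r ih =>
    rw [← (Fin.consEquiv (fun _ : Fin (r + 1) => ℤ)).tsum_eq, ENNReal.tsum_prod', Fin.prod_univ_succ,
      ← ih (fun i => f i.succ)]
    simp only [Fin.consEquiv_apply, Fin.prod_univ_succ, Fin.cons_zero, Fin.cons_succ, ENNReal.tsum_mul_left,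
      ENNReal.tsum_mul_right]

/-- cutoff equal to one on `[-4,4]`, supported in `[-5,5]` -/
def chi (u : ℝ) : ℝ := Real.smoothTransition (u + 5) * Real.smoothTransition (5 - u)

lemma chi_nonneg (u : ℝ) : 0 ≤ chi u :=
  mul_nonneg (Real.smoothTransition.nonneg _) (Real.smoothTransition.nonneg _)

lemma chi_one {u : ℝ} (h : |u| ≤ 4) : chi u = 1 := by
  have := abs_le.mp h
  rw [chi, Real.smoothTransition.one_of_one_le (by linarith), Real.smoothTransition.one_of_one_le (by linarith), mul_one]

lemma chi_supp {u : ℝ} (h : chi u ≠ 0) : |u| ≤ 5 := by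
  rw [abs_le]
  constructor
  · by_contra hc
    exact h (by rw [chi, Real.smoothTransition.zero_of_nonpos (by linarith), zero_mul])
  · by_contra hc
    exact h (by rw [chi, Real.smoothTransition.zero_of_nonpos (x := 5 - u) (by linarith), mul_zero])

lemma chi_smooth : ContDiff ℝ ∞ chi :=
  ((Real.smoothTransition.contDiff (n := ⊤)).comp (by fun_prop)).mul
    ((Real.smoothTransition.contDiff (n := ⊤)).comp (by fun_prop))

section NF
open NumberField NumberField.InfinitePlace NumberField.mixedEmbedding
open NumberField.Units NumberField.Units.dirichletUnitTheorem
open scoped Classical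

/-- the basis of log space -/
def BU : Module.Basis (Fin (rank K)) ℝ (logSpace K) := (basisUnitLattice K).ofZLatticeBasis ℝ (unitLattice K)

/-- the unit weight -/
def wt (v : mixedSpace K) : ℝ :=
  if mixedEmbedding.norm v = 0 then 0 else ∏ i, bb ((BU K).repr (logMap v) i)

lemma wt_nonneg (v : mixedSpace K) : 0 ≤ wt K v := by
  unfold wt; split_ifs
  · rfl
  · exact Finset.prod_nonneg fun i _ => bb_nonneg _

lemma wt_smul (c : ℝ) (hc : c ≠ 0) (v : mixedSpace K) : wt K (c • v) = wt K v := by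
  unfold wt
  by_cases h : mixedEmbedding.norm v = 0
  · rw [if_pos h, if_pos (by rw [mixedEmbedding.norm_smul, h, mul_zero])]
  · rw [if_neg h, if_neg, logMap_real_smul h hc]
    rw [mixedEmbedding.norm_smul]
    exact mul_ne_zero (pow_ne_zero _ (abs_ne_zero.mpr hc)) h

lemma logMap_smooth (v : mixedSpace K) (hv : mixedEmbedding.norm v ≠ 0) :
    ContDiffAt ℝ ∞ (logMap : mixedSpace K → logSpace K) v := by
  rw [contDiffAt_pi]
  intro w
  simp only [logMap_apply]
  refine contDiffAt_const.mul (ContDiffAt.sub ?_ (ContDiffAt.mul ?_ contDiffAt_const))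
  · exact log_normAtPlace_smooth K w.1 v (mixedEmbedding.norm_ne_zero_iff.mp hv _)
  · exact (nfDatum K).L_smooth v hv

lemma wt_smooth (v : mixedSpace K) (hv : mixedEmbedding.norm v ≠ 0) : ContDiffAt ℝ ∞ (wt K) v := by
  have : wt K =ᶠ[𝓝 v] fun v => ∏ i, bb ((BU K).repr (logMap v) i) := by
    filter_upwards [(isOpen_ne_fun (mixedEmbedding.continuous_norm K) continuous_const).mem_nhds hv] with u hu
    rw [wt, if_neg hu]
  refine ContDiffAt.congr_of_eventuallyEq ?_ this
  refine contDiffAt_prod fun i _ => bb_smooth.contDiffAt.comp v ?_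
  let l : logSpace K →L[ℝ] ℝ := LinearMap.toContinuousLinearMap ((BU K).coord i)
  exact l.contDiff.contDiffAt.comp v (logMap_smooth K v hv)

lemma wt_meas : Measurable (wt K) := by
  unfold wt
  refine Measurable.ite (measurableSet_eq_fun (mixedEmbedding.continuous_norm K).measurable measurable_const)
    measurable_const ?_
  refine Finset.measurable_prod _ fun i _ => bb_smooth.continuous.measurable.comp ?_
  let l : logSpace K →L[ℝ] ℝ := LinearMap.toContinuousLinearMap ((BU K).coord i)
  refine l.continuous.measurable.comp ?_
  unfold logMap
  refine measurable_pi_iff.mpr fun w ↦ measurable_const.mul ?_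
  exact (continuous_normAtPlace _).measurable.log.sub <|
      (mixedEmbedding.continuous_norm _).measurable.log.mul measurable_const

lemma exists_logMap_bound : ∃ M, ∀ v : mixedSpace K, wt K v ≠ 0 → ∀ w, |logMap v w| ≤ M := by
  have hc : IsCompact (Set.univ.pi fun _ : Fin (rank K) => Set.Icc (0:ℝ) 2) :=
    isCompact_univ_pi fun _ => isCompact_Icc
  let e := (BU K).equivFun.toContinuousLinearEquiv
  have hc2 := hc.image e.symm.continuous
  obtain ⟨M, hM⟩ := hc2.isBounded.exists_norm_le
  refine ⟨M, fun v hv w => ?_⟩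
  have hn : ¬ mixedEmbedding.norm v = 0 := fun h => hv (by rw [wt, if_pos h])
  rw [wt, if_neg hn, Finset.prod_ne_zero_iff] at hv
  have h1 := hM (logMap v) ⟨e (logMap v), fun i _ => ?_, e.symm_apply_apply _⟩
  · exact (norm_le_pi_norm (logMap v) w).trans h1
  · have := hv i (Finset.mem_univ _)
    show _ ≤ (BU K).repr (logMap v) i ∧ (BU K).repr (logMap v) i ≤ _
    constructor
    · by_contra hcc; exact this (bb_zero (Or.inl (by linarith)))
    · by_contra hcc; exact this (bb_zero (Or.inr (by linarith)))

lemma exists_log_bound : ∃ M, ∀ v : mixedSpace K, wt K v ≠ 0 → |Real.log (mixedEmbedding.norm v)| ≤ 5 →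
    ∀ w, |Real.log (normAtPlace w v)| ≤ M := by
  obtain ⟨M, hM⟩ := exists_logMap_bound K
  have hn1 : (1:ℝ) ≤ Module.finrank ℚ K := by exact_mod_cast (Module.finrank_pos : 0 < Module.finrank ℚ K)
  have hm : ∀ w : InfinitePlace K, (1:ℝ) ≤ mult w := fun w => one_le_mult
  -- places other than `w₀`
  have h1 : ∀ v : mixedSpace K, wt K v ≠ 0 → |Real.log (mixedEmbedding.norm v)| ≤ 5 →
    ∀ w, w ≠ w₀ → (mult w : ℝ) * |Real.log (normAtPlace w v)| ≤ M + 5 * mult w := by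
    intro v hv hL w hw
    have h2 := hM v hv ⟨w, hw⟩
    rw [logMap_apply] at h2
    have hm0 : (0:ℝ) ≤ mult w := by linarith [hm w]
    have h3 : |Real.log (mixedEmbedding.norm v) * (Module.finrank ℚ K : ℝ)⁻¹| ≤ 5 := by
      rw [abs_mul, abs_of_nonneg (by positivity : (0:ℝ) ≤ (Module.finrank ℚ K : ℝ)⁻¹)]
      calc _ ≤ 5 * (1:ℝ) := by
            gcongr
            exact inv_le_one_of_one_le₀ hn1
        _ = 5 := by ring
    rw [abs_mul, abs_of_nonneg hm0] at h2
    have h4 : |Real.log (normAtPlace w v)| ≤ |Real.log (normAtPlace w v) -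
       Real.log (mixedEmbedding.norm v) * (Module.finrank ℚ K : ℝ)⁻¹| + 5 := by
      have := abs_add_le (Real.log (normAtPlace w v) -
       Real.log (mixedEmbedding.norm v) * (Module.finrank ℚ K : ℝ)⁻¹)
       (Real.log (mixedEmbedding.norm v) * (Module.finrank ℚ K : ℝ)⁻¹)
      rw [sub_add_cancel] at this
      linarith
    calc _ ≤ (mult w : ℝ) * (|Real.log (normAtPlace w v) -
       Real.log (mixedEmbedding.norm v) * (Module.finrank ℚ K : ℝ)⁻¹| + 5) := by gcongr
      _ ≤ _ := by linarith
  refine ⟨5 + ∑ w : InfinitePlace K, (|M| + 5 * mult w), fun v hv hL w => ?_⟩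
  have hn : mixedEmbedding.norm v ≠ 0 := fun h => hv (by rw [wt, if_pos h])
  have hle : ∀ w : InfinitePlace K, (0:ℝ) ≤ |M| + 5 * mult w := fun w => by positivity
  have hsum : ∀ w : InfinitePlace K, |M| + 5 * (mult w:ℝ) ≤ ∑ w : InfinitePlace K, (|M| + 5 * (mult w : ℝ)) :=
    fun w => Finset.single_le_sum (f := fun w : InfinitePlace K => (|M| + 5 * (mult w : ℝ))) (fun w _ => hle w) (Finset.mem_univ w)
  by_cases hw : w = w₀
  · subst hw
    have h5 := mixed_log_norm K v hn
    rw [← Finset.add_sum_erase _ _ (Finset.mem_univ (w₀ : InfinitePlace K))] at h5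
    have h6 : |∑ w ∈ Finset.univ.erase (w₀ : InfinitePlace K), (mult w : ℝ) * Real.log (normAtPlace w v)|
        ≤ ∑ w : InfinitePlace K, (|M| + 5 * (mult w : ℝ)) := by
      refine (Finset.abs_sum_le_sum_abs _ _).trans ?_
      refine (Finset.sum_le_sum (g := fun w : InfinitePlace K => |M| + 5 * (mult w : ℝ)) fun w hw => ?_).trans
        (Finset.sum_le_sum_of_subset_of_nonneg (Finset.erase_subset _ _) fun w _ _ => hle w)
      rw [abs_mul, Nat.abs_cast]
      linarith [h1 v hv hL w (Finset.ne_of_mem_erase hw), le_abs_self M]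
    have h7 : |(mult (w₀ : InfinitePlace K) : ℝ) * Real.log (normAtPlace w₀ v)| ≤
        5 + ∑ w : InfinitePlace K, (|M| + 5 * (mult w : ℝ)) := by
      rw [show (mult (w₀ : InfinitePlace K) : ℝ) * Real.log (normAtPlace w₀ v) =
        Real.log (mixedEmbedding.norm v) - ∑ w ∈ Finset.univ.erase (w₀ : InfinitePlace K), (mult w : ℝ) * Real.log (normAtPlace w v)
        by linarith]
      exact (abs_sub _ _).trans (add_le_add hL h6)
    rw [abs_mul, Nat.abs_cast] at h7
    nlinarith [hm w₀, abs_nonneg (Real.log (normAtPlace w₀ v))]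
  · have := h1 v hv hL w hw
    nlinarith [hm w, abs_nonneg (Real.log (normAtPlace w v)), hsum w, le_abs_self M]

/-- the amplitude -/
def amp (v : mixedSpace K) : ℝ := chi (Real.log (mixedEmbedding.norm v)) * wt K v

lemma amp_props : ∃ T : Set (mixedSpace K), IsCompact T ∧ T ⊆ (nfDatum K).Ω ∧ Function.support (amp K) ⊆ T := by
  obtain ⟨M, hM⟩ := exists_log_bound K
  refine ⟨{v | ∀ w, Real.exp (-M) ≤ normAtPlace w v ∧ normAtPlace w v ≤ Real.exp M}, ?_, ?_, ?_⟩
  · refine Metric.isCompact_of_isClosed_isBounded ?_ ?_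
    · rw [Set.setOf_forall]
      exact isClosed_iInter fun w => (isClosed_le continuous_const (continuous_normAtPlace w)).inter
        (isClosed_le (continuous_normAtPlace w) continuous_const)
    · rw [isBounded_iff_forall_norm_le]
      refine ⟨Real.exp M, fun v hv => ?_⟩
      rw [norm_eq_sup'_normAtPlace]
      exact Finset.sup'_le _ _ fun w _ => (hv w).2
  · intro v hv
    exact mixedEmbedding.norm_ne_zero_iff.mpr fun w => ((Real.exp_pos _).trans_le (hv w).1).ne'
  · intro v hv w
    have h1 : chi (Real.log (mixedEmbedding.norm v)) ≠ 0 := left_ne_zero_of_mul hv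
    have h2 : wt K v ≠ 0 := right_ne_zero_of_mul hv
    have hn : mixedEmbedding.norm v ≠ 0 := fun h => h2 (by rw [wt, if_pos h])
    have h3 := abs_le.mp (hM v h2 (chi_supp h1) w)
    have hp : 0 < normAtPlace w v :=
      lt_of_le_of_ne (normAtPlace_nonneg _ _) (mixedEmbedding.norm_ne_zero_iff.mp hn w).symm
    rw [← Real.le_log_iff_exp_le hp, ← Real.log_le_iff_le_exp hp]
    exact h3

lemma amp_tsupp : tsupport (amp K) ⊆ (nfDatum K).Ω := by
  obtain ⟨T, hT, hTΩ, hs⟩ := amp_props K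
  exact (closure_minimal hs hT.isClosed).trans hTΩ

lemma amp_cpt : HasCompactSupport (amp K) := by
  obtain ⟨T, hT, hTΩ, hs⟩ := amp_props K
  exact HasCompactSupport.of_support_subset_isCompact hT hs

lemma amp_smooth : ContDiff ℝ ∞ (amp K) := by
  rw [contDiff_iff_contDiffAt]
  intro v
  by_cases hv : v ∈ tsupport (amp K)
  · have hv := amp_tsupp K hv
    exact (chi_smooth.contDiffAt.comp v ((nfDatum K).L_smooth v hv)).mul (wt_smooth K v hv)
  · rw [notMem_tsupport_iff_eventuallyEq] at hv
    exact contDiffAt_const.congr_of_eventuallyEq hv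

end NF
end LandauTail

namespace LandauTail
set_option linter.unusedSectionVars false
open MeasureTheory
open scoped ContDiff

section NF
open NumberField NumberField.InfinitePlace NumberField.mixedEmbedding
open NumberField.Units NumberField.Units.dirichletUnitTheorem
open scoped Classical nonZeroDivisors

/-- Dirichlet's unit theorem as an equivalence -/
def unitsEquiv : torsion K × (Fin (rank K) → ℤ) ≃ (𝓞 K)ˣ :=
  Equiv.ofBijective (fun ζe => ζe.1 * ∏ i, (fundSystem K i) ^ (ζe.2 i)) (by
    rw [Function.bijective_iff_existsUnique]
    intro x
    obtain ⟨y, hy, hy2⟩ := exist_unique_eq_mul_prod K x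
    exact ⟨y, hy.symm, fun z hz => hy2 z hz.symm⟩)

lemma BU_log (ζe : torsion K × (Fin (rank K) → ℤ)) (i : Fin (rank K)) :
    (BU K).repr (logEmbedding K (Additive.ofMul (unitsEquiv K ζe))) i = ζe.2 i := by
  have h0 : logEmbedding K (Additive.ofMul (ζe.1 : (𝓞 K)ˣ)) = 0 :=
    logEmbedding_eq_zero_iff.mpr ζe.1.2
  have h1 : logEmbedding K (Additive.ofMul (unitsEquiv K ζe)) = ∑ j, (ζe.2 j : ℝ) • BU K j := by
    simp only [unitsEquiv, Equiv.ofBijective_apply]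
    rw [ofMul_mul, map_add, h0, zero_add, ofMul_prod, map_sum]
    refine Finset.sum_congr rfl fun j _ => ?_
    rw [ofMul_zpow, map_zsmul, logEmbedding_fundSystem, BU, Module.Basis.ofZLatticeBasis_apply,
      Int.cast_smul_eq_zsmul]
  rw [h1]
  simp [Finsupp.single_apply]

lemma unit_sum (v : mixedSpace K) (hv : mixedEmbedding.norm v ≠ 0) :
    ∑' u : (𝓞 K)ˣ, ENNReal.ofReal (wt K (u • v)) = torsionOrder K := by
  rw [← (unitsEquiv K).tsum_eq, ENNReal.tsum_prod']
  have : ∀ ζ : torsion K, ∑' e : Fin (rank K) → ℤ, ENNReal.ofReal (wt K (unitsEquiv K (ζ, e) • v)) = 1 := by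
    intro ζ
    have h1 : ∀ e : Fin (rank K) → ℤ, ENNReal.ofReal (wt K (unitsEquiv K (ζ, e) • v)) =
        ∏ i, ENNReal.ofReal (bb ((BU K).repr (logMap v) i + e i)) := by
      intro e
      rw [wt, if_neg (by rw [norm_unit_smul]; exact hv),
        ENNReal.ofReal_prod_of_nonneg (fun i _ => bb_nonneg _)]
      refine Finset.prod_congr rfl fun i _ => ?_
      rw [logMap_unit_smul _ hv, map_add, Finsupp.add_apply, BU_log, add_comm]
    simp_rw [h1]
    rw [tsum_pi_prod _ (fun i k => ENNReal.ofReal (bb ((BU K).repr (logMap v) i + (k:ℝ))))]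
    simp [bb_tsum]
  simp_rw [this]
  haveI := Fintype.ofFinite (torsion K)
  rw [tsum_fintype]
  simp [torsionOrder, Nat.card_eq_fintype_card]

lemma exists_gen {C : ClassGroup (𝓞 K)} {J : (Ideal (𝓞 K))⁰} (hJ : ClassGroup.mk0 J = C⁻¹)
    (I : {I : (Ideal (𝓞 K))⁰ // ClassGroup.mk0 I = C}) :
    ∃ a : 𝓞 K, Ideal.span {a} = (I.1 : Ideal (𝓞 K)) * J := by
  have : ClassGroup.mk0 (I.1 * J) = 1 := by rw [map_mul, I.2, hJ, mul_inv_cancel]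
  rw [ClassGroup.mk0_eq_one_iff] at this
  obtain ⟨a, ha⟩ := this
  exact ⟨a, by rw [Ideal.span, ← ha]; rfl⟩

/-- a generator of `I * J` -/
def gen {C : ClassGroup (𝓞 K)} {J : (Ideal (𝓞 K))⁰} (hJ : ClassGroup.mk0 J = C⁻¹)
    (I : {I : (Ideal (𝓞 K))⁰ // ClassGroup.mk0 I = C}) : 𝓞 K := (exists_gen K hJ I).choose

lemma gen_spec {C : ClassGroup (𝓞 K)} {J : (Ideal (𝓞 K))⁰} (hJ : ClassGroup.mk0 J = C⁻¹)
    (I : {I : (Ideal (𝓞 K))⁰ // ClassGroup.mk0 I = C}) :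
    Ideal.span {gen K hJ I} = (I.1 : Ideal (𝓞 K)) * J := (exists_gen K hJ I).choose_spec

lemma gen_ne {C : ClassGroup (𝓞 K)} {J : (Ideal (𝓞 K))⁰} (hJ : ClassGroup.mk0 J = C⁻¹)
    (I : {I : (Ideal (𝓞 K))⁰ // ClassGroup.mk0 I = C}) : gen K hJ I ≠ 0 := by
  intro h
  have := gen_spec K hJ I
  rw [h, Ideal.span_singleton_eq_bot.mpr rfl] at this
  exact nonZeroDivisors.ne_zero (I.1 * J).2 this.symm

lemma emb_norm (a : 𝓞 K) : mixedEmbedding.norm (mixedEmbedding K (a : K)) = Ideal.absNorm (Ideal.span {a}) := by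
  rw [norm_eq_norm, Ideal.absNorm_span_singleton, ← Algebra.coe_norm_int, Nat.cast_natAbs]
  push_cast
  rfl

lemma gen_norm {C : ClassGroup (𝓞 K)} {J : (Ideal (𝓞 K))⁰} (hJ : ClassGroup.mk0 J = C⁻¹)
    (I : {I : (Ideal (𝓞 K))⁰ // ClassGroup.mk0 I = C}) :
    mixedEmbedding.norm (mixedEmbedding K (gen K hJ I : K)) =
      (Ideal.absNorm (I.1 : Ideal (𝓞 K)) : ℝ) * Ideal.absNorm (J : Ideal (𝓞 K)) := by
  rw [emb_norm, gen_spec, map_mul, Nat.cast_mul]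

lemma nz_norm {a : 𝓞 K} (ha : a ≠ 0) : mixedEmbedding.norm (mixedEmbedding K (a : K)) ≠ 0 := by
  rw [emb_norm, Nat.cast_ne_zero, Ideal.absNorm_ne_zero_iff_mem_nonZeroDivisors]
  exact mem_nonZeroDivisors_of_ne_zero (by simpa using ha)

lemma gen_mul_mem {C : ClassGroup (𝓞 K)} {J : (Ideal (𝓞 K))⁰} (hJ : ClassGroup.mk0 J = C⁻¹)
    (p : {I : (Ideal (𝓞 K))⁰ // ClassGroup.mk0 I = C} × (𝓞 K)ˣ) :
    (p.2 : 𝓞 K) * gen K hJ p.1 ∈ (J : Ideal (𝓞 K)) ∧ (p.2 : 𝓞 K) * gen K hJ p.1 ≠ 0 := by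
  obtain ⟨I, u⟩ := p
  have h0 : (u : 𝓞 K) ≠ 0 := Units.ne_zero u
  have h1 : gen K hJ I ∈ Ideal.span {gen K hJ I} := Ideal.mem_span_singleton_self _
  have h2 : gen K hJ I ∈ (J : Ideal (𝓞 K)) := by
    have h3 : (I.1 : Ideal (𝓞 K)) * (J : Ideal (𝓞 K)) ≤ (J : Ideal (𝓞 K)) := Ideal.mul_le_right
    rw [gen_spec] at h1
    exact h3 h1
  exact ⟨Ideal.mul_mem_left (J : Ideal (𝓞 K)) (u : 𝓞 K) h2, mul_ne_zero h0 (gen_ne K hJ I)⟩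

/-- unfolding map -/
def unfoldMap {C : ClassGroup (𝓞 K)} {J : (Ideal (𝓞 K))⁰} (hJ : ClassGroup.mk0 J = C⁻¹)
    (p : {I : (Ideal (𝓞 K))⁰ // ClassGroup.mk0 I = C} × (𝓞 K)ˣ) :
    {a : 𝓞 K // a ∈ (J : Ideal (𝓞 K)) ∧ a ≠ 0} := ⟨(p.2 : 𝓞 K) * gen K hJ p.1, gen_mul_mem K hJ p⟩

lemma unfoldMap_bij {C : ClassGroup (𝓞 K)} {J : (Ideal (𝓞 K))⁰} (hJ : ClassGroup.mk0 J = C⁻¹) :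
    Function.Bijective (unfoldMap K hJ) := by
  constructor
  · rintro ⟨I, u⟩ ⟨I', u'⟩ h
    replace h : (u : 𝓞 K) * gen K hJ I = u' * gen K hJ I' := congrArg Subtype.val h
    have h1 : Ideal.span {gen K hJ I} = Ideal.span {gen K hJ I'} := by
      rw [← Ideal.span_singleton_mul_left_unit u.isUnit, h, Ideal.span_singleton_mul_left_unit u'.isUnit]
    rw [gen_spec, gen_spec] at h1
    have h2 : I = I' := by
      apply Subtype.ext
      have : I.1 * J = I'.1 * J := Subtype.ext h1
      exact mul_right_cancel this
    subst h2
    have h3 := mul_right_cancel₀ (gen_ne K hJ I) h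
    rw [Units.ext h3]
  · rintro ⟨a, haJ, ha⟩
    have h1 : (J : Ideal (𝓞 K)) ∣ Ideal.span {a} := by
      rw [Ideal.dvd_span_singleton]; exact haJ
    obtain ⟨I, hI⟩ := h1
    have hI0 : I ∈ (Ideal (𝓞 K))⁰ := by
      apply mem_nonZeroDivisors_of_ne_zero
      rintro rfl
      rw [mul_zero] at hI
      exact ha (Ideal.span_singleton_eq_bot.mp hI)
    have hC : ClassGroup.mk0 (⟨I, hI0⟩ : (Ideal (𝓞 K))⁰) = C := by
      have : ClassGroup.mk0 (J * ⟨I, hI0⟩) = 1 := by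
        rw [ClassGroup.mk0_eq_one_iff]
        exact ⟨a, by rw [Submonoid.coe_mul, ← hI]⟩
      rw [map_mul, hJ, inv_mul_eq_one] at this
      exact this.symm
    have h4 := gen_spec K hJ ⟨⟨I, hI0⟩, hC⟩
    have h5 : Ideal.span {gen K hJ ⟨⟨I, hI0⟩, hC⟩} = Ideal.span {a} := by
      rw [h4, hI, mul_comm]
    rw [Ideal.span_singleton_eq_span_singleton] at h5
    obtain ⟨u, hu⟩ := h5
    exact ⟨(⟨⟨I, hI0⟩, hC⟩, u), Subtype.ext ((mul_comm _ _).trans hu)⟩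

/-- unfolding bijection -/
def unfoldEquiv {C : ClassGroup (𝓞 K)} {J : (Ideal (𝓞 K))⁰} (hJ : ClassGroup.mk0 J = C⁻¹) :
    {I : (Ideal (𝓞 K))⁰ // ClassGroup.mk0 I = C} × (𝓞 K)ˣ ≃ {a : 𝓞 K // a ∈ (J : Ideal (𝓞 K)) ∧ a ≠ 0} :=
  Equiv.ofBijective _ (unfoldMap_bij K hJ)

lemma unfold_sum {C : ClassGroup (𝓞 K)} {J : (Ideal (𝓞 K))⁰} (hJ : ClassGroup.mk0 J = C⁻¹) (h : ℝ → ENNReal) :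
    ∑' a : (J : Ideal (𝓞 K)), h (mixedEmbedding.norm (mixedEmbedding K ((a : 𝓞 K) : K))) *
      ENNReal.ofReal (wt K (mixedEmbedding K ((a : 𝓞 K) : K))) =
    torsionOrder K * ∑' I : {I : (Ideal (𝓞 K))⁰ // ClassGroup.mk0 I = C},
      h ((Ideal.absNorm (I.1 : Ideal (𝓞 K)) : ℝ) * Ideal.absNorm (J : Ideal (𝓞 K))) := by
  set F : 𝓞 K → ENNReal := fun a => h (mixedEmbedding.norm (mixedEmbedding K (a : K))) *
      ENNReal.ofReal (wt K (mixedEmbedding K (a : K))) with hF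
  have hF0 : F 0 = 0 := by simp [hF, wt]
  have e1 : ∑' a : (J : Ideal (𝓞 K)), F a = ∑' a : {a : 𝓞 K // a ∈ (J : Ideal (𝓞 K)) ∧ a ≠ 0}, F a := by
    have t1 := tsum_subtype {a : 𝓞 K | a ∈ (J : Ideal (𝓞 K))} F
    have t2 := tsum_subtype {a : 𝓞 K | a ∈ (J : Ideal (𝓞 K)) ∧ a ≠ 0} F
    refine t1.trans (Eq.trans ?_ t2.symm)
    congr 1
    funext a
    by_cases ha : a = 0
    · subst ha; simp [Set.indicator_apply, hF0]
    · simp [Set.indicator_apply, ha]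
  show ∑' a : (J : Ideal (𝓞 K)), F a = _
  rw [e1, ← (unfoldEquiv K hJ).tsum_eq, ENNReal.tsum_prod', ← ENNReal.tsum_mul_left]
  congr 1
  funext I
  have hn := nz_norm K (gen_ne K hJ I)
  rw [mul_comm, ← unit_sum K _ hn, ← ENNReal.tsum_mul_left]
  congr 1
  funext u
  have hv : mixedEmbedding K ((u * gen K hJ I : 𝓞 K) : K) = u • mixedEmbedding K (gen K hJ I : K) := by
    rw [unitSMul_smul, ← map_mul]; simp
  show h _ * _ = _
  simp only [unfoldEquiv, Equiv.ofBijective_apply, unfoldMap]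
  rw [hv, norm_unit_smul, gen_norm]

/-- the lattice basis of the ideal `J` -/
def bJ (J : (Ideal (𝓞 K))⁰) := fractionalIdealLatticeBasis K (FractionalIdeal.mk0 K J)

lemma lattice_sum (J : (Ideal (𝓞 K))⁰) (F : mixedSpace K → ENNReal) :
    ∑' m, F ((bJ K J).equivFun.symm (zv m)) =
      ∑' a : (J : Ideal (𝓞 K)), F (mixedEmbedding K ((a : 𝓞 K) : K)) := by
  have hm : ∀ m, ∑ i, m i • bJ K J i = (bJ K J).equivFun.symm (zv m) := by
    intro m
    rw [Module.Basis.equivFun_symm_apply]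
    exact Finset.sum_congr rfl fun i _ => (Int.cast_smul_eq_zsmul ℝ (m i) _).symm
  have hi1 : Function.Injective (fun m => (bJ K J).equivFun.symm (zv m)) := by
    intro m m' h
    have := (bJ K J).equivFun.symm.injective h
    funext i
    have := congrFun this i
    simpa [zv] using this
  have hi2 : Function.Injective (fun a : (J : Ideal (𝓞 K)) => mixedEmbedding K ((a : 𝓞 K) : K)) :=
    fun a b h => Subtype.ext (RingOfIntegers.coe_injective (mixedEmbedding_injective K h))
  have hr : Set.range (fun m => (bJ K J).equivFun.symm (zv m)) =
      Set.range (fun a : (J : Ideal (𝓞 K)) => mixedEmbedding K ((a : 𝓞 K) : K)) := by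
    have h1 : Set.range (fun m => (bJ K J).equivFun.symm (zv m)) =
        (Submodule.span ℤ (Set.range (bJ K J)) : Set (mixedSpace K)) := by
      ext x
      rw [SetLike.mem_coe, Submodule.mem_span_range_iff_exists_fun]
      constructor
      · rintro ⟨m, rfl⟩
        exact ⟨m, hm m⟩
      · rintro ⟨m, rfl⟩
        exact ⟨m, (hm m).symm⟩
    rw [h1]
    ext x
    rw [SetLike.mem_coe, bJ, mem_span_fractionalIdealLatticeBasis]
    constructor
    · rintro ⟨y, hy, rfl⟩
      simp only [FractionalIdeal.coe_mk0] at hy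
      obtain ⟨a, ha, rfl⟩ := hy
      exact ⟨⟨a, ha⟩, rfl⟩
    · rintro ⟨a, rfl⟩
      refine ⟨((a : 𝓞 K) : K), ?_, rfl⟩
      simp only [FractionalIdeal.coe_mk0]
      exact ⟨a, a.2, rfl⟩
  rw [← tsum_range F hi1, ← tsum_range F hi2, hr]

lemma class_split (f : (Ideal (𝓞 K))⁰ → ENNReal) :
    ∑' I, f I = ∑ C : ClassGroup (𝓞 K), ∑' I : {I : (Ideal (𝓞 K))⁰ // ClassGroup.mk0 I = C}, f I.1 := by
  rw [← (Equiv.sigmaFiberEquiv (ClassGroup.mk0 (R := 𝓞 K))).tsum_eq, ENNReal.tsum_sigma', tsum_fintype]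
  rfl

end NF
end LandauTail

namespace LandauTail
set_option linter.unusedSectionVars false
open MeasureTheory
open scoped ContDiff

section NF
open NumberField NumberField.InfinitePlace NumberField.mixedEmbedding
open NumberField.Units NumberField.Units.dirichletUnitTheorem
open scoped Classical nonZeroDivisors

lemma phi_amp {φ : ℝ → ℝ} (hs : ∀ u, φ u ≠ 0 → |u| ≤ 4) (v : mixedSpace K) :
    φ (Real.log (mixedEmbedding.norm v)) * amp K v = φ (Real.log (mixedEmbedding.norm v)) * wt K v := by
  by_cases h : φ (Real.log (mixedEmbedding.norm v)) = 0
  · rw [h]; simp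
  · rw [amp, chi_one (hs _ h), one_mul]

lemma cpt_of {φ : ℝ → ℝ} (hs : ∀ u, φ u ≠ 0 → |u| ≤ 4) : HasCompactSupport φ := by
  refine HasCompactSupport.of_support_subset_isCompact (isCompact_Icc (a := (-4:ℝ)) (b := 4)) ?_
  intro u hu
  exact abs_le.mp (hs u hu)

lemma main_integral : ∃ c1 : ℝ, 0 ≤ c1 ∧ ∀ φ : ℝ → ℝ, ContDiff ℝ ∞ φ → (∀ u, 0 ≤ φ u) →
    (∀ u, φ u ≠ 0 → |u| ≤ 4) →
    ∫ v : mixedSpace K, φ (Real.log (mixedEmbedding.norm v)) * amp K v = c1 * ∫ u, φ u * Real.exp u := by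
  have hchi : HasCompactSupport (fun u => chi u * Real.exp u) := by
    refine HasCompactSupport.of_support_subset_isCompact (isCompact_Icc (a := (-5:ℝ)) (b := 5)) ?_
    intro u hu
    exact abs_le.mp (chi_supp (left_ne_zero_of_mul hu))
  have hA0 : 0 < ∫ u, chi u * Real.exp u := by
    refine Continuous.integral_pos_of_hasCompactSupport_nonneg_nonzero (x := 0)
      (chi_smooth.continuous.mul Real.continuous_exp) hchi
      (fun u => mul_nonneg (chi_nonneg u) (Real.exp_pos u).le) ?_
    rw [chi_one (by simp)]; simp
  have hLm : Measurable fun v : mixedSpace K => Real.log (mixedEmbedding.norm v) := (nfDatum K).L_meas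
  have hwm := wt_meas K
  have toR : ∀ f : ℝ → ℝ, Continuous f → (∀ u, 0 ≤ f u) →
     ∫ u, f u * Real.exp u = (∫⁻ t, ENNReal.ofReal (f t) * ENNReal.ofReal (Real.exp t)).toReal := by
    intro f hf hf0
    rw [integral_eq_lintegral_of_nonneg_ae (Eventually.of_forall fun u => mul_nonneg (hf0 u) (Real.exp_pos u).le)
      (by fun_prop)]
    simp_rw [ENNReal.ofReal_mul (hf0 _)]
  have toV : ∀ f : ℝ → ℝ, Continuous f → (∀ u, 0 ≤ f u) →
     ∫ v : mixedSpace K, f (Real.log (mixedEmbedding.norm v)) * wt K v =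
      (∫⁻ v : mixedSpace K, ENNReal.ofReal (f (Real.log (mixedEmbedding.norm v))) * ENNReal.ofReal (wt K v)).toReal := by
    intro f hf hf0
    rw [integral_eq_lintegral_of_nonneg_ae (Eventually.of_forall fun u => mul_nonneg (hf0 _) (wt_nonneg K u))
      ((hf.measurable.comp hLm).mul hwm).aestronglyMeasurable]
    simp_rw [ENNReal.ofReal_mul (hf0 _)]
  refine ⟨(∫ v : mixedSpace K, chi (Real.log (mixedEmbedding.norm v)) * wt K v) / ∫ u, chi u * Real.exp u, ?_, ?_⟩
  · refine div_nonneg (integral_nonneg fun v => mul_nonneg (chi_nonneg _) (wt_nonneg K v)) hA0.le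
  intro φ hφ hφ0 hs
  simp_rw [phi_amp K hs]
  have hid := push_identity (nfDatum K) (w := fun v => ENNReal.ofReal (wt K v)) (by fun_prop)
    (fun s v => by
      show ENNReal.ofReal _ = ENNReal.ofReal _
      rw [wt_smul K _ (Real.exp_ne_zero _)])
    (fun v hv => fun h => hv (by rw [wt, if_pos h, ENNReal.ofReal_zero]))
    (f := fun u => ENNReal.ofReal (φ u)) (f0 := fun u => ENNReal.ofReal (chi u))
    (hφ.continuous.measurable.ennreal_ofReal) (chi_smooth.continuous.measurable.ennreal_ofReal)
  have h2 := congrArg ENNReal.toReal hid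
  rw [ENNReal.toReal_mul, ENNReal.toReal_mul, ← toR φ hφ.continuous hφ0, ← toR chi chi_smooth.continuous chi_nonneg] at h2
  have h3 := toV φ hφ.continuous hφ0
  have h4 := toV chi chi_smooth.continuous chi_nonneg
  rw [h3, h4]
  rw [div_mul_eq_mul_div, eq_div_iff hA0.ne', mul_comm, mul_comm _ (∫ u, φ u * Real.exp u)]
  exact h2.symm

lemma class_count (C : ClassGroup (𝓞 K)) : ∃ c : ℝ, 0 ≤ c ∧ ∃ E : ℝ, 0 ≤ E ∧ ∀ φ : ℝ → ℝ, ContDiff ℝ ∞ φ →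
    (∀ u, 0 ≤ φ u) → (∀ u, φ u ≠ 0 → |u| ≤ 4) → ∀ x q : ℝ, 1 ≤ x → 0 ≤ q →
    NM 1 (fun u => (φ u : ℂ)) ≤ q →
    NM (1 + 2 * Module.finrank ℚ K) (fun u => (φ u : ℂ)) ≤
      q * (x ^ ((2:ℝ) / (Module.finrank ℚ K + 1))) ^ (2 * Module.finrank ℚ K) →
    |∑' I : {I : (Ideal (𝓞 K))⁰ // ClassGroup.mk0 I = C},
        φ (Real.log (Ideal.absNorm (I.1 : Ideal (𝓞 K)) / x)) - c * x * ∫ u, φ u * Real.exp u| ≤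
      E * q * x ^ (((Module.finrank ℚ K : ℝ) - 1) / (Module.finrank ℚ K + 1)) := by
  obtain ⟨J, hJ⟩ := ClassGroup.mk0_surjective C⁻¹
  set n := Module.finrank ℚ K with hn
  have hn0 : 0 < n := Module.finrank_pos
  have hnR : (0:ℝ) < n := by exact_mod_cast hn0
  obtain ⟨c0, hc0, E, hE, hmain⟩ := lattice_count (nfDatum K) (bJ K J) (a0 := fun v => (amp K v : ℂ))
    (Complex.ofRealCLM.contDiff.comp (amp_smooth K)) ((amp_cpt K).comp_left (g := fun r : ℝ => (r : ℂ)) Complex.ofReal_zero)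
    (by
      have : tsupport (fun v => (amp K v : ℂ)) ⊆ tsupport (amp K) :=
        closure_mono (fun v hv => by simpa using hv)
      exact this.trans (amp_tsupp K)) (mixedEmbedding.finrank K)
  obtain ⟨c1, hc1, hintg⟩ := main_integral K
  set NJ : ℝ := (Ideal.absNorm (J : Ideal (𝓞 K)) : ℝ) with hNJ
  have hNJ1 : 1 ≤ NJ := by
    rw [hNJ]; exact_mod_cast Nat.one_le_iff_ne_zero.mpr (Ideal.absNorm_ne_zero_of_nonZeroDivisors J)
  have hNJ0 : 0 < NJ := by linarith
  set T : ℝ := ((torsionOrder K : ℕ) : ℝ) with hT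
  have hT0 : 0 < T := by rw [hT]; exact_mod_cast Nat.pos_of_ne_zero (torsionOrder_ne_zero K)
  set θ : ℝ := ((n : ℝ) - 1) / (n + 1) with hθ
  refine ⟨c0 * NJ * c1 / T, by positivity, E * NJ ^ θ / T, by positivity, ?_⟩
  intro φ hφ hφ0 hs x q hx hq hNM1 hNM2
  have hx0 : 0 < x := by linarith
  set Y := NJ * x with hY
  have hxY : x ≤ Y := by rw [hY]; nlinarith
  have hY1 : 1 ≤ Y := hx.trans hxY
  have hY0 : 0 < Y := by linarith
  set R := Y ^ ((1:ℝ) / n) with hR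
  have hR0 : 0 < R := by positivity
  have hRn : R ^ n = Y := by
    rw [hR, ← Real.rpow_natCast, ← Real.rpow_mul hY0.le, one_div, inv_mul_cancel₀ hnR.ne', Real.rpow_one]
  have hR1 : 1 ≤ R := Real.one_le_rpow hY1 (by positivity)
  have hRδ : R ^ (((n:ℝ) - 1) / (n + 1)) * R = Y ^ ((2:ℝ) / (n + 1)) := by
    conv_lhs => rw [← Real.rpow_one R]
    rw [Real.rpow_one, ← Real.rpow_add_one hR0.ne', hR, ← Real.rpow_mul hY0.le]
    congr 1
    field_simp
    ring
  have hRθ : R ^ ((n:ℝ) * (n - 1) / (n + 1)) = NJ ^ θ * x ^ θ := by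
    rw [← Real.mul_rpow hNJ0.le hx0.le, ← hY, hR, ← Real.rpow_mul hY0.le]
    congr 1
    rw [hθ]
    field_simp
  have hφc : ContDiff ℝ ∞ (fun u => (φ u : ℂ)) := Complex.ofRealCLM.contDiff.comp hφ
  have hb := hmain (fun u => (φ u : ℂ)) hφc
    ((cpt_of hs).comp_left (g := fun r : ℝ => (r : ℂ)) Complex.ofReal_zero) R q hR1 hq hNM1 (by
      refine hNM2.trans ?_
      rw [hRδ]
      gcongr)
  -- rewrite the integral
  have hI : ∫ v, ((φ ((nfDatum K).L v) : ℝ) : ℂ) * (amp K v : ℂ) = ((c1 * ∫ u, φ u * Real.exp u : ℝ) : ℂ) := by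
    rw [← hintg φ hφ hφ0 hs, ← integral_complex_ofReal]
    congr 1
    funext v
    push_cast
    rfl
  -- rewrite the sum
  have hlogR : (n : ℝ) * Real.log R = Real.log Y := by rw [← hRn, Real.log_pow]
  have hS : ∑' m, ((φ ((nfDatum K).L (R⁻¹ • (bJ K J).equivFun.symm (zv m))) : ℝ) : ℂ) *
      (amp K (R⁻¹ • (bJ K J).equivFun.symm (zv m)) : ℂ) =
      ((T * ∑' I : {I : (Ideal (𝓞 K))⁰ // ClassGroup.mk0 I = C},
        φ (Real.log (Ideal.absNorm (I.1 : Ideal (𝓞 K)) / x)) : ℝ) : ℂ) := by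
    set h : ℝ → ENNReal := fun t => ENNReal.ofReal (φ (Real.log t - Real.log Y)) with hh
    have e1 : ∀ v : mixedSpace K, φ ((nfDatum K).L (R⁻¹ • v)) * amp K (R⁻¹ • v) =
        (h (mixedEmbedding.norm v) * ENNReal.ofReal (wt K v)).toReal := by
      intro v
      have : (nfDatum K).L (R⁻¹ • v) = Real.log (mixedEmbedding.norm (R⁻¹ • v)) := rfl
      rw [this, phi_amp K hs, wt_smul K _ (inv_ne_zero hR0.ne'), ENNReal.toReal_mul,
        ENNReal.toReal_ofReal (wt_nonneg K v), hh, ENNReal.toReal_ofReal (hφ0 _)]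
      by_cases hv : mixedEmbedding.norm v = 0
      · rw [wt, if_pos hv, mul_zero, mul_zero]
      · rw [mixedEmbedding.norm_smul, Real.log_mul (pow_ne_zero _ (abs_ne_zero.mpr (inv_ne_zero hR0.ne'))) hv,
          Real.log_pow, Real.log_abs, Real.log_inv, ← hlogR]
        congr 2
        ring
    have e2 : ∑' m, φ ((nfDatum K).L (R⁻¹ • (bJ K J).equivFun.symm (zv m))) *
      amp K (R⁻¹ • (bJ K J).equivFun.symm (zv m)) = T * ∑' I : {I : (Ideal (𝓞 K))⁰ // ClassGroup.mk0 I = C},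
        φ (Real.log (Ideal.absNorm (I.1 : Ideal (𝓞 K)) / x)) := by
      simp_rw [e1]
      rw [← ENNReal.tsum_toReal_eq (fun m => ENNReal.mul_ne_top ENNReal.ofReal_ne_top ENNReal.ofReal_ne_top),
        lattice_sum K J (fun v => h (mixedEmbedding.norm v) * ENNReal.ofReal (wt K v)), unfold_sum K hJ h,
        ENNReal.toReal_mul, ENNReal.toReal_natCast, ENNReal.tsum_toReal_eq (fun m => ENNReal.ofReal_ne_top)]
      congr 1
      refine tsum_congr fun I => ?_
      rw [ENNReal.toReal_ofReal (hφ0 _)]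
      have hI0 : (Ideal.absNorm (I.1 : Ideal (𝓞 K)) : ℝ) ≠ 0 := by
        exact_mod_cast Ideal.absNorm_ne_zero_of_nonZeroDivisors I.1
      rw [Real.log_mul hI0 hNJ0.ne', hY, Real.log_mul hNJ0.ne' hx0.ne', Real.log_div hI0 hx0.ne']
      congr 1
      ring
    rw [← e2, Complex.ofReal_tsum]
    push_cast
    rfl
  rw [hS, hI] at hb
  have hb2 : ‖((T * ∑' I : {I : (Ideal (𝓞 K))⁰ // ClassGroup.mk0 I = C},
        φ (Real.log (Ideal.absNorm (I.1 : Ideal (𝓞 K)) / x)) - c0 * R ^ n * (c1 * ∫ u, φ u * Real.exp u) : ℝ) : ℂ)‖ ≤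
      E * q * R ^ ((n:ℝ) * (n - 1) / (n + 1)) := by
    refine le_of_eq_of_le ?_ hb
    push_cast
    rfl
  rw [Complex.norm_real, Real.norm_eq_abs, hRn, hRθ] at hb2
  have hfin : ∑' I : {I : (Ideal (𝓞 K))⁰ // ClassGroup.mk0 I = C},
        φ (Real.log (Ideal.absNorm (I.1 : Ideal (𝓞 K)) / x)) - c0 * NJ * c1 / T * x * ∫ u, φ u * Real.exp u
      = (T * ∑' I : {I : (Ideal (𝓞 K))⁰ // ClassGroup.mk0 I = C},
        φ (Real.log (Ideal.absNorm (I.1 : Ideal (𝓞 K)) / x)) - c0 * Y * (c1 * ∫ u, φ u * Real.exp u)) / T := by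
    rw [hY]; field_simp
  rw [hfin, abs_div, abs_of_pos hT0, div_le_iff₀ hT0]
  refine hb2.trans (le_of_eq ?_)
  field_simp

end NF
end LandauTail

namespace LandauTail
set_option linter.unusedSectionVars false
open MeasureTheory
open scoped ContDiff

section NF
open NumberField NumberField.InfinitePlace NumberField.mixedEmbedding
open NumberField.Units NumberField.Units.dirichletUnitTheorem
open scoped Classical nonZeroDivisors

lemma fin_ideals (B : ℝ) : {I : (Ideal (𝓞 K))⁰ | (Ideal.absNorm (I : Ideal (𝓞 K)) : ℝ) ≤ B}.Finite := by
  refine (Ideal.finite_setOfPred_absNorm_le₀ (S := 𝓞 K) ⌊B⌋₊).subset ?_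
  intro I hI
  exact Nat.le_floor hI

lemma one_le_norm_ideal (I : (Ideal (𝓞 K))⁰) : (1:ℝ) ≤ Ideal.absNorm (I : Ideal (𝓞 K)) := by
  exact_mod_cast Nat.one_le_iff_ne_zero.mpr (Ideal.absNorm_ne_zero_of_nonZeroDivisors I)

lemma summable_cut {ι : Type*} {N : ι → ℝ} (hN : ∀ i, 1 ≤ N i) (hfin : ∀ B : ℝ, {i | N i ≤ B}.Finite)
    {φ : ℝ → ℝ} (R : ℝ) (hs : ∀ u, φ u ≠ 0 → |u| ≤ R) {x : ℝ} (hx : 0 < x) :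
    Summable fun i => φ (Real.log (N i / x)) := by
  refine summable_of_hasFiniteSupport ?_
  refine (hfin (x * Real.exp R)).subset ?_
  intro i hi
  have h1 := (abs_le.mp (hs _ hi)).2
  have hp : 0 < N i := by linarith [hN i]
  rw [Real.log_le_iff_le_exp (by positivity), div_le_iff₀ hx] at h1
  show N i ≤ _
  linarith

lemma class_split_real {f : (Ideal (𝓞 K))⁰ → ℝ} (hf0 : ∀ I, 0 ≤ f I) (hf : Summable f) :
    ∑' I, f I = ∑ C : ClassGroup (𝓞 K), ∑' I : {I : (Ideal (𝓞 K))⁰ // ClassGroup.mk0 I = C}, f I.1 := by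
  have h := congrArg ENNReal.toReal (class_split K (fun I => ENNReal.ofReal (f I)))
  rw [ENNReal.tsum_toReal_eq (fun _ => ENNReal.ofReal_ne_top), ENNReal.toReal_sum] at h
  · simp_rw [ENNReal.tsum_toReal_eq (fun _ => ENNReal.ofReal_ne_top), ENNReal.toReal_ofReal (hf0 _)] at h
    exact h
  · intro C _
    exact ((hf.subtype _).tsum_ofReal_ne_top)

lemma smooth_count : ∃ c : ℝ, 0 ≤ c ∧ ∃ E : ℝ, 0 ≤ E ∧ ∀ φ : ℝ → ℝ, ContDiff ℝ ∞ φ →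
    (∀ u, 0 ≤ φ u) → (∀ u, φ u ≠ 0 → |u| ≤ 4) → ∀ x q : ℝ, 1 ≤ x → 0 ≤ q →
    NM 1 (fun u => (φ u : ℂ)) ≤ q →
    NM (1 + 2 * Module.finrank ℚ K) (fun u => (φ u : ℂ)) ≤
      q * (x ^ ((2:ℝ) / (Module.finrank ℚ K + 1))) ^ (2 * Module.finrank ℚ K) →
    |∑' I : (Ideal (𝓞 K))⁰,
        φ (Real.log (Ideal.absNorm (I : Ideal (𝓞 K)) / x)) - c * x * ∫ u, φ u * Real.exp u| ≤
      E * q * x ^ (((Module.finrank ℚ K : ℝ) - 1) / (Module.finrank ℚ K + 1)) := by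
  choose c hc E hE H using class_count K
  refine ⟨∑ C, c C, Finset.sum_nonneg fun C _ => hc C, ∑ C, E C, Finset.sum_nonneg fun C _ => hE C, ?_⟩
  intro φ hφ h0 hs x q hx hq h1 h2
  rw [class_split_real K (fun I => h0 _) (summable_cut (one_le_norm_ideal K) (fin_ideals K) 4 hs (by linarith)),
    Finset.sum_mul, Finset.sum_mul, Finset.sum_mul, Finset.sum_mul, ← Finset.sum_sub_distrib]
  refine (Finset.abs_sum_le_sum_abs _ _).trans (Finset.sum_le_sum fun C _ => ?_)
  exact H C φ hφ h0 hs x q hx hq h1 h2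

end NF
end LandauTail

namespace LandauTail
set_option linter.unusedSectionVars false
open MeasureTheory
open scoped ContDiff

lemma deriv_mul_bd {f g : ℝ → ℝ} (hf : ContDiff ℝ ∞ f) (hg : ContDiff ℝ ∞ g) {M : ℕ} {A B D u : ℝ}
    (hA : 0 ≤ A) (hB : 0 ≤ B) (hD : 0 ≤ D)
    (h1 : ∀ i ≤ M, ‖iteratedDeriv i f u‖ ≤ A * D ^ i) (h2 : ∀ i ≤ M, ‖iteratedDeriv i g u‖ ≤ B * D ^ i) :
    ∀ j ≤ M, ‖iteratedDeriv j (fun t => f t * g t) u‖ ≤ A * B * (2 * D) ^ j := by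
  intro j hj
  have h := norm_iteratedFDeriv_mul_le (𝕜 := ℝ) hf hg u (n := j) (by exact_mod_cast le_top)
  simp_rw [norm_iteratedFDeriv_eq_norm_iteratedDeriv] at h
  refine h.trans ?_
  calc ∑ i ∈ Finset.range (j + 1), (j.choose i : ℝ) * ‖iteratedDeriv i f u‖ * ‖iteratedDeriv (j - i) g u‖
      ≤ ∑ i ∈ Finset.range (j + 1), (j.choose i : ℝ) * (A * B * D ^ j) := by
        refine Finset.sum_le_sum fun i hi => ?_
        have hij : i ≤ j := Nat.lt_succ_iff.mp (Finset.mem_range.mp hi)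
        have e : D ^ j = D ^ i * D ^ (j - i) := by rw [← pow_add]; congr 1; omega
        rw [e, mul_assoc]
        refine mul_le_mul_of_nonneg_left ?_ (by positivity)
        calc _ ≤ (A * D ^ i) * (B * D ^ (j - i)) :=
              mul_le_mul (h1 i (by omega)) (h2 _ (by omega)) (norm_nonneg _) (by positivity)
          _ = _ := by ring
    _ = A * B * (2 * D) ^ j := by
        rw [← Finset.sum_mul, mul_pow]
        have : ∑ i ∈ Finset.range (j + 1), (j.choose i : ℝ) = 2 ^ j := by exact_mod_cast Nat.sum_range_choose j
        rw [this]; ring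

lemma st_bd_one (i : ℕ) : ∃ A : ℝ, ∀ t, ‖iteratedDeriv i Real.smoothTransition t‖ ≤ A := by
  have hsm : ContDiff ℝ ∞ Real.smoothTransition := Real.smoothTransition.contDiff
  have hc : Continuous (iteratedDeriv i Real.smoothTransition) :=
    hsm.continuous_iteratedDeriv i (by exact_mod_cast le_top)
  obtain ⟨A, hA⟩ := (isCompact_Icc (a := (0:ℝ)) (b := 1)).exists_bound_of_continuousOn hc.continuousOn
  refine ⟨max A 1, fun t => ?_⟩
  by_cases ht : t ∈ Set.Icc (0:ℝ) 1
  · exact (hA t ht).trans (le_max_left _ _)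
  refine le_trans ?_ (le_max_right _ _)
  have key : ∀ c : ℝ, ‖c‖ ≤ 1 → Real.smoothTransition =ᶠ[𝓝 t] (fun _ => c) →
      ‖iteratedDeriv i Real.smoothTransition t‖ ≤ 1 := by
    intro c hc h
    rw [h.iteratedDeriv_eq i, iteratedDeriv_const]
    split_ifs
    · exact hc
    · simp
  rw [Set.mem_Icc, not_and_or, not_le, not_le] at ht
  rcases ht with ht | ht
  · refine key 0 (by simp) ?_
    filter_upwards [eventually_lt_nhds ht] with s hs using Real.smoothTransition.zero_of_nonpos hs.le
  · refine key 1 (by simp) ?_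
    filter_upwards [eventually_gt_nhds ht] with s hs using Real.smoothTransition.one_of_one_le hs.le

lemma st_bd (M : ℕ) : ∃ A : ℝ, 0 ≤ A ∧ ∀ i ≤ M, ∀ t, ‖iteratedDeriv i Real.smoothTransition t‖ ≤ A := by
  choose A hA using st_bd_one
  refine ⟨∑ i ∈ Finset.range (M + 1), A i,
    Finset.sum_nonneg fun i _ => (norm_nonneg _).trans (hA i 0), fun i hi t => (hA i t).trans ?_⟩
  exact Finset.single_le_sum (f := A) (fun i _ => (norm_nonneg _).trans (hA i 0)) (Finset.mem_range.mpr (by omega))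

lemma st_scaled (i : ℕ) (k b u : ℝ) {A : ℝ} (hA : ∀ t, ‖iteratedDeriv i Real.smoothTransition t‖ ≤ A) :
    ‖iteratedDeriv i (fun u => Real.smoothTransition (k * u + b)) u‖ ≤ A * |k| ^ i := by
  have hsm : ContDiff ℝ i (fun t => Real.smoothTransition (t + b)) :=
    (Real.smoothTransition.contDiff (n := (i : ℕ∞))).comp (contDiff_id.add contDiff_const)
  have h := iteratedDeriv_comp_const_mul hsm k
  have h' := congrFun h u
  rw [h', iteratedDeriv_comp_add_const, norm_mul, norm_pow, Real.norm_eq_abs, mul_comm]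
  exact mul_le_mul_of_nonneg_right (hA _) (by positivity)

lemma exp_iter (α : ℝ) (i : ℕ) (u : ℝ) :
    iteratedDeriv i (fun u => Real.exp (-α * u)) u = (-α) ^ i * Real.exp (-α * u) := by
  have := iteratedDeriv_comp_const_mul (n := i) Real.contDiff_exp (-α)
  have h := congrFun this u
  rw [h, iteratedDeriv_eq_iterate, Real.iter_deriv_exp]

lemma exp_bd (α : ℝ) {u : ℝ} (hu : |u| ≤ 2) : Real.exp (-α * u) ≤ Real.exp (|α| * 2) := by
  refine Real.exp_le_exp.mpr ?_
  calc -α * u ≤ |α * u| := by rw [neg_mul]; exact neg_le_abs _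
    _ = |α| * |u| := abs_mul _ _
    _ ≤ |α| * 2 := mul_le_mul_of_nonneg_left hu (abs_nonneg _)

/-- The smoothed window. -/
def win (α D a u : ℝ) : ℝ :=
  Real.smoothTransition (D * u + a) * Real.smoothTransition (-D * u + (D + a)) * Real.exp (-α * u)

lemma win_smooth (α D a : ℝ) : ContDiff ℝ ∞ (win α D a) := by
  have hsm : ContDiff ℝ ∞ Real.smoothTransition := Real.smoothTransition.contDiff
  have h1 : ContDiff ℝ ∞ (fun u => Real.smoothTransition (D * u + a)) := hsm.comp (by fun_prop)
  have h2 : ContDiff ℝ ∞ (fun u => Real.smoothTransition (-D * u + (D + a))) := hsm.comp (by fun_prop)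
  exact (h1.mul h2).mul (by fun_prop)

lemma win_nonneg (α D a u : ℝ) : 0 ≤ win α D a u :=
  mul_nonneg (mul_nonneg (Real.smoothTransition.nonneg _) (Real.smoothTransition.nonneg _)) (Real.exp_pos _).le

lemma win_le (α D a u : ℝ) : win α D a u ≤ Real.exp (-α * u) := by
  have := mul_le_one₀ (Real.smoothTransition.le_one (D * u + a)) (Real.smoothTransition.nonneg (-D * u + (D + a)))
    (Real.smoothTransition.le_one _)
  exact mul_le_of_le_one_left (Real.exp_pos _).le this

lemma win_zero_left {α D a u : ℝ} (h : D * u + a ≤ 0) : win α D a u = 0 := by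
  rw [win, Real.smoothTransition.zero_of_nonpos h, zero_mul, zero_mul]

lemma win_zero_right {α D a u : ℝ} (h : -D * u + (D + a) ≤ 0) : win α D a u = 0 := by
  rw [win, Real.smoothTransition.zero_of_nonpos h, mul_zero, zero_mul]

lemma win_one {α D a u : ℝ} (h : 1 ≤ D * u + a) (h' : 1 ≤ -D * u + (D + a)) : win α D a u = Real.exp (-α * u) := by
  rw [win, Real.smoothTransition.one_of_one_le h, Real.smoothTransition.one_of_one_le h', one_mul, one_mul]

lemma win_supp {α D a u : ℝ} (hD : 1 ≤ D) (ha1 : a ≤ 1) (h : win α D a u ≠ 0) : |u| ≤ 2 := by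
  rw [abs_le]
  constructor
  · by_contra! hc
    exact h (win_zero_left (by nlinarith))
  · by_contra! hc
    exact h (win_zero_right (by nlinarith))

/-- Pointwise bound away from the edges. -/
lemma win_far {α D a u : ℝ} (hD : 1 ≤ D) (ha0 : 0 ≤ a) (ha1 : a ≤ 1) (j : ℕ)
    (h0 : 1 < D * |u|) (h1 : 1 < D * |u - 1|) :
    ‖iteratedDeriv j (win α D a) u‖ ≤ if |u| ≤ 2 then |α| ^ j * Real.exp (|α| * 2) else 0 := by
  have hD0 : 0 < D := by linarith
  have hz : (∀ᶠ s in 𝓝 u, win α D a s = 0) → ‖iteratedDeriv j (win α D a) u‖ = 0 := by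
    intro h
    have h' : win α D a =ᶠ[𝓝 u] (fun _ => 0) := h
    rw [h'.iteratedDeriv_eq j, iteratedDeriv_const]
    simp
  have hnn : 0 ≤ if |u| ≤ 2 then |α| ^ j * Real.exp (|α| * 2) else (0:ℝ) := by
    split_ifs <;> positivity
  rcases le_total 0 u with hu | hu
  swap
  · rw [abs_of_nonpos hu] at h0
    rw [hz]
    · exact hnn
    · have : ∀ᶠ s in 𝓝 u, D * s < -1 :=
        (continuous_const.mul continuous_id).continuousAt.eventually_lt_const (by simpa using by linarith)
      filter_upwards [this] with s hs
      exact win_zero_left (by linarith)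
  rw [abs_of_nonneg hu] at h0
  rcases le_total 0 (u - 1) with hu1 | hu1
  · rw [abs_of_nonneg hu1] at h1
    rw [hz]
    · exact hnn
    · have : ∀ᶠ s in 𝓝 u, 1 < D * (s - 1) :=
        (continuous_const.mul (continuous_id.sub continuous_const)).continuousAt.eventually_const_lt (by simpa using h1)
      filter_upwards [this] with s hs
      exact win_zero_right (by linarith)
  · rw [abs_of_nonpos hu1] at h1
    have e1 : ∀ᶠ s in 𝓝 u, 1 < D * s :=
        (continuous_const.mul continuous_id).continuousAt.eventually_const_lt (by simpa using h0)
    have e2 : ∀ᶠ s in 𝓝 u, 1 < D * -(s - 1) :=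
        (continuous_const.mul (continuous_id.sub continuous_const).neg).continuousAt.eventually_const_lt (by simpa using h1)
    have h' : win α D a =ᶠ[𝓝 u] (fun s => Real.exp (-α * s)) := by
      filter_upwards [e1, e2] with s h1 h2
      exact win_one (by linarith) (by linarith)
    rw [h'.iteratedDeriv_eq j, exp_iter, if_pos (by rw [abs_of_nonneg hu]; linarith), norm_mul, norm_pow,
      Real.norm_eq_abs, abs_neg, Real.norm_of_nonneg (Real.exp_pos _).le]
    exact mul_le_mul_of_nonneg_left (exp_bd α (by rw [abs_of_nonneg hu]; linarith)) (by positivity)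

lemma win_near (α : ℝ) (M : ℕ) : ∃ W : ℝ, 0 ≤ W ∧ ∀ D a u : ℝ, 1 ≤ D → |u| ≤ 2 → ∀ j ≤ M,
    ‖iteratedDeriv j (win α D a) u‖ ≤ W * D ^ j := by
  obtain ⟨A, hA0, hA⟩ := st_bd M
  refine ⟨A * A * Real.exp (|α| * 2) * (4 * (1 + |α|)) ^ M, by positivity, ?_⟩
  intro D a u hD hu j hj
  have hD0 : 0 < D := by linarith
  have hsm : ContDiff ℝ ∞ Real.smoothTransition := Real.smoothTransition.contDiff
  have h1 : ContDiff ℝ ∞ (fun u => Real.smoothTransition (D * u + a)) := hsm.comp (by fun_prop)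
  have h2 : ContDiff ℝ ∞ (fun u => Real.smoothTransition (-D * u + (D + a))) := hsm.comp (by fun_prop)
  have b1 := deriv_mul_bd h1 h2 (M := M) (u := u) hA0 hA0 hD0.le
    (fun i hi => by simpa [abs_of_pos hD0] using st_scaled i D a u (hA i hi))
    (fun i hi => by simpa [abs_of_pos hD0] using st_scaled i (-D) (D + a) u (hA i hi))
  have hα1 : 1 ≤ 1 + |α| := by linarith [abs_nonneg α]
  have b2 := deriv_mul_bd (h1.mul h2) (g := fun u => Real.exp (-α * u)) (by fun_prop) (M := M) (u := u)
    (A := A * A) (B := Real.exp (|α| * 2)) (D := 2 * D * (1 + |α|)) (by positivity) (by positivity) (by positivity)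
    (fun i hi => by
      refine (b1 i hi).trans ?_
      refine mul_le_mul_of_nonneg_left (pow_le_pow_left₀ (by positivity) ?_ _) (by positivity)
      nlinarith)
    (fun i hi => by
      rw [exp_iter, norm_mul, norm_pow, Real.norm_eq_abs, abs_neg, Real.norm_of_nonneg (Real.exp_pos _).le, mul_comm]
      refine mul_le_mul (exp_bd α hu) (pow_le_pow_left₀ (abs_nonneg _) ?_ _) (by positivity) (by positivity)
      nlinarith [abs_nonneg α])
  refine (b2 j hj).trans ?_
  have : 2 * (2 * D * (1 + |α|)) = (4 * (1 + |α|)) * D := by ring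
  rw [this, mul_pow, ← mul_assoc]
  gcongr
  linarith

end LandauTail

namespace LandauTail
set_option linter.unusedSectionVars false
open MeasureTheory
open scoped ContDiff

/-- indicator majorant of the two edges -/
def edg (D u : ℝ) : ℝ := (Set.Icc (-D⁻¹) D⁻¹).indicator (fun _ => (1:ℝ)) u +
  (Set.Icc (1 - D⁻¹) (1 + D⁻¹)).indicator (fun _ => (1:ℝ)) u

lemma edg_nonneg (D u : ℝ) : 0 ≤ edg D u :=
  add_nonneg (Set.indicator_nonneg (fun _ _ => zero_le_one) _) (Set.indicator_nonneg (fun _ _ => zero_le_one) _)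

lemma ind_int (a b : ℝ) : Integrable ((Set.Icc a b).indicator (fun _ => (1:ℝ))) :=
  (integrable_indicator_iff measurableSet_Icc).mpr (integrableOn_const (by simp))

lemma edg_int (D : ℝ) : Integrable (edg D) := (ind_int _ _).add (ind_int _ _)

lemma edg_integral {D : ℝ} (hD : 1 ≤ D) : ∫ u, edg D u = 4 * D⁻¹ := by
  have : 0 < D⁻¹ := by positivity
  unfold edg
  rw [integral_add (ind_int _ _) (ind_int _ _), integral_indicator measurableSet_Icc,
    integral_indicator measurableSet_Icc]
  simp only [integral_const, smul_eq_mul, mul_one, measureReal_restrict_apply MeasurableSet.univ, Set.univ_inter,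
    Real.volume_real_Icc]
  rw [max_eq_left (by linarith), max_eq_left (by linarith)]
  ring

lemma edg_cases {D : ℝ} (hD : 1 ≤ D) (u : ℝ) : (1 ≤ edg D u ∧ |u| ≤ 2) ∨ (1 < D * |u| ∧ 1 < D * |u - 1|) := by
  have hD0 : 0 < D := by linarith
  have hi : D⁻¹ ≤ 1 := inv_le_one_of_one_le₀ hD
  have n1 : 0 ≤ (Set.Icc (-D⁻¹) D⁻¹).indicator (fun _ => (1:ℝ)) u := Set.indicator_nonneg (fun _ _ => zero_le_one) _
  have n2 : 0 ≤ (Set.Icc (1 - D⁻¹) (1 + D⁻¹)).indicator (fun _ => (1:ℝ)) u :=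
    Set.indicator_nonneg (fun _ _ => zero_le_one) _
  by_cases h0 : 1 < D * |u|
  · by_cases h1 : 1 < D * |u - 1|
    · exact Or.inr ⟨h0, h1⟩
    · left
      have h : |u - 1| ≤ D⁻¹ := by rw [inv_eq_one_div, le_div_iff₀ hD0]; linarith
      rw [abs_le] at h
      refine ⟨?_, abs_le.mpr ⟨by linarith, by linarith⟩⟩
      have : u ∈ Set.Icc (1 - D⁻¹) (1 + D⁻¹) := ⟨by linarith, by linarith⟩
      unfold edg
      rw [Set.indicator_of_mem this]
      linarith
  · left
    have h : |u| ≤ D⁻¹ := by rw [inv_eq_one_div, le_div_iff₀ hD0]; linarith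
    rw [abs_le] at h
    refine ⟨?_, abs_le.mpr ⟨by linarith, by linarith⟩⟩
    have : u ∈ Set.Icc (-D⁻¹) D⁻¹ := h
    unfold edg
    rw [Set.indicator_of_mem this]
    linarith

lemma win_L1 (α : ℝ) (M : ℕ) : ∃ Q : ℝ, 0 ≤ Q ∧ ∀ D a : ℝ, 1 ≤ D → 0 ≤ a → a ≤ 1 → ∀ j ≤ M,
    ∫ u, ‖iteratedDeriv j (fun u => (win α D a u : ℂ)) u‖ ≤ Q * (1 + D ^ j * D⁻¹) := by
  obtain ⟨W, hW, hn⟩ := win_near α M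
  set W1 := (1 + |α|) ^ M * Real.exp (|α| * 2) with hW1
  have hW10 : 0 ≤ W1 := by positivity
  refine ⟨4 * (W1 + W), by positivity, ?_⟩
  intro D a hD ha0 ha1 j hj
  have hD0 : 0 < D := by linarith
  have hc : ∀ u, ‖iteratedDeriv j (fun u => (win α D a u : ℂ)) u‖ = ‖iteratedDeriv j (win α D a) u‖ := by
    intro u
    rw [← norm_iteratedFDeriv_eq_norm_iteratedDeriv, ← norm_iteratedFDeriv_eq_norm_iteratedDeriv]
    exact Complex.ofRealLI.norm_iteratedFDeriv_comp_left (f := win α D a) (n := ∞)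
      (win_smooth α D a).contDiffAt (by exact_mod_cast le_top)
  simp_rw [hc]
  have hpt : ∀ u, ‖iteratedDeriv j (win α D a) u‖ ≤
      W1 * (Set.Icc (-2:ℝ) 2).indicator (fun _ => (1:ℝ)) u + W * D ^ j * edg D u := by
    intro u
    have i0 : 0 ≤ (Set.Icc (-2:ℝ) 2).indicator (fun _ => (1:ℝ)) u := Set.indicator_nonneg (fun _ _ => zero_le_one) _
    have e0 := edg_nonneg D u
    rcases edg_cases hD u with ⟨h1, h2⟩ | ⟨h1, h2⟩
    · calc _ ≤ W * D ^ j := hn D a u hD h2 j hj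
        _ ≤ W * D ^ j * edg D u := le_mul_of_one_le_right (by positivity) h1
        _ ≤ _ := le_add_of_nonneg_left (by positivity)
    · refine (win_far hD ha0 ha1 j h1 h2).trans ?_
      refine le_trans ?_ (le_add_of_nonneg_right (by positivity))
      split_ifs with hu
      · rw [Set.indicator_of_mem (show u ∈ Set.Icc (-2:ℝ) 2 from abs_le.mp hu), mul_one, hW1]
        refine mul_le_mul_of_nonneg_right ?_ (Real.exp_pos _).le
        exact (pow_le_pow_left₀ (abs_nonneg _) (by linarith) j).trans
          (pow_le_pow_right₀ (by linarith [abs_nonneg α]) hj)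
      · positivity
  have hint1 := (ind_int (-2) 2).const_mul W1
  have hint2 := (edg_int D).const_mul (W * D ^ j)
  calc _ ≤ ∫ u, (W1 * (Set.Icc (-2:ℝ) 2).indicator (fun _ => (1:ℝ)) u + W * D ^ j * edg D u) :=
        integral_mono_of_nonneg (Eventually.of_forall fun u => norm_nonneg _) (hint1.add hint2)
          (Eventually.of_forall hpt)
    _ = W1 * 4 + W * D ^ j * (4 * D⁻¹) := by
        rw [integral_add hint1 hint2, integral_const_mul, integral_const_mul, edg_integral hD,
          integral_indicator measurableSet_Icc]
        simp only [integral_const, smul_eq_mul, mul_one, measureReal_restrict_apply MeasurableSet.univ, Set.univ_inter,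
          Real.volume_real_Icc]
        norm_num
    _ ≤ _ := by
        have : 0 ≤ D ^ j * D⁻¹ := by positivity
        nlinarith

lemma win_NM (α : ℝ) (n : ℕ) : ∃ q : ℝ, 0 ≤ q ∧ ∀ D a : ℝ, 1 ≤ D → 0 ≤ a → a ≤ 1 →
    NM 1 (fun u => (win α D a u : ℂ)) ≤ q ∧ NM (1 + 2 * n) (fun u => (win α D a u : ℂ)) ≤ q * D ^ (2 * n) := by
  obtain ⟨Q, hQ, h⟩ := win_L1 α (1 + 2 * n)
  refine ⟨(2 * n + 2) * (2 * Q), by positivity, fun D a hD ha0 ha1 => ?_⟩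
  have hD0 : 0 < D := by linarith
  have hb : ∀ j k : ℕ, j ≤ k + 1 → 1 + D ^ j * D⁻¹ ≤ 2 * D ^ k := by
    intro j k hjk
    have h1 : 1 ≤ D ^ k := one_le_pow₀ hD
    have h2 : D ^ j * D⁻¹ ≤ D ^ k := by
      rw [← div_eq_mul_inv, div_le_iff₀ hD0, ← pow_succ]
      exact pow_le_pow_right₀ hD hjk
    linarith
  have hk : ∀ M k : ℕ, M ≤ 1 + 2 * n → M ≤ k + 1 → NM M (fun u => (win α D a u : ℂ)) ≤ (M + 1) * (2 * Q) * D ^ k := by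
    intro M k hM hMk
    calc NM M (fun u => (win α D a u : ℂ)) ≤ ∑ j ∈ Finset.range (M + 1), 2 * Q * D ^ k := by
          refine Finset.sum_le_sum fun j hj => ?_
          have := Finset.mem_range.mp hj
          refine (h D a hD ha0 ha1 j (by omega)).trans ?_
          calc _ ≤ Q * (2 * D ^ k) := mul_le_mul_of_nonneg_left (hb j k (by omega)) hQ
            _ = _ := by ring
      _ = _ := by rw [Finset.sum_const, Finset.card_range, nsmul_eq_mul]; push_cast; ring
  constructor
  · refine (hk 1 0 (by omega) (by omega)).trans ?_
    rw [pow_zero, mul_one]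
    push_cast
    nlinarith [(Nat.cast_nonneg n : (0:ℝ) ≤ n)]
  · refine (hk (1 + 2 * n) (2 * n) le_rfl (by omega)).trans (le_of_eq ?_)
    push_cast; ring

/-- sharp window -/
def shp (s : Set ℝ) (α u : ℝ) : ℝ := s.indicator (fun u => Real.exp (-α * u)) u

lemma shp_nonneg (s : Set ℝ) (α u : ℝ) : 0 ≤ shp s α u := Set.indicator_nonneg (fun _ _ => (Real.exp_pos _).le) _

lemma shp_le (s : Set ℝ) (α u : ℝ) : shp s α u ≤ Real.exp (-α * u) :=
  Set.indicator_le_self' (fun _ _ => (Real.exp_pos _).le) _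

lemma win0_le {s : Set ℝ} (hs : Set.Ioo 0 1 ⊆ s) {α D u : ℝ} (hD : 1 ≤ D) : win α D 0 u ≤ shp s α u := by
  have hD0 : 0 < D := by linarith
  by_cases h : u ∈ Set.Ioo (0:ℝ) 1
  · rw [shp, Set.indicator_of_mem (hs h)]; exact win_le _ _ _ _
  · have : win α D 0 u = 0 := by
      rw [Set.mem_Ioo, not_and_or, not_lt, not_lt] at h
      rcases h with h | h
      · exact win_zero_left (by nlinarith)
      · exact win_zero_right (by nlinarith)
    rw [this]; exact shp_nonneg _ _ _

lemma le_win1 {s : Set ℝ} (hs : s ⊆ Set.Icc 0 1) {α D u : ℝ} (hD : 1 ≤ D) : shp s α u ≤ win α D 1 u := by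
  have hD0 : 0 < D := by linarith
  by_cases h : u ∈ s
  · obtain ⟨h0, h1⟩ := hs h
    rw [win_one (by nlinarith) (by nlinarith)]
    exact shp_le _ _ _
  · rw [shp, Set.indicator_of_notMem h]; exact win_nonneg _ _ _ _

lemma shp_far {s : Set ℝ} (hs : Set.Ioo 0 1 ⊆ s) (hs' : s ⊆ Set.Icc 0 1) {α D a u : ℝ} (hD : 1 ≤ D) (ha0 : 0 ≤ a)
    (ha1 : a ≤ 1) (h0 : 1 < D * |u|) (h1 : 1 < D * |u - 1|) : win α D a u = shp s α u := by
  have hD0 : 0 < D := by linarith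
  by_cases h : u ∈ s
  · obtain ⟨h0', h1'⟩ := hs' h
    rw [abs_of_nonneg h0'] at h0
    rw [abs_of_nonpos (by linarith)] at h1
    rw [win_one (by linarith) (by nlinarith), shp, Set.indicator_of_mem h]
  · rw [shp, Set.indicator_of_notMem h]
    have h' : u ∉ Set.Ioo (0:ℝ) 1 := fun hh => h (hs hh)
    rw [Set.mem_Ioo, not_and_or, not_lt, not_lt] at h'
    rcases h' with h' | h'
    · rw [abs_of_nonpos h'] at h0
      exact win_zero_left (by linarith)
    · rw [abs_of_nonneg (by linarith)] at h1
      exact win_zero_right (by linarith)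

lemma shp_int {s : Set ℝ} (hm : MeasurableSet s) (hs' : s ⊆ Set.Icc 0 1) (α : ℝ) :
    Integrable (fun u => shp s α u * Real.exp u) := by
  have : (fun u => shp s α u * Real.exp u) = s.indicator (fun u => Real.exp (-α * u) * Real.exp u) := by
    funext u
    unfold shp
    rw [Set.indicator_mul_left]
  rw [this, integrable_indicator_iff hm]
  refine IntegrableOn.mono_set ?_ hs'
  exact (by fun_prop : Continuous fun u : ℝ => Real.exp (-α * u) * Real.exp u).continuousOn.integrableOn_Icc

lemma win_main {s : Set ℝ} (hm : MeasurableSet s) (hs : Set.Ioo 0 1 ⊆ s) (hs' : s ⊆ Set.Icc 0 1) (α : ℝ) :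
    ∀ D a : ℝ, 1 ≤ D → 0 ≤ a → a ≤ 1 →
    |(∫ u, win α D a u * Real.exp u) - ∫ u, shp s α u * Real.exp u| ≤
      4 * (Real.exp (|α| * 2) * Real.exp 2) * D⁻¹ := by
  intro D a hD ha0 ha1
  have hwi : Integrable (fun u => win α D a u * Real.exp u) := by
    refine Continuous.integrable_of_hasCompactSupport ((win_smooth α D a).continuous.mul Real.continuous_exp) ?_
    refine HasCompactSupport.of_support_subset_isCompact (isCompact_Icc (a := (-2:ℝ)) (b := 2)) ?_
    intro u hu
    exact abs_le.mp (win_supp hD ha1 (left_ne_zero_of_mul hu))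
  rw [← integral_sub hwi (shp_int hm hs' α), ← Real.norm_eq_abs]
  have hb := norm_integral_le_of_norm_le (f := fun u => win α D a u * Real.exp u - shp s α u * Real.exp u)
    ((edg_int D).const_mul (Real.exp (|α| * 2) * Real.exp 2)) (Eventually.of_forall fun u => by
      rw [← sub_mul, norm_mul, Real.norm_eq_abs, Real.norm_of_nonneg (Real.exp_pos u).le]
      rcases edg_cases hD u with ⟨h1, h2⟩ | ⟨h1, h2⟩
      · refine le_trans ?_ (le_mul_of_one_le_right (by positivity) h1)
        refine mul_le_mul ?_ (Real.exp_le_exp.mpr (abs_le.mp h2).2) (Real.exp_pos _).le (Real.exp_pos _).le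
        refine le_trans ?_ (exp_bd α h2)
        rw [abs_le]
        constructor <;> linarith [win_nonneg α D a u, win_le α D a u, shp_nonneg s α u, shp_le s α u]
      · rw [shp_far hs hs' hD ha0 ha1 h1 h2, sub_self, abs_zero, zero_mul]
        have := edg_nonneg D u
        positivity)
  refine hb.trans (le_of_eq ?_)
  rw [integral_const_mul, edg_integral hD]
  ring

/-- The abstract sharp count. -/
lemma sharp_count {ι : Type*} {N : ι → ℝ} (hN : ∀ i, 1 ≤ N i) (hfin : ∀ B : ℝ, {i | N i ≤ B}.Finite)
    (n : ℕ) {c E : ℝ} (hc : 0 ≤ c) (hE : 0 ≤ E)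
    (H : ∀ φ : ℝ → ℝ, ContDiff ℝ ∞ φ →
      (∀ u, 0 ≤ φ u) → (∀ u, φ u ≠ 0 → |u| ≤ 4) → ∀ x q : ℝ, 1 ≤ x → 0 ≤ q →
      NM 1 (fun u => (φ u : ℂ)) ≤ q →
      NM (1 + 2 * n) (fun u => (φ u : ℂ)) ≤ q * (x ^ ((2:ℝ) / (n + 1))) ^ (2 * n) →
      |∑' i, φ (Real.log (N i / x)) - c * x * ∫ u, φ u * Real.exp u| ≤
      E * q * x ^ (((n : ℝ) - 1) / (n + 1))) (α : ℝ) : ∃ B : ℝ, 0 ≤ B ∧ ∀ s : Set ℝ, MeasurableSet s →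
      Set.Ioo 0 1 ⊆ s → s ⊆ Set.Icc 0 1 → ∀ x : ℝ, 1 ≤ x →
      |∑' i, shp s α (Real.log (N i / x)) - c * x * ∫ u, shp s α u * Real.exp u| ≤
        B * x ^ (((n : ℝ) - 1) / (n + 1)) := by
  obtain ⟨q, hq, hNM⟩ := win_NM α n
  set V := 4 * (Real.exp (|α| * 2) * Real.exp 2) with hV
  have hV0 : 0 ≤ V := by positivity
  refine ⟨E * q + c * V, by positivity, ?_⟩
  intro s hm hs hs' x hx
  have hx0 : 0 < x := by linarith
  set D := x ^ ((2:ℝ) / (n + 1)) with hD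
  have hD1 : 1 ≤ D := Real.one_le_rpow hx (by positivity)
  have hxD : x * D⁻¹ = x ^ (((n : ℝ) - 1) / (n + 1)) := by
    rw [hD, ← Real.rpow_neg hx0.le]
    conv_lhs => enter [1]; rw [← Real.rpow_one x]
    rw [← Real.rpow_add hx0]
    congr 1
    field_simp
    ring
  have hw : ∀ a : ℝ, 0 ≤ a → a ≤ 1 →
      |∑' i, win α D a (Real.log (N i / x)) - c * x * ∫ u, shp s α u * Real.exp u| ≤
        (E * q + c * V) * x ^ (((n : ℝ) - 1) / (n + 1)) := by
    intro a ha0 ha1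
    have h1 := H (win α D a) (win_smooth α D a) (win_nonneg α D a)
      (fun u hu => (win_supp hD1 ha1 hu).trans (by norm_num)) x q hx hq (hNM D a hD1 ha0 ha1).1 (hNM D a hD1 ha0 ha1).2
    have h2 := win_main hm hs hs' α D a hD1 ha0 ha1
    have h3 : |c * x * (∫ u, win α D a u * Real.exp u) - c * x * ∫ u, shp s α u * Real.exp u| ≤
        c * V * x ^ (((n : ℝ) - 1) / (n + 1)) := by
      rw [← mul_sub, abs_mul, abs_of_nonneg (by positivity : 0 ≤ c * x), ← hxD]
      calc _ ≤ c * x * (V * D⁻¹) := mul_le_mul_of_nonneg_left h2 (by positivity)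
        _ = _ := by ring
    calc _ ≤ _ := abs_sub_le _ (c * x * (∫ u, win α D a u * Real.exp u)) _
      _ ≤ _ := add_le_add h1 h3
      _ = _ := by ring
  have hsum : ∀ a : ℝ, a ≤ 1 → Summable fun i => win α D a (Real.log (N i / x)) := fun a ha =>
    summable_cut hN hfin 2 (fun u hu => win_supp hD1 ha hu) hx0
  have hsh : Summable fun i => shp s α (Real.log (N i / x)) := by
    refine summable_cut hN hfin 1 (fun u hu => ?_) hx0
    have : u ∈ s := Set.mem_of_indicator_ne_zero hu
    obtain ⟨h0, h1⟩ := hs' this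
    rw [abs_of_nonneg h0]; exact h1
  have l0 := (hsum 0 zero_le_one).tsum_le_tsum (fun i => win0_le hs hD1) hsh
  have l1 := hsh.tsum_le_tsum (fun i => le_win1 hs' hD1) (hsum 1 le_rfl)
  have w0 := abs_le.mp (hw 0 le_rfl zero_le_one)
  have w1 := abs_le.mp (hw 1 zero_le_one le_rfl)
  rw [abs_le]
  constructor <;> linarith [w0.1, w1.2]

end LandauTail

namespace LandauTail
set_option linter.unusedSectionVars false
open MeasureTheory
open scoped ContDiff

lemma int_exp_unit {β : ℝ} (hβ : β ≠ 0) : ∫ u in (0:ℝ)..1, Real.exp (β * u) = (Real.exp β - 1) / β := by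
  rw [intervalIntegral.integral_comp_mul_left (fun u => Real.exp u) hβ]
  simp [div_eq_inv_mul]

lemma shp_mul_exp (s : Set ℝ) (α : ℝ) :
    (fun u => shp s α u * Real.exp u) = s.indicator (fun u => Real.exp ((1 - α) * u)) := by
  funext u
  unfold shp
  by_cases h : u ∈ s
  · rw [Set.indicator_of_mem h, Set.indicator_of_mem h, ← Real.exp_add]
    congr 1; ring
  · rw [Set.indicator_of_notMem h, Set.indicator_of_notMem h, zero_mul]

lemma shp_val_Ioc {α : ℝ} (hα : α ≠ 1) :
    ∫ u, shp (Set.Ioc 0 1) α u * Real.exp u = (Real.exp (1 - α) - 1) / (1 - α) := by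
  rw [shp_mul_exp, integral_indicator measurableSet_Ioc, ← intervalIntegral.integral_of_le zero_le_one,
    int_exp_unit (sub_ne_zero.mpr hα.symm)]

lemma shp_val_Ico {α : ℝ} (hα : α ≠ 1) :
    ∫ u, shp (Set.Ico 0 1) α u * Real.exp u = (Real.exp (1 - α) - 1) / (1 - α) := by
  rw [shp_mul_exp, integral_indicator measurableSet_Ico, integral_Ico_eq_integral_Ioo,
    ← integral_Ioc_eq_integral_Ioo, ← intervalIntegral.integral_of_le zero_le_one,
    int_exp_unit (sub_ne_zero.mpr hα.symm)]

lemma log_shift {N x : ℝ} (hN : 0 < N) (hx : 0 < x) (k : ℕ) :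
    Real.log (N / (x * Real.exp k)) = Real.log (N / x) - k := by
  rw [Real.log_div hN.ne' (by positivity), Real.log_mul hx.ne' (Real.exp_ne_zero _), Real.log_exp,
    Real.log_div hN.ne' hx.ne']
  ring

lemma one_term {N x α : ℝ} (hN : 0 < N) (hx : 0 < x) :
    ∑' k : ℕ, ENNReal.ofReal (x ^ (-α) * Real.exp (-α * k) * shp (Set.Ico 0 1) α (Real.log (N / (x * Real.exp k)))) =
      ENNReal.ofReal (if x ≤ N then N ^ (-α) else 0) := by
  simp_rw [log_shift hN hx]
  by_cases h : x ≤ N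
  · have hL : 0 ≤ Real.log (N / x) := Real.log_nonneg ((one_le_div hx).mpr h)
    rw [if_pos h, tsum_eq_single ⌊Real.log (N / x)⌋₊]
    · congr 1
      have hm : Real.log (N / x) - (⌊Real.log (N / x)⌋₊ : ℝ) ∈ Set.Ico (0:ℝ) 1 := by
        constructor
        · linarith [Nat.floor_le hL]
        · linarith [Nat.lt_floor_add_one (Real.log (N / x))]
      rw [shp, Set.indicator_of_mem hm, mul_assoc, ← Real.exp_add]
      rw [Real.rpow_def_of_pos hx, Real.rpow_def_of_pos hN, ← Real.exp_add, Real.log_div hN.ne' hx.ne']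
      congr 1
      ring
    · intro k hk
      have hm : Real.log (N / x) - (k : ℝ) ∉ Set.Ico (0:ℝ) 1 := by
        rintro ⟨h1, h2⟩
        apply hk
        rw [eq_comm, Nat.floor_eq_iff hL]
        constructor <;> linarith
      rw [shp, Set.indicator_of_notMem hm, mul_zero, ENNReal.ofReal_zero]
  · rw [if_neg h, ENNReal.ofReal_zero]
    refine ENNReal.tsum_eq_zero.mpr fun k => ?_
    have hL : Real.log (N / x) < 0 := Real.log_neg (by positivity) ((div_lt_one hx).mpr (not_le.mp h))
    have hm : Real.log (N / x) - (k : ℝ) ∉ Set.Ico (0:ℝ) 1 := by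
      rintro ⟨h1, h2⟩
      linarith [(Nat.cast_nonneg k : (0:ℝ) ≤ k)]
    rw [shp, Set.indicator_of_notMem hm, mul_zero, ENNReal.ofReal_zero]

lemma shp_summable {ι : Type*} {N : ι → ℝ} (hN : ∀ i, 1 ≤ N i) (hfin : ∀ B : ℝ, {i | N i ≤ B}.Finite)
    {s : Set ℝ} (hs' : s ⊆ Set.Icc 0 1) (α : ℝ) {x : ℝ} (hx : 0 < x) :
    Summable fun i => shp s α (Real.log (N i / x)) := by
  refine summable_cut hN hfin 1 (fun u hu => ?_) hx
  have : u ∈ s := Set.mem_of_indicator_ne_zero hu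
  obtain ⟨h0, h1⟩ := hs' this
  rw [abs_of_nonneg h0]; exact h1

lemma tail_dyadic {ι : Type*} {N : ι → ℝ} (hN : ∀ i, 1 ≤ N i) (hfin : ∀ B : ℝ, {i | N i ≤ B}.Finite)
    (α : ℝ) {x : ℝ} (hx : 0 < x) :
    ∑' i, (if x ≤ N i then N i ^ (-α) else 0) =
      ∑' k : ℕ, x ^ (-α) * Real.exp (-α * k) * ∑' i, shp (Set.Ico 0 1) α (Real.log (N i / (x * Real.exp k))) := by
  have hN0 : ∀ i, 0 < N i := fun i => by linarith [hN i]
  have hsm : ∀ k : ℕ, Summable fun i => x ^ (-α) * Real.exp (-α * k) *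
      shp (Set.Ico 0 1) α (Real.log (N i / (x * Real.exp k))) := fun k =>
    (shp_summable hN hfin Set.Ico_subset_Icc_self α (by positivity)).mul_left _
  have h : ∑' i, ENNReal.ofReal (if x ≤ N i then N i ^ (-α) else 0) =
      ∑' k : ℕ, ∑' i, ENNReal.ofReal (x ^ (-α) * Real.exp (-α * k) *
        shp (Set.Ico 0 1) α (Real.log (N i / (x * Real.exp k)))) := by
    rw [ENNReal.tsum_comm]
    exact tsum_congr fun i => (one_term (hN0 i) hx).symm
  have h2 := congrArg ENNReal.toReal h
  rw [ENNReal.tsum_toReal_eq (fun _ => ENNReal.ofReal_ne_top),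
    ENNReal.tsum_toReal_eq (fun k => (hsm k).tsum_ofReal_ne_top)] at h2
  have e1 : ∀ i, (ENNReal.ofReal (if x ≤ N i then N i ^ (-α) else 0)).toReal = if x ≤ N i then N i ^ (-α) else 0 := by
    intro i
    refine ENNReal.toReal_ofReal ?_
    split_ifs
    · exact Real.rpow_nonneg (hN0 i).le _
    · exact le_rfl
  simp_rw [e1] at h2
  rw [h2]
  refine tsum_congr fun k => ?_
  rw [ENNReal.tsum_toReal_eq (fun _ => ENNReal.ofReal_ne_top), ← tsum_mul_left]
  refine tsum_congr fun i => ?_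
  have := shp_nonneg (Set.Ico 0 1) α (Real.log (N i / (x * Real.exp k)))
  exact ENNReal.toReal_ofReal (by positivity)

lemma tail_abstract {ι : Type*} {N : ι → ℝ} (hN : ∀ i, 1 ≤ N i) (hfin : ∀ B : ℝ, {i | N i ≤ B}.Finite)
    {α θ c B : ℝ} (hα : 1 < α) (hθ : θ < α) (hB : 0 ≤ B)
    (H : ∀ x : ℝ, 1 ≤ x → |∑' i, shp (Set.Ico 0 1) α (Real.log (N i / x)) -
      c * x * ∫ u, shp (Set.Ico 0 1) α u * Real.exp u| ≤ B * x ^ θ) :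
    ∃ C : ℝ, ∀ x : ℝ, 1 ≤ x → |∑' i, (if x ≤ N i then N i ^ (-α) else 0) - c / ((α - 1) * x ^ (α - 1))| ≤
      C * x ^ (θ - α) := by
  refine ⟨B * (1 - Real.exp (θ - α))⁻¹, fun x hx => ?_⟩
  have hx0 : 0 < x := by linarith
  rw [tail_dyadic hN hfin α hx0]
  set a : ℕ → ℝ := fun k => x ^ (-α) * Real.exp (-α * k) *
    ∑' i, shp (Set.Ico 0 1) α (Real.log (N i / (x * Real.exp k))) with ha
  set G := ∫ u, shp (Set.Ico 0 1) α u * Real.exp u with hG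
  have hr1 : Real.exp (1 - α) < 1 := by rw [Real.exp_lt_one_iff]; linarith
  have hr2 : Real.exp (θ - α) < 1 := by rw [Real.exp_lt_one_iff]; linarith
  set m : ℕ → ℝ := fun k => c * x ^ (1 - α) * G * Real.exp (1 - α) ^ k with hm
  have hms : HasSum m (c * x ^ (1 - α) * G * (1 - Real.exp (1 - α))⁻¹) :=
    (hasSum_geometric_of_lt_one (Real.exp_pos _).le hr1).mul_left _
  have hes : HasSum (fun k : ℕ => B * x ^ (θ - α) * Real.exp (θ - α) ^ k) (B * x ^ (θ - α) * (1 - Real.exp (θ - α))⁻¹) :=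
    (hasSum_geometric_of_lt_one (Real.exp_pos _).le hr2).mul_left _
  have hb : ∀ k, ‖a k - m k‖ ≤ B * x ^ (θ - α) * Real.exp (θ - α) ^ k := by
    intro k
    have hk : 1 ≤ Real.exp (k : ℝ) := Real.one_le_exp (Nat.cast_nonneg k)
    have h1 := H (x * Real.exp k) (by nlinarith)
    have e1 : m k = x ^ (-α) * Real.exp (-α * k) * (c * (x * Real.exp k) * G) := by
      rw [hm]
      simp only
      rw [← Real.exp_nat_mul, sub_eq_add_neg, Real.rpow_add hx0, Real.rpow_one,
        show (k : ℝ) * (1 + -α) = -α * k + k by ring, Real.exp_add]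
      ring
    have e2 : B * x ^ (θ - α) * Real.exp (θ - α) ^ k = x ^ (-α) * Real.exp (-α * k) * (B * (x * Real.exp k) ^ θ) := by
      rw [← Real.exp_nat_mul, sub_eq_add_neg, Real.rpow_add hx0, Real.mul_rpow hx0.le (Real.exp_pos _).le,
        ← Real.exp_mul, show (k : ℝ) * (θ + -α) = -α * k + k * θ by ring, Real.exp_add]
      ring
    rw [e1, e2, ha]
    simp only
    rw [← mul_sub, norm_mul, Real.norm_of_nonneg (by positivity : 0 ≤ x ^ (-α) * Real.exp (-α * k))]
    exact mul_le_mul_of_nonneg_left h1 (by positivity)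
  have hsum : Summable fun k => a k - m k := Summable.of_norm_bounded hes.summable hb
  have hfin2 := tsum_of_norm_bounded hes hb
  have hasum : ∑' k, a k = ∑' k, (a k - m k) + ∑' k, m k := by
    rw [← hsum.tsum_add hms.summable]
    exact tsum_congr fun k => by ring
  have hval : c * x ^ (1 - α) * G * (1 - Real.exp (1 - α))⁻¹ = c / ((α - 1) * x ^ (α - 1)) := by
    rw [hG, shp_val_Ico hα.ne']
    have h1 : 1 - Real.exp (1 - α) ≠ 0 := by linarith
    have h2 : (1 - α) ≠ 0 := by linarith
    have h3 : α - 1 ≠ 0 := by linarith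
    have h4 : x ^ (1 - α) = (x ^ (α - 1))⁻¹ := by rw [← Real.rpow_neg hx0.le]; congr 1; ring
    have h5 : 0 < x ^ (α - 1) := by positivity
    rw [h4]
    have h6 : (Real.exp (1 - α) - 1) / (1 - α) = (1 - Real.exp (1 - α)) / (α - 1) := by
      rw [div_eq_div_iff h2 h3]; ring
    rw [h6]
    field_simp
  rw [hasum, hms.tsum_eq, hval, add_sub_cancel_right, ← Real.norm_eq_abs]
  refine hfin2.trans (le_of_eq ?_)
  ring

lemma card_sum {ι : Type*} {N : ι → ℝ} (hfin : ∀ B : ℝ, {i | N i ≤ B}.Finite) (s : ℝ) :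
    HasSum (fun i => {i | N i ≤ s}.indicator (fun _ => (1:ℝ)) i) (Nat.card {i // N i ≤ s}) := by
  have hs : Summable (fun i => {i | N i ≤ s}.indicator (fun _ => (1:ℝ)) i) :=
    summable_of_hasFiniteSupport ((hfin s).subset fun i hi => Set.mem_of_indicator_ne_zero hi)
  have : ∑' i, {i | N i ≤ s}.indicator (fun _ => (1:ℝ)) i = (Nat.card {i // N i ≤ s} : ℝ) := by
    rw [← tsum_subtype, tsum_const, nsmul_eq_mul, mul_one]
    rfl
  rw [← this]
  exact hs.hasSum

lemma const_eq {ι : Type*} {N : ι → ℝ} (hN : ∀ i, 1 ≤ N i) (hfin : ∀ B : ℝ, {i | N i ≤ B}.Finite)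
    {θ c B κ : ℝ} (hθ : θ < 1)
    (H : ∀ x : ℝ, 1 ≤ x → |∑' i, shp (Set.Ioc 0 1) 0 (Real.log (N i / x)) -
      c * x * ∫ u, shp (Set.Ioc 0 1) 0 u * Real.exp u| ≤ B * x ^ θ)
    (hκ : Tendsto (fun s : ℝ => (Nat.card {i // N i ≤ s} : ℝ) / s) atTop (𝓝 κ)) : c = κ := by
  have hG := shp_val_Ioc (α := 0) (by norm_num)
  rw [sub_zero, div_one] at hG
  rw [hG] at H
  have he : 1 < Real.exp 1 := by rw [Real.one_lt_exp_iff]; exact one_pos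
  have hcount : ∀ x : ℝ, 0 < x → ∑' i, shp (Set.Ioc 0 1) 0 (Real.log (N i / x)) =
      (Nat.card {i // N i ≤ x * Real.exp 1} : ℝ) - Nat.card {i // N i ≤ x} := by
    intro x hx
    refine HasSum.tsum_eq ?_
    have h := (card_sum hfin (x * Real.exp 1)).sub (card_sum hfin x)
    have hfun : (fun i => shp (Set.Ioc 0 1) 0 (Real.log (N i / x))) = fun i =>
        {i | N i ≤ x * Real.exp 1}.indicator (fun _ => (1:ℝ)) i - {i | N i ≤ x}.indicator (fun _ => (1:ℝ)) i := by
      funext i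
      have hp : 0 < N i := by linarith [hN i]
      have hxe : x ≤ x * Real.exp 1 := le_mul_of_one_le_right hx.le he.le
      have k1 : 0 < Real.log (N i / x) ↔ x < N i := by
        rw [Real.log_pos_iff (by positivity), one_lt_div hx]
      have k2 : Real.log (N i / x) ≤ 1 ↔ N i ≤ x * Real.exp 1 := by
        rw [Real.log_le_iff_le_exp (by positivity), div_le_iff₀ hx, mul_comm]
      unfold shp
      simp only [Set.indicator_apply, Set.mem_Ioc, Set.mem_setOf_eq, k1, k2, neg_zero, zero_mul, Real.exp_zero]
      by_cases h1 : N i ≤ x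
      · rw [if_neg (fun h => absurd h.1 (not_lt.mpr h1)), if_pos (h1.trans hxe), if_pos h1]; simp
      · rw [if_neg h1]
        simp [not_le.mp h1]
    rw [hfun]
    exact h
  have t1 : Tendsto (fun x : ℝ => (∑' i, shp (Set.Ioc 0 1) 0 (Real.log (N i / x))) / x) atTop
      (𝓝 (κ * Real.exp 1 - κ)) := by
    have a1 : Tendsto (fun x : ℝ => x * Real.exp 1) atTop atTop := tendsto_id.atTop_mul_const (Real.exp_pos 1)
    have a2 := ((hκ.comp a1).mul_const (Real.exp 1)).sub hκ
    refine a2.congr' ?_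
    filter_upwards [eventually_gt_atTop 0] with x hx
    rw [hcount x hx]
    simp only [Function.comp]
    field_simp
  have t2 : Tendsto (fun x : ℝ => (∑' i, shp (Set.Ioc 0 1) 0 (Real.log (N i / x))) / x) atTop
      (𝓝 (c * (Real.exp 1 - 1))) := by
    rw [tendsto_iff_norm_sub_tendsto_zero]
    have a1 : Tendsto (fun x : ℝ => B * x ^ (-(1 - θ))) atTop (𝓝 0) := by
      have := (tendsto_rpow_neg_atTop (by linarith : 0 < 1 - θ)).const_mul B
      rwa [mul_zero] at this
    refine squeeze_zero' (Eventually.of_forall fun _ => norm_nonneg _) ?_ a1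
    filter_upwards [eventually_ge_atTop 1] with x hx
    have hx0 : 0 < x := by linarith
    have e : (∑' i, shp (Set.Ioc 0 1) 0 (Real.log (N i / x))) / x - c * (Real.exp 1 - 1) =
      (∑' i, shp (Set.Ioc 0 1) 0 (Real.log (N i / x)) - c * x * (Real.exp 1 - 1)) / x := by
      field_simp
    rw [e, norm_div, Real.norm_eq_abs, Real.norm_of_nonneg hx0.le, div_le_iff₀ hx0]
    refine (H x hx).trans (le_of_eq ?_)
    rw [mul_assoc, ← Real.rpow_add_one hx0.ne']
    congr 2
    ring
  have h := tendsto_nhds_unique t1 t2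
  have h2 : (κ - c) * (Real.exp 1 - 1) = 0 := by linarith
  rcases mul_eq_zero.mp h2 with h | h
  · linarith
  · linarith

end LandauTail

/-- For `α > 1`, `Σ_{0 ≠ m, N(m) ≥ x} N(m)^{-α} = κ/((α-1) x^{α-1}) +
O(x^{-(α-1+2/(n_K+1))})`. -/
theorem tail_sum_ideals_norm_rpow_neg
    (α : ℝ) (hα : 1 < α) :
    ∃ C : ℝ, ∀ x : ℝ, 2 ≤ x →
      |(∑' m : {m : Ideal (NumberField.RingOfIntegers K) //
          m ≠ 0 ∧ x ≤ (Ideal.absNorm m : ℝ)},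
        (Ideal.absNorm m.1 : ℝ) ^ (-α)) -
          kappa K / ((α - 1) * x ^ (α - 1))| ≤
      C * x ^ (-(α - 1 + 2 / ((Module.finrank ℚ K : ℝ) + 1))) := by
  obtain ⟨c, hc, E, hE, H⟩ := LandauTail.smooth_count K
  have hN := LandauTail.one_le_norm_ideal K
  have hfin := LandauTail.fin_ideals K
  have hn : (0:ℝ) < Module.finrank ℚ K := by exact_mod_cast Module.finrank_pos
  set n := Module.finrank ℚ K with hnd
  have hθ1 : ((n : ℝ) - 1) / (n + 1) < 1 := by
    rw [div_lt_one (by linarith)]; linarith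
  obtain ⟨B0, hB0, H0⟩ := LandauTail.sharp_count hN hfin n hc hE H 0
  obtain ⟨B, hB, H1⟩ := LandauTail.sharp_count hN hfin n hc hE H α
  have hck : c = kappa K := by
    refine LandauTail.const_eq hN hfin hθ1
      (fun x hx => H0 _ measurableSet_Ioc Set.Ioo_subset_Ioc_self Set.Ioc_subset_Icc_self x hx) ?_
    have h := NumberField.Ideal.tendsto_norm_le_div_atTop₀ K
    have e : kappa K = (2 ^ NumberField.InfinitePlace.nrRealPlaces K *
        (2 * Real.pi) ^ NumberField.InfinitePlace.nrComplexPlaces K * NumberField.Units.regulator K *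
        NumberField.classNumber K) /
        (NumberField.Units.torsionOrder K * Real.sqrt |(NumberField.discr K : ℝ)|) := by
      unfold kappa
      ring
    rw [e]
    exact h
  obtain ⟨C, hC⟩ := LandauTail.tail_abstract hN hfin hα (hθ1.trans hα) hB
    (fun x hx => H1 _ measurableSet_Ico Set.Ioo_subset_Ico_self Set.Ico_subset_Icc_self x hx)
  refine ⟨C, fun x hx => ?_⟩
  have h := hC x (by linarith)
  rw [hck] at h
  have hexp : ((n : ℝ) - 1) / (n + 1) - α = -(α - 1 + 2 / ((n : ℝ) + 1)) := by
    field_simp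
    ring
  rw [hexp] at h
  have hsum : (∑' m : {m : Ideal (NumberField.RingOfIntegers K) // m ≠ 0 ∧ x ≤ (Ideal.absNorm m : ℝ)},
        (Ideal.absNorm m.1 : ℝ) ^ (-α)) =
      ∑' I : nonZeroDivisors (Ideal (NumberField.RingOfIntegers K)),
        (if x ≤ (Ideal.absNorm (I : Ideal (NumberField.RingOfIntegers K)) : ℝ) then
          (Ideal.absNorm (I : Ideal (NumberField.RingOfIntegers K)) : ℝ) ^ (-α) else 0) := by
    have e1 := tsum_subtype {I : nonZeroDivisors (Ideal (NumberField.RingOfIntegers K)) |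
      x ≤ (Ideal.absNorm (I : Ideal (NumberField.RingOfIntegers K)) : ℝ)}
      (fun I => (Ideal.absNorm (I : Ideal (NumberField.RingOfIntegers K)) : ℝ) ^ (-α))
    have e2 : ∑' I : nonZeroDivisors (Ideal (NumberField.RingOfIntegers K)),
        (if x ≤ (Ideal.absNorm (I : Ideal (NumberField.RingOfIntegers K)) : ℝ) then
          (Ideal.absNorm (I : Ideal (NumberField.RingOfIntegers K)) : ℝ) ^ (-α) else 0) =
        ∑' I, {I : nonZeroDivisors (Ideal (NumberField.RingOfIntegers K)) |
      x ≤ (Ideal.absNorm (I : Ideal (NumberField.RingOfIntegers K)) : ℝ)}.indicator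
      (fun I => (Ideal.absNorm (I : Ideal (NumberField.RingOfIntegers K)) : ℝ) ^ (-α)) I := by
      refine tsum_congr fun I => ?_
      rw [Set.indicator_apply]
      rfl
    rw [e2, ← e1]
    let e : {m : Ideal (NumberField.RingOfIntegers K) // m ≠ 0 ∧ x ≤ (Ideal.absNorm m : ℝ)} ≃
        {I : nonZeroDivisors (Ideal (NumberField.RingOfIntegers K)) |
          x ≤ (Ideal.absNorm (I : Ideal (NumberField.RingOfIntegers K)) : ℝ)} :=
      { toFun := fun m => ⟨⟨m.1, mem_nonZeroDivisors_of_ne_zero m.2.1⟩, m.2.2⟩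
        invFun := fun I => ⟨I.1.1, nonZeroDivisors.ne_zero I.1.2, I.2⟩
        left_inv := fun m => rfl
        right_inv := fun I => rfl }
    exact e.tsum_eq (fun I : {I : nonZeroDivisors (Ideal (NumberField.RingOfIntegers K)) |
          x ≤ (Ideal.absNorm (I : Ideal (NumberField.RingOfIntegers K)) : ℝ)} =>
          (Ideal.absNorm (I.1 : Ideal (NumberField.RingOfIntegers K)) : ℝ) ^ (-α))
  rw [hsum]
  exact h

end
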